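/- Let Q be a rational, indefinite, nondegenerate quadratic form on ℝⁿ of signature (p,q) with p≥q≥1, n=p+q≥3, and let ξ∈ℝ. Define κ₀ by: κ₀=1 if (p,q)=(n−1,1); κ₀=2 if (p,q)=(2,2); κ₀=3/2 if (p,q)∈{(4,2),(3,3)}; κ₀=5/2 if (p,q)=(6,3); and for all other signatures with p≥q>1, κ₀=2κ₁q(p−1), where κ₁=1/n if n≡0 (mod 4), κ₁=1/(n−1) if n≡1 (mod 4), κ₁=1/(n−2) if n≡2 (mod 4), κ₁=1/(n+1) if n≡3 (mod 4). Then for every κ<κ₀ and for Lebesgue-almost every α∈ℝⁿ there exists t₀ such that for every t≥t₀ there is v∈ℤⁿ with ‖v‖≤t and |Q(v+α)−ξ|<t^{−κ}. -/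

import Mathlib

open MeasureTheory Matrix Filter
open scoped ENNReal Real

noncomputable section

instance {n : ℕ} : MeasurableSpace (Matrix (Fin n) (Fin n) ℝ) :=
  inferInstanceAs (MeasurableSpace (Fin n → Fin n → ℝ))

/-- The Euclidean norm of a vector in `ℝⁿ`. -/
def eunorm {n : ℕ} (v : Fin n → ℝ) : ℝ := Real.sqrt (∑ i, v i ^ 2)

/-- The operator norm of a matrix acting on Euclidean `ℝⁿ`. -/
def opNorm {n : ℕ} (g : Matrix (Fin n) (Fin n) ℝ) : ℝ :=
  ‖LinearMap.toContinuousLinearMap (Matrix.toEuclideanLin g)‖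

/-- The norm `‖g‖ := ‖g⁻¹‖_op` used for norm balls. -/
def mnorm {n : ℕ} (g : Matrix (Fin n) (Fin n) ℝ) : ℝ := opNorm g⁻¹

/-- `Q` is a nondegenerate quadratic form, represented by an invertible symmetric matrix. -/
def IsNondegQuadForm {n : ℕ} (Q : (Fin n → ℝ) → ℝ) : Prop :=
  ∃ J : Matrix (Fin n) (Fin n) ℝ, J.IsSymm ∧ IsUnit J.det ∧ ∀ v, Q v = v ⬝ᵥ J.mulVec v

/-- `Q` is proportional to a quadratic form with rational coefficients. -/
def IsRationalForm {n : ℕ} (Q : (Fin n → ℝ) → ℝ) : Prop :=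
  ∃ c : ℝ, c ≠ 0 ∧ ∃ J : Matrix (Fin n) (Fin n) ℚ,
    ∀ v, Q v = c * (v ⬝ᵥ (J.map (fun r => (r : ℝ))).mulVec v)

/-- `Q` has signature `(p,q)`: it is `GL_n(ℝ)`-equivalent to `v₁²+⋯+v_p²−v_{p+1}²−⋯−v_n²`. -/
def HasSignature {n : ℕ} (Q : (Fin n → ℝ) → ℝ) (p q : ℕ) : Prop :=
  p + q = n ∧ ∃ g : Matrix (Fin n) (Fin n) ℝ, IsUnit g.det ∧
    ∀ v, Q (vecMul v g) = ∑ i : Fin n, (if (i : ℕ) < p then (v i) ^ 2 else -((v i) ^ 2))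

/-- The special orthogonal group of `Q` (acting on row vectors). -/
def SOset {n : ℕ} (Q : (Fin n → ℝ) → ℝ) : Set (Matrix (Fin n) (Fin n) ℝ) :=
  {g | g.det = 1 ∧ ∀ v, Q (vecMul v g) = Q v}

/-- `SO⁺_Q(ℝ)`: the connected component of the identity in `SO_Q(ℝ)`. -/
def SOplus {n : ℕ} (Q : (Fin n → ℝ) → ℝ) : Set (Matrix (Fin n) (Fin n) ℝ) :=
  connectedComponentIn (SOset Q) 1

/-- `Γ = SO⁺_Q(ℤ) = SO⁺_Q(ℝ) ∩ SL_n(ℤ)`. -/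
def SOZ {n : ℕ} (Q : (Fin n → ℝ) → ℝ) : Set (Matrix (Fin n) (Fin n) ℝ) :=
  SOplus Q ∩ {g | ∀ i j, ∃ z : ℤ, g i j = (z : ℝ)}

/-- The norm ball `G_t = {g ∈ G : ‖g⁻¹‖_op ≤ t}` in `G = SO⁺_Q(ℝ)`. -/
def GballQ {n : ℕ} (Q : (Fin n → ℝ) → ℝ) (t : ℝ) : Set (Matrix (Fin n) (Fin n) ℝ) :=
  SOplus Q ∩ {g | mnorm g ≤ t}

/-- `μ` is a (left) Haar measure for the subgroup `G` of matrices: it is supported on `G`,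
left-invariant under `G`, positive on open sets meeting `G` and finite on compact sets. -/
structure IsHaarOn {n : ℕ} (G : Set (Matrix (Fin n) (Fin n) ℝ))
    (μ : Measure (Matrix (Fin n) (Fin n) ℝ)) : Prop where
  compl : μ Gᶜ = 0
  left_inv : ∀ g ∈ G, ∀ s : Set (Matrix (Fin n) (Fin n) ℝ),
    MeasurableSet s → μ ((g * ·) ⁻¹' s) = μ s
  open_pos : ∀ U : Set (Matrix (Fin n) (Fin n) ℝ), IsOpen U → (U ∩ G).Nonempty → 0 < μ U
  compact_fin : ∀ K : Set (Matrix (Fin n) (Fin n) ℝ), IsCompact K → μ K < ⊤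

/-- Multiplication in `G̃ = G ⋉ ℝⁿ` (row-vector convention): `(h,α)(g,v) = (hg, αg+v)`. -/
def tmul {n : ℕ} (x y : Matrix (Fin n) (Fin n) ℝ × (Fin n → ℝ)) :
    Matrix (Fin n) (Fin n) ℝ × (Fin n → ℝ) :=
  (x.1 * y.1, vecMul x.2 y.1 + y.2)

/-- The orbit relation of the right action of `Γ̃ = Γ ⋉ ℤⁿ` on `G̃`. -/
def latRel {n : ℕ} (Γ : Set (Matrix (Fin n) (Fin n) ℝ))
    (x y : Matrix (Fin n) (Fin n) ℝ × (Fin n → ℝ)) : Prop :=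
  ∃ γ ∈ Γ, ∃ u : Fin n → ℤ, y = tmul x (γ, fun i => (u i : ℝ))

/-- The quotient `G̃/Γ̃` (as a quotient of the ambient `Mat_n(ℝ) × ℝⁿ`). -/
def XQuot (n : ℕ) (Γ : Set (Matrix (Fin n) (Fin n) ℝ)) : Type :=
  Quot (latRel Γ)

instance (n : ℕ) (Γ : Set (Matrix (Fin n) (Fin n) ℝ)) : TopologicalSpace (XQuot n Γ) :=
  inferInstanceAs (TopologicalSpace (Quot _))

instance (n : ℕ) (Γ : Set (Matrix (Fin n) (Fin n) ℝ)) : MeasurableSpace (XQuot n Γ) := borel _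

/-- The left action of `(g,w) ∈ G̃` on `G̃/Γ̃`. -/
def actTG {n : ℕ} {Γ : Set (Matrix (Fin n) (Fin n) ℝ)} (g : Matrix (Fin n) (Fin n) ℝ)
    (w : Fin n → ℝ) : XQuot n Γ → XQuot n Γ :=
  Quot.map (fun x => (g * x.1, vecMul w x.1 + x.2)) (by
    rintro x y ⟨γ, hγ, u, rfl⟩
    refine ⟨γ, hγ, u, ?_⟩
    simp only [tmul, Prod.mk.injEq]
    constructor
    · rw [Matrix.mul_assoc]
    · rw [Matrix.add_vecMul, Matrix.vecMul_vecMul, add_assoc])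

/-- The left action of `g ∈ G` on `G̃/Γ̃`. -/
def actG {n : ℕ} {Γ : Set (Matrix (Fin n) (Fin n) ℝ)} (g : Matrix (Fin n) (Fin n) ℝ) :
    XQuot n Γ → XQuot n Γ := actTG g 0

/-- The averaging operator `β_S f (x) = (1/μ_G(S)) ∫_S f(g⁻¹x) dμ_G(g)`. -/
def avgOp {n : ℕ} {Γ : Set (Matrix (Fin n) (Fin n) ℝ)}
    (μG : Measure (Matrix (Fin n) (Fin n) ℝ)) (S : Set (Matrix (Fin n) (Fin n) ℝ))
    (f : XQuot n Γ → ℂ) (x : XQuot n Γ) : ℂ :=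
  (μG S).toReal⁻¹ • ∫ g in S, f (actG g⁻¹ x) ∂μG

/-- The unit cube `[0,1]ⁿ`, a fundamental domain for `ℝⁿ/ℤⁿ`. -/
def unitCube (n : ℕ) : Set (Fin n → ℝ) := Set.univ.pi fun _ => Set.Icc (0 : ℝ) 1

/-- Membership in `L²₀₀(G̃/Γ̃)`: the average of `f` over (almost) each fiber `ℝⁿ/ℤⁿ` vanishes. -/
def FiberAvgZero {n : ℕ} {Γ : Set (Matrix (Fin n) (Fin n) ℝ)}
    (μG : Measure (Matrix (Fin n) (Fin n) ℝ)) (f : XQuot n Γ → ℂ) : Prop :=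
  ∀ᵐ g ∂μG, ∫ w in unitCube n, f (Quot.mk (latRel Γ) (g, w)) = 0

/-- The exponent `κ₁` from Theorem 1.3 (property (T) cases). -/
def kappa1 (n : ℕ) : ℝ :=
  if n % 4 = 0 then 1 / n
  else if n % 4 = 1 then 1 / ((n : ℝ) - 1)
  else if n % 4 = 2 then 1 / ((n : ℝ) - 2)
  else 1 / ((n : ℝ) + 1)

/-- The exponent `κ₀` of Theorem 1.1, depending only on the signature `(p,q)`. -/
def kappa0 (p q : ℕ) : ℝ :=
  if q = 1 then 1
  else if (p, q) = (2, 2) then 2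
  else if (p, q) = (4, 2) ∨ (p, q) = (3, 3) then 3 / 2
  else if (p, q) = (6, 3) then 5 / 2
  else 2 * kappa1 (p + q) * q * ((p : ℝ) - 1)

/-- The divisor bound `d(n) ≪ n ^ ε`. -/
theorem exists_card_divisors_le_rpow {ε : ℝ} (hε : 0 < ε) :
    ∃ C : ℝ, 1 ≤ C ∧ ∀ n : ℕ, n ≠ 0 → (n.divisors.card : ℝ) ≤ C * (n : ℝ) ^ ε := by
  set K : ℝ := max 1 (1 / (ε * Real.log 2)) with hK
  have hK1 : 1 ≤ K := le_max_left _ _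
  set B : ℕ := ⌈(2 : ℝ) ^ (1 / ε)⌉₊ with hB
  have hlog : 0 < ε * Real.log 2 := mul_pos hε (Real.log_pos (by norm_num))
  refine ⟨K ^ B, one_le_pow₀ hK1, fun n hn => ?_⟩
  have key : ∀ p ∈ n.primeFactors, ((n.factorization p + 1 : ℕ) : ℝ) ≤
      (if p < B then K else 1) * ((p : ℝ) ^ (n.factorization p)) ^ ε := by
    intro p hp
    have hp2 : 2 ≤ p := (Nat.prime_of_mem_primeFactors hp).two_le
    have hp2' : (2 : ℝ) ≤ p := by exact_mod_cast hp2
    set a := n.factorization p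
    have hcomm : ((p : ℝ) ^ a) ^ ε = ((p : ℝ) ^ ε) ^ a := by
      rw [← Real.rpow_natCast, ← Real.rpow_natCast, ← Real.rpow_mul (by positivity),
        ← Real.rpow_mul (by positivity), mul_comm]
    split_ifs with h
    · have h1 : ((2 : ℝ) ^ ε) ^ a ≤ ((p : ℝ) ^ a) ^ ε := by
        rw [hcomm]; gcongr
      have h2 : 1 + a * (ε * Real.log 2) ≤ ((2 : ℝ) ^ ε) ^ a := by
        rw [Real.rpow_def_of_pos (by norm_num : (0 : ℝ) < 2), ← Real.exp_nat_mul]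
        have := Real.add_one_le_exp ((a : ℝ) * (Real.log 2 * ε))
        nlinarith
      have h3 : ((a + 1 : ℕ) : ℝ) ≤ K * (1 + a * (ε * Real.log 2)) := by
        have h4 : 1 ≤ K * (ε * Real.log 2) := by
          calc (1 : ℝ) = 1 / (ε * Real.log 2) * (ε * Real.log 2) := by field_simp
            _ ≤ _ := by gcongr; exact le_max_right _ _
        push_cast
        have : (0 : ℝ) ≤ a := by positivity
        nlinarith
      exact h3.trans (by gcongr; exact h2.trans h1)
    · have hpB : (2 : ℝ) ^ (1 / ε) ≤ p := (Nat.le_ceil _).trans (by exact_mod_cast not_lt.1 h)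
      have h1 : (2 : ℝ) ≤ (p : ℝ) ^ ε := by
        calc (2 : ℝ) = ((2 : ℝ) ^ (1 / ε)) ^ ε := by
              rw [← Real.rpow_mul (by norm_num)]; field_simp; simp
          _ ≤ _ := by gcongr
      rw [hcomm, one_mul]
      calc ((a + 1 : ℕ) : ℝ) ≤ (2 : ℝ) ^ a := by exact_mod_cast Nat.lt_two_pow_self
        _ ≤ _ := by gcongr
  rw [Nat.card_divisors hn]
  push_cast at key ⊢
  calc ∏ p ∈ n.primeFactors, ((n.factorization p : ℝ) + 1)
      ≤ ∏ p ∈ n.primeFactors, ((if p < B then K else 1) * ((p : ℝ) ^ (n.factorization p)) ^ ε) :=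
        Finset.prod_le_prod (fun _ _ => by positivity) key
    _ = (∏ p ∈ n.primeFactors, (if p < B then K else 1)) * (n : ℝ) ^ ε := by
        rw [Finset.prod_mul_distrib, Real.finsetProd_rpow _ _ (fun _ _ => by positivity)]
        congr 2
        conv_rhs => rw [← Nat.prod_factorization_pow_eq_self hn]
        rw [Finsupp.prod]
        push_cast
        rfl
    _ ≤ K ^ B * (n : ℝ) ^ ε := by
        gcongr
        rw [← Finset.prod_filter, Finset.prod_const]
        refine pow_le_pow_right₀ hK1 ?_
        calc _ ≤ (Finset.range B).card := Finset.card_le_card fun p hp => by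
              simpa using (Finset.mem_filter.1 hp).2
          _ = B := by simp

/-- Two primitive representations of `N` by `x ^ 2 + c * y ^ 2` lying in the same residue class
have cross product divisible by `N`, up to a bounded factor. -/
theorem dvd_four_mul_cross_of_gcd_eq {c N x₀ y₀ x y x' y' : ℤ} (hN : 0 < N)
    (h₀ : x₀ ^ 2 + c * y₀ ^ 2 = N) (h : x ^ 2 + c * y ^ 2 = N)
    (hp₀ : IsCoprime x₀ y₀) (hp : IsCoprime x y)
    (h' : x' ^ 2 + c * y' ^ 2 = N)
    (hg : (x * y₀ - x₀ * y).gcd N = (x' * y₀ - x₀ * y').gcd N) :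
    N ∣ 4 * c * (x * y' - x' * y) := by
  have cop : ∀ {u v : ℤ}, IsCoprime u v → u ^ 2 + c * v ^ 2 = N → IsCoprime v N := by
    intro u v huv e
    rw [← e]
    have : IsCoprime v (u ^ 2) := (huv.symm).pow_right
    have := this.add_mul_left_right (c * v)
    rwa [show u ^ 2 + v * (c * v) = u ^ 2 + c * v ^ 2 by ring] at this
  have hy₀ := cop hp₀ h₀
  have hy := cop hp h
  set d : ℤ := ((x * y₀ - x₀ * y).gcd N : ℤ) with hd
  have hdN : d ∣ N := Int.gcd_dvd_right _ _
  obtain ⟨e, he⟩ := hdN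
  have hd0 : d ≠ 0 := by rintro h0; rw [h0] at he; simp at he; omega
  have main : ∀ {u v : ℤ}, u ^ 2 + c * v ^ 2 = N → d = ((u * y₀ - x₀ * v).gcd N : ℤ) →
      d ∣ u * y₀ - x₀ * v ∧ e ∣ u * y₀ + x₀ * v := by
    intro u v huv hd'
    have h1 : d ∣ u * y₀ - x₀ * v := hd' ▸ Int.gcd_dvd_left _ _
    refine ⟨h1, ?_⟩
    obtain ⟨w, hw⟩ := h1
    have h2 : IsCoprime w e := by
      have h3 := Int.gcd_eq_gcd_ab (u * y₀ - x₀ * v) N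
      rw [← hd'] at h3
      refine ⟨(u * y₀ - x₀ * v).gcdA N, (u * y₀ - x₀ * v).gcdB N, ?_⟩
      apply mul_left_cancel₀ hd0
      rw [mul_one]
      linear_combination -h3 - (u * y₀ - x₀ * v).gcdA N * hw - (u * y₀ - x₀ * v).gcdB N * he
    have h4 : d * e ∣ d * (w * (u * y₀ + x₀ * v)) := by
      refine ⟨y₀ ^ 2 - v ^ 2, ?_⟩
      rw [← mul_assoc, ← hw, ← he]
      linear_combination y₀ ^ 2 * huv - v ^ 2 * h₀
    exact (h2.symm).dvd_of_dvd_mul_left ((mul_dvd_mul_iff_left hd0).1 h4)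
  obtain ⟨h1, h2⟩ := main h rfl
  obtain ⟨h1', h2'⟩ := main h' (by rw [hd, hg])
  have hdN : d ∣ N := ⟨e, he⟩
  have heN : e ∣ N := ⟨d, by rw [he]; ring⟩
  have hW1 : d ∣ x * y' - x' * y := by
    have : d ∣ y₀ * (x * y' - x' * y) := by
      have := dvd_sub (h1.mul_right y') (h1'.mul_right y)
      rwa [show (x * y₀ - x₀ * y) * y' - (x' * y₀ - x₀ * y') * y
        = y₀ * (x * y' - x' * y) by ring] at this
    exact (hy₀.of_isCoprime_of_dvd_right hdN).symm.dvd_of_dvd_mul_left this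
  have hW2 : e ∣ x * y' - x' * y := by
    have : e ∣ y₀ * (x * y' - x' * y) := by
      have := dvd_sub (h2.mul_right y') (h2'.mul_right y)
      rwa [show (x * y₀ + x₀ * y) * y' - (x' * y₀ + x₀ * y') * y
        = y₀ * (x * y' - x' * y) by ring] at this
    exact (hy₀.of_isCoprime_of_dvd_right heN).symm.dvd_of_dvd_mul_left this
  set g : ℤ := (d.gcd e : ℤ) with hgdef
  have hgd : g ∣ d := Int.gcd_dvd_left _ _
  have hge : g ∣ e := Int.gcd_dvd_right _ _
  have hgx : g ∣ 2 * x := by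
    have : g ∣ y₀ * (2 * x) := by
      have := dvd_add (hgd.trans h1) (hge.trans h2)
      rwa [show x * y₀ - x₀ * y + (x * y₀ + x₀ * y) = y₀ * (2 * x) by ring] at this
    exact (hy₀.of_isCoprime_of_dvd_right (hgd.trans hdN)).symm.dvd_of_dvd_mul_left this
  have hg2 : g ^ 2 ∣ 4 * c := by
    have h5 : g ^ 2 ∣ N := by rw [he, sq]; exact mul_dvd_mul hgd hge
    have h6 : g ^ 2 ∣ (2 * x) ^ 2 := pow_dvd_pow_of_dvd hgx 2
    have h7 : g ^ 2 ∣ y ^ 2 * (4 * c) := by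
      have := dvd_sub (h5.mul_left 4) h6
      rwa [show 4 * N - (2 * x) ^ 2 = y ^ 2 * (4 * c) by linear_combination -4 * h] at this
    have h8 : IsCoprime (g ^ 2) (y ^ 2) :=
      ((hy.of_isCoprime_of_dvd_right (hgd.trans hdN)).symm).pow
    exact h8.dvd_of_dvd_mul_left h7
  have hg4 : g ∣ 4 * c := (dvd_pow_self g two_ne_zero).trans hg2
  have hgN : N ∣ g * (x * y' - x' * y) := by
    rw [hgdef, Int.gcd_eq_gcd_ab, add_mul, he]
    refine dvd_add ?_ ?_
    · have : d * e ∣ d * (x * y' - x' * y) := mul_dvd_mul_left _ hW2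
      rw [show d * d.gcdA e * (x * y' - x' * y) = d * (x * y' - x' * y) * d.gcdA e by ring]
      exact this.mul_right _
    · have : d * e ∣ (x * y' - x' * y) * e := mul_dvd_mul_right hW1 _
      rw [show e * d.gcdB e * (x * y' - x' * y) = (x * y' - x' * y) * e * d.gcdB e by ring]
      exact this.mul_right _
  exact hgN.trans (mul_dvd_mul_right hg4 _)

theorem card_primitive_repr_le {c : ℤ} (hc : 0 < c) {N : ℕ} (hN : 0 < N) (s : Finset (ℤ × ℤ))
    (hs : ∀ z ∈ s, z.1 ^ 2 + c * z.2 ^ 2 = N ∧ IsCoprime z.1 z.2) :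
    s.card ≤ (8 * c + 1).toNat * 3 * N.divisors.card := by
  rcases s.eq_empty_or_nonempty with rfl | ⟨z₀, hz₀⟩
  · simp
  obtain ⟨h₀, hp₀⟩ := hs z₀ hz₀
  have hN' : (0 : ℤ) < N := by exact_mod_cast hN
  refine Finset.card_le_mul_card_image_of_maps_to
    (f := fun z => (z.1 * z₀.2 - z₀.1 * z.2).gcd N) (fun z _ => ?_) _ (fun d _ => ?_)
  · exact Nat.mem_divisors.2 ⟨by exact_mod_cast Int.gcd_dvd_right _ (N : ℤ), hN.ne'⟩
  set F := s.filter fun z => (z.1 * z₀.2 - z₀.1 * z.2).gcd N = d with hF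
  rcases F.eq_empty_or_nonempty with h | ⟨z₁, hz₁⟩
  · rw [h]; simp
  obtain ⟨hz₁s, hz₁d⟩ := Finset.mem_filter.1 hz₁
  obtain ⟨h₁, hp₁⟩ := hs z₁ hz₁s
  have facts : ∀ z ∈ F, z.1 ^ 2 + c * z.2 ^ 2 = N ∧
      (N : ℤ) ∣ 4 * c * (z.1 * z₁.2 - z₁.1 * z.2) := by
    intro z hz
    obtain ⟨hzs, hzd⟩ := Finset.mem_filter.1 hz
    obtain ⟨h, hp⟩ := hs z hzs
    exact ⟨h, dvd_four_mul_cross_of_gcd_eq hN' h₀ h hp₀ hp h₁ (by rw [hzd, hz₁d])⟩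
  have ident : ∀ z ∈ F, (z.1 * z₁.1 + c * z.2 * z₁.2) ^ 2 +
      c * (z.1 * z₁.2 - z₁.1 * z.2) ^ 2 = (N : ℤ) ^ 2 := by
    intro z hz
    have h := (facts z hz).1
    calc _ = (z.1 ^ 2 + c * z.2 ^ 2) * (z₁.1 ^ 2 + c * z₁.2 ^ 2) := by ring
      _ = _ := by rw [h, h₁]; ring
  have hcard : (Finset.Icc (-(4 * c)) (4 * c) ×ˢ ({-1, 0, 1} : Finset ℤ)).card =
      (8 * c + 1).toNat * 3 := by
    rw [Finset.card_product, Int.card_Icc]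
    congr 2; ring
  rw [← hcard]
  refine Finset.card_le_card_of_injOn
    (fun z => (4 * c * (z.1 * z₁.2 - z₁.1 * z.2) / N, (z.1 * z₁.1 + c * z.2 * z₁.2).sign))
    (fun z hz => ?_) (fun z hz w hw hzw => ?_)
  · have hid := ident z hz
    obtain ⟨h, k, hk⟩ := facts z hz
    have hW : |z.1 * z₁.2 - z₁.1 * z.2| ≤ N := by
      apply abs_le_of_sq_le_sq _ hN'.le
      nlinarith [sq_nonneg (z.1 * z₁.1 + c * z.2 * z₁.2),
        sq_nonneg (z.1 * z₁.2 - z₁.1 * z.2)]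
    have hkb : |k| ≤ 4 * c := by
      have : (N : ℤ) * |k| ≤ N * (4 * c) := by
        calc (N : ℤ) * |k| = |(N : ℤ) * k| := by rw [abs_mul, abs_of_pos hN']
          _ = 4 * c * |z.1 * z₁.2 - z₁.1 * z.2| := by
              rw [← hk, abs_mul, abs_of_pos (by positivity : 0 < 4 * c)]
          _ ≤ 4 * c * N := by gcongr
          _ = _ := by ring
      exact le_of_mul_le_mul_left this hN'
    have : 4 * c * (z.1 * z₁.2 - z₁.1 * z.2) / N = k := by
      rw [hk]; exact Int.mul_ediv_cancel_left _ hN'.ne'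
    simp only [Finset.coe_product, Set.mem_prod, Finset.mem_coe, Finset.mem_Icc, this]
    refine ⟨abs_le.1 hkb, ?_⟩
    rcases Int.sign_trichotomy (z.1 * z₁.1 + c * z.2 * z₁.2) with h | h | h <;> simp [h]
  · simp only [Prod.mk.injEq] at hzw
    obtain ⟨e1, e2⟩ := hzw
    have hW : z.1 * z₁.2 - z₁.1 * z.2 = w.1 * z₁.2 - z₁.1 * w.2 := by
      obtain ⟨k, hk⟩ := (facts z hz).2
      obtain ⟨l, hl⟩ := (facts w hw).2
      rw [hk, hl, Int.mul_ediv_cancel_left _ hN'.ne', Int.mul_ediv_cancel_left _ hN'.ne'] at e1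
      have : 4 * c * (z.1 * z₁.2 - z₁.1 * z.2) = 4 * c * (w.1 * z₁.2 - z₁.1 * w.2) := by
        rw [hk, hl, e1]
      exact mul_left_cancel₀ (by positivity) this
    have hV : z.1 * z₁.1 + c * z.2 * z₁.2 = w.1 * z₁.1 + c * w.2 * z₁.2 := by
      have h1 := ident z hz
      have h2 := ident w hw
      rw [hW] at h1
      have h3 : |z.1 * z₁.1 + c * z.2 * z₁.2| = |w.1 * z₁.1 + c * w.2 * z₁.2| := by
        apply (sq_eq_sq_iff_abs_eq_abs _ _).1; linarith
      rw [← Int.sign_mul_abs (z.1 * z₁.1 + c * z.2 * z₁.2), e2, h3, Int.sign_mul_abs]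
    have hx : (N : ℤ) * z.1 = N * w.1 := by
      rw [← h₁]; linear_combination z₁.1 * hV + c * z₁.2 * hW
    have hy : (N : ℤ) * z.2 = N * w.2 := by
      rw [← h₁]; linear_combination z₁.2 * hV - z₁.1 * hW
    exact Prod.ext (mul_left_cancel₀ hN'.ne' hx) (mul_left_cancel₀ hN'.ne' hy)

theorem card_repr_le {c : ℤ} (hc : 0 < c) {N : ℕ} (hN : 0 < N) (s : Finset (ℤ × ℤ))
    (hs : ∀ z ∈ s, z.1 ^ 2 + c * z.2 ^ 2 = N) :
    s.card ≤ (8 * c + 1).toNat * 3 * N.divisors.card ^ 2 := by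
  have hN' : (0 : ℤ) < N := by exact_mod_cast hN
  rw [sq, ← mul_assoc]
  have hdvd : ∀ z ∈ s, ((z.1.gcd z.2 : ℕ) : ℤ) ^ 2 ∣ N := fun z hz => by
    rw [← hs z hz]
    exact dvd_add (pow_dvd_pow_of_dvd (Int.gcd_dvd_left _ _) 2)
      ((pow_dvd_pow_of_dvd (Int.gcd_dvd_right _ _) 2).mul_left _)
  refine Finset.card_le_mul_card_image_of_maps_to (f := fun z => z.1.gcd z.2)
    (fun z hz => ?_) _ (fun g hg => ?_)
  · refine Nat.mem_divisors.2 ⟨?_, hN.ne'⟩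
    have := (dvd_pow_self _ two_ne_zero).trans (hdvd z hz)
    exact_mod_cast this
  set F := s.filter fun z => z.1.gcd z.2 = g with hF
  rcases F.eq_empty_or_nonempty with h | ⟨z₁, hz₁⟩
  · rw [h]; simp
  have hg0 : 0 < g := Nat.pos_of_mem_divisors hg
  have hg0' : (g : ℤ) ≠ 0 := by exact_mod_cast hg0.ne'
  have hgN : g ^ 2 ∣ N := by
    obtain ⟨hz₁s, hz₁d⟩ := Finset.mem_filter.1 hz₁
    have := hdvd z₁ hz₁s
    rw [hz₁d] at this
    exact_mod_cast this
  obtain ⟨M, hM⟩ := hgN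
  have hM0 : 0 < M := Nat.pos_of_ne_zero (by rintro rfl; simp at hM; omega)
  have fact : ∀ z ∈ F, (g : ℤ) * (z.1 / g) = z.1 ∧ (g : ℤ) * (z.2 / g) = z.2 := by
    intro z hz
    have := (Finset.mem_filter.1 hz).2
    exact ⟨Int.mul_ediv_cancel' (this ▸ Int.gcd_dvd_left _ _),
      Int.mul_ediv_cancel' (this ▸ Int.gcd_dvd_right _ _)⟩
  have inj : Set.InjOn (fun z : ℤ × ℤ => (z.1 / (g : ℤ), z.2 / (g : ℤ))) F := by
    intro z hz w hw hzw
    simp only [Prod.mk.injEq] at hzw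
    ext
    · rw [← (fact z hz).1, ← (fact w hw).1, hzw.1]
    · rw [← (fact z hz).2, ← (fact w hw).2, hzw.2]
  rw [← Finset.card_image_of_injOn inj]
  refine (card_primitive_repr_le hc hM0 _ ?_).trans ?_
  · intro w hw
    obtain ⟨z, hz, rfl⟩ := Finset.mem_image.1 hw
    obtain ⟨hzs, hzd⟩ := Finset.mem_filter.1 hz
    obtain ⟨f1, f2⟩ := fact z hz
    constructor
    · have := hs z hzs
      rw [hM, ← f1, ← f2] at this
      push_cast at this
      apply mul_left_cancel₀ (pow_ne_zero 2 hg0')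
      dsimp only
      linear_combination this
    · rw [Int.isCoprime_iff_gcd_eq_one]
      dsimp only
      have := Int.gcd_div_gcd_div_gcd (i := z.1) (j := z.2) (by omega)
      rwa [hzd] at this
  · gcongr
    exact ⟨g ^ 2, by rw [hM]; ring⟩

/-- A definite binary form represents each integer few times in a box. -/
theorem exists_card_binary_le {a b : ℤ} (hab : 0 < a * b) {ε : ℝ} (hε : 0 < ε) :
    ∃ C : ℝ, 1 ≤ C ∧ ∀ (N : ℤ) (M : ℕ) (s : Finset (ℤ × ℤ)), 1 ≤ M →
      (∀ z ∈ s, a * z.1 ^ 2 + b * z.2 ^ 2 = N ∧ |z.1| ≤ M ∧ |z.2| ≤ M) →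
      (s.card : ℝ) ≤ C * (M : ℝ) ^ ε := by
  obtain ⟨C, hC, hdiv⟩ := exists_card_divisors_le_rpow (show (0 : ℝ) < ε / 4 by positivity)
  set K : ℝ := (((8 * (a * b) + 1).toNat * 3 : ℕ) : ℝ) with hK
  have hK1 : 1 ≤ K := by rw [hK]; exact_mod_cast by omega
  have ha : a ≠ 0 := by rintro rfl; simp at hab
  set L : ℝ := ((a ^ 2 + a * b : ℤ) : ℝ) with hL
  have hL0 : 1 ≤ L := by rw [hL]; exact_mod_cast by nlinarith [sq_nonneg a]
  have hCL : 1 ≤ (C * L ^ (ε / 4)) ^ 2 :=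
    one_le_pow₀ (one_le_mul_of_one_le_of_one_le hC (Real.one_le_rpow hL0 (by positivity)))
  refine ⟨K * (C * L ^ (ε / 4)) ^ 2, one_le_mul_of_one_le_of_one_le hK1 hCL, ?_⟩
  intro N M s hM hs
  have hM1 : (1 : ℝ) ≤ M := by exact_mod_cast hM
  have hMε : (1 : ℝ) ≤ (M : ℝ) ^ ε := Real.one_le_rpow hM1 hε.le
  have hbig : (1 : ℝ) ≤ K * (C * L ^ (ε / 4)) ^ 2 * (M : ℝ) ^ ε :=
    one_le_mul_of_one_le_of_one_le (one_le_mul_of_one_le_of_one_le hK1 hCL) hMε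
  have ident : ∀ z ∈ s, (a * z.1) ^ 2 + a * b * z.2 ^ 2 = a * N := fun z hz => by
    rw [← (hs z hz).1]; ring
  rcases lt_trichotomy (a * N) 0 with hN | hN | hN
  · have : s = ∅ := Finset.eq_empty_of_forall_notMem fun z hz => by
      have := ident z hz
      nlinarith [sq_nonneg (a * z.1), sq_nonneg z.2]
    rw [this]; simp; positivity
  · have : s.card ≤ 1 := Finset.card_le_one.2 fun z hz w hw => by
      have zero : ∀ z ∈ s, z = 0 := by
        intro z hz
        have h := ident z hz
        rw [hN] at h
        have h1 : z.2 ^ 2 = 0 := by nlinarith [sq_nonneg (a * z.1), sq_nonneg z.2]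
        have h2 : (a * z.1) ^ 2 = 0 := by nlinarith [sq_nonneg (a * z.1), sq_nonneg z.2]
        have h3 : z.1 = 0 := by
          rcases mul_eq_zero.1 (pow_eq_zero_iff two_ne_zero |>.1 h2) with h | h
          · exact absurd h ha
          · exact h
        exact Prod.ext h3 (pow_eq_zero_iff two_ne_zero |>.1 h1)
      rw [zero z hz, zero w hw]
    exact le_trans (by exact_mod_cast this) hbig
  · obtain ⟨R, hR⟩ := Int.eq_ofNat_of_zero_le hN.le
    have hR0 : 0 < R := by omega
    rcases s.eq_empty_or_nonempty with rfl | ⟨z₀, hz₀⟩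
    · simp; positivity
    have hRM : (R : ℝ) ≤ L * (M : ℝ) ^ 2 := by
      have h := ident z₀ hz₀
      obtain ⟨-, h1, h2⟩ := hs z₀ hz₀
      have h1' : z₀.1 ^ 2 ≤ (M : ℤ) ^ 2 := sq_le_sq' (abs_le.1 h1).1 (abs_le.1 h1).2
      have h2' : z₀.2 ^ 2 ≤ (M : ℤ) ^ 2 := sq_le_sq' (abs_le.1 h2).1 (abs_le.1 h2).2
      have : (R : ℤ) ≤ (a ^ 2 + a * b) * (M : ℤ) ^ 2 := by
        have h3 : (R : ℤ) = a * N := hR.symm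
        rw [h3, ← h]
        nlinarith [sq_nonneg a, mul_le_mul_of_nonneg_left h1' (sq_nonneg a)]
      rw [hL]; exact_mod_cast this
    have hcard : s.card ≤ (8 * (a * b) + 1).toNat * 3 * R.divisors.card ^ 2 := by
      rw [← Finset.card_image_of_injective s
        (f := fun z : ℤ × ℤ => (a * z.1, z.2)) (fun z w h => by
          simp only [Prod.mk.injEq] at h
          exact Prod.ext (mul_left_cancel₀ ha h.1) h.2)]
      refine card_repr_le hab hR0 _ fun w hw => ?_
      obtain ⟨z, hz, rfl⟩ := Finset.mem_image.1 hw
      rw [ident z hz, hR]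
    have hd := hdiv R hR0.ne'
    calc (s.card : ℝ) ≤ K * (R.divisors.card : ℝ) ^ 2 := by rw [hK]; exact_mod_cast hcard
      _ ≤ K * (C * (L * (M : ℝ) ^ 2) ^ (ε / 4)) ^ 2 := by
        gcongr
        exact hd.trans (by gcongr)
      _ = K * (C * L ^ (ε / 4)) ^ 2 * (M : ℝ) ^ ε := by
        rw [Real.mul_rpow (by positivity) (by positivity), ← Real.rpow_natCast (M : ℝ) 2,
          ← Real.rpow_mul (by positivity), ← mul_assoc C, mul_pow _ _ 2,
          ← Real.rpow_natCast ((M : ℝ) ^ _) 2, ← Real.rpow_mul (by positivity)]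
        push_cast
        rw [show (2 : ℝ) * (ε / 4) * 2 = ε by ring]
        ring

/-- Level sets of a diagonal form with two coefficients of the same sign contain few lattice points
in a box. -/
theorem exists_card_level_le {n : ℕ} (A : Fin n → ℤ) {i j : Fin n} (hij : i ≠ j)
    (hA : 0 < A i * A j) {ε : ℝ} (hε : 0 < ε) :
    ∃ C : ℝ, 0 ≤ C ∧ ∀ (k : ℤ) (M : ℕ) (s : Finset (Fin n → ℤ)), 1 ≤ M →
      (∀ m ∈ s, ∑ l, A l * m l ^ 2 = k ∧ ∀ l, |m l| ≤ M) →
      (s.card : ℝ) ≤ C * (M : ℝ) ^ ((n : ℝ) - 2 + ε) := by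
  obtain ⟨C, hC, hbin⟩ := exists_card_binary_le hA hε
  have hcardn : Fintype.card {l : Fin n // l ≠ i ∧ l ≠ j} = n - 2 := by
    rw [Fintype.card_subtype]
    have : (Finset.univ.filter fun l : Fin n => l ≠ i ∧ l ≠ j) = {i, j}ᶜ := by
      ext l; simp
    rw [this, Finset.card_compl, Finset.card_pair hij, Fintype.card_fin]
  have hn2 : 2 ≤ n := by
    have := Finset.card_le_univ ({i, j} : Finset (Fin n))
    rwa [Finset.card_pair hij, Fintype.card_fin] at this
  refine ⟨C * 3 ^ (n - 2), by positivity, fun k M s hM hs => ?_⟩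
  have hM1 : (1 : ℝ) ≤ M := by exact_mod_cast hM
  set B : Finset ({l : Fin n // l ≠ i ∧ l ≠ j} → ℤ) :=
    Fintype.piFinset fun _ => Finset.Icc (-(M : ℤ)) M with hB
  have hBcard : B.card = (2 * M + 1) ^ (n - 2) := by
    rw [hB, Fintype.card_piFinset, Finset.prod_const, Finset.card_univ, hcardn, Int.card_Icc]
    congr 1; omega
  have main : s.card ≤ ⌊C * (M : ℝ) ^ ε⌋₊ * B.card := by
    refine Finset.card_le_mul_card_image_of_maps_to
      (f := fun m => fun l : {l : Fin n // l ≠ i ∧ l ≠ j} => m l) (fun m hm => ?_) _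
      (fun b _ => ?_)
    · rw [hB, Fintype.mem_piFinset]
      intro l
      exact Finset.mem_Icc.2 (abs_le.1 ((hs m hm).2 l))
    set F := s.filter fun m => (fun l : {l : Fin n // l ≠ i ∧ l ≠ j} => m l) = b with hF
    rcases F.eq_empty_or_nonempty with h | ⟨m₁, hm₁⟩
    · rw [h]; simp
    obtain ⟨hm₁s, hm₁b⟩ := Finset.mem_filter.1 hm₁
    have agree : ∀ m ∈ F, ∀ l, l ≠ i ∧ l ≠ j → m l = m₁ l := by
      intro m hm l hl
      have := (Finset.mem_filter.1 hm).2
      rw [← hm₁b] at this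
      exact congrFun this ⟨l, hl⟩
    have inj : Set.InjOn (fun m : Fin n → ℤ => (m i, m j)) F := by
      intro m hm m' hm' h
      simp only [Prod.mk.injEq] at h
      funext l
      by_cases hli : l = i
      · rw [hli, h.1]
      by_cases hlj : l = j
      · rw [hlj, h.2]
      rw [agree m hm l ⟨hli, hlj⟩, agree m' hm' l ⟨hli, hlj⟩]
    refine Nat.le_floor ?_
    rw [← Finset.card_image_of_injOn inj]
    refine hbin (A i * m₁ i ^ 2 + A j * m₁ j ^ 2) M _ hM fun z hz => ?_
    obtain ⟨m, hm, rfl⟩ := Finset.mem_image.1 hz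
    have hms := (Finset.mem_filter.1 hm).1
    refine ⟨?_, (hs m hms).2 i, (hs m hms).2 j⟩
    have hsum : ∑ l, (A l * m l ^ 2 - A l * m₁ l ^ 2) = 0 := by
      rw [Finset.sum_sub_distrib, (hs m hms).1, (hs m₁ hm₁s).1, sub_self]
    rw [Fintype.sum_eq_add i j hij (fun l hl => by rw [agree m hm l hl, sub_self])] at hsum
    dsimp only
    linarith
  calc (s.card : ℝ) ≤ (⌊C * (M : ℝ) ^ ε⌋₊ : ℝ) * B.card := by exact_mod_cast main
    _ ≤ C * (M : ℝ) ^ ε * ((3 : ℝ) * M) ^ (n - 2) := by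
      rw [hBcard]
      push_cast
      gcongr
      · exact Nat.floor_le (by positivity)
      · linarith
    _ = C * 3 ^ (n - 2) * (M : ℝ) ^ ((n : ℝ) - 2 + ε) := by
      rw [Real.rpow_add (by positivity), mul_pow, ← Real.rpow_natCast (M : ℝ) (n - 2),
        Nat.cast_sub hn2]
      push_cast
      ring

theorem rpow_neg_le_tsum {σ : ℝ} (hσ : 0 < σ) {R : ℕ} (hR : 1 ≤ R) :
    ENNReal.ofReal ((R : ℝ) ^ (-σ)) ≤ ENNReal.ofReal (2 ^ (σ + 1)) *
      ∑' M : ℕ, if R ≤ M then ENNReal.ofReal ((M : ℝ) ^ (-σ - 1)) else 0 := by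
  have hR0 : (0 : ℝ) < R := by exact_mod_cast hR
  have h1 : ENNReal.ofReal (R * (2 * R : ℝ) ^ (-σ - 1)) ≤
      ∑' M : ℕ, if R ≤ M then ENNReal.ofReal ((M : ℝ) ^ (-σ - 1)) else 0 := by
    refine le_trans ?_ (ENNReal.sum_le_tsum (Finset.Ico R (2 * R)))
    calc ENNReal.ofReal (R * (2 * R : ℝ) ^ (-σ - 1))
        = ∑ M ∈ Finset.Ico R (2 * R), ENNReal.ofReal ((2 * R : ℝ) ^ (-σ - 1)) := by
          rw [Finset.sum_const, Nat.card_Ico, nsmul_eq_mul, ENNReal.ofReal_mul (by positivity),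
            ENNReal.ofReal_natCast]
          congr 2; omega
      _ ≤ _ := Finset.sum_le_sum fun M hM => by
          obtain ⟨h2, h3⟩ := Finset.mem_Ico.1 hM
          rw [if_pos h2]
          have h2' : (R : ℝ) ≤ M := by exact_mod_cast h2
          have h3' : (M : ℝ) ≤ 2 * R := by exact_mod_cast h3.le
          exact ENNReal.ofReal_le_ofReal
            (Real.rpow_le_rpow_of_nonpos (by linarith) h3' (by linarith))
  refine le_trans (le_of_eq ?_) (mul_le_mul_right h1 _)
  rw [← ENNReal.ofReal_mul (by positivity), Real.mul_rpow (by norm_num) hR0.le]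
  congr 1
  rw [show (2 : ℝ) ^ (σ + 1) * (R * ((2 : ℝ) ^ (-σ - 1) * (R : ℝ) ^ (-σ - 1))) =
    ((2 : ℝ) ^ (σ + 1) * (2 : ℝ) ^ (-σ - 1)) * (R * (R : ℝ) ^ (-σ - 1)) by ring,
    ← Real.rpow_add (by norm_num)]
  nth_rewrite 2 [← Real.rpow_one (R : ℝ)]
  rw [← Real.rpow_add hR0]
  ring_nf
  simp

/-- Uniformly over the levels `k`, the sum of `‖m‖ ^ (-(n - 2 + ε))` over the nonzero lattice
points of a level set of a diagonal form is bounded. -/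
theorem exists_tsum_level_le {n : ℕ} (hn : 3 ≤ n) (A : Fin n → ℤ) {i j : Fin n} (hij : i ≠ j)
    (hA : 0 < A i * A j) {ε : ℝ} (hε : 0 < ε) :
    ∃ C : ℝ≥0∞, C ≠ ⊤ ∧ ∀ k : ℤ,
      ∑' m : Fin n → ℤ, (if m ≠ 0 ∧ ∑ l, A l * m l ^ 2 = k then
        ENNReal.ofReal (‖m‖ ^ (-((n : ℝ) - 2 + ε))) else 0) ≤ C := by
  obtain ⟨C, hC, hlev⟩ := exists_card_level_le A hij hA (half_pos hε)
  have hn' : (3 : ℝ) ≤ n := by exact_mod_cast hn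
  set σ : ℝ := (n : ℝ) - 2 + ε with hσ
  have hσ0 : 0 < σ := by rw [hσ]; linarith
  have hsum : Summable fun M : ℕ => C * (M : ℝ) ^ (-1 - ε / 2) :=
    (Real.summable_nat_rpow.2 (by linarith)).mul_left C
  refine ⟨ENNReal.ofReal (2 ^ (σ + 1)) * ∑' M : ℕ, ENNReal.ofReal (C * (M : ℝ) ^ (-1 - ε / 2)),
    ENNReal.mul_ne_top ENNReal.ofReal_ne_top hsum.tsum_ofReal_ne_top, fun k => ?_⟩
  set r : (Fin n → ℤ) → ℕ := fun m => Finset.univ.sup fun l => (m l).natAbs with hr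
  have hle : ∀ (m : Fin n → ℤ) (M : ℕ), r m ≤ M → ∀ l, |m l| ≤ M := fun m M h l => by
    have : (m l).natAbs ≤ r m := Finset.le_sup (f := fun l => (m l).natAbs) (Finset.mem_univ l)
    have h2 : |m l| = ((m l).natAbs : ℤ) := Int.abs_eq_natAbs _
    omega
  have hnorm : ∀ m : Fin n → ℤ, ‖m‖ = r m := fun m => by
    apply le_antisymm
    · rw [pi_norm_le_iff_of_nonneg (by positivity)]
      intro l
      have := hle m (r m) le_rfl l
      rw [Int.norm_eq_abs]
      exact_mod_cast this
    · have : Nonempty (Fin n) := ⟨i⟩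
      obtain ⟨l, -, hl⟩ := Finset.exists_mem_eq_sup (Finset.univ : Finset (Fin n))
        Finset.univ_nonempty fun l => (m l).natAbs
      rw [hr]
      dsimp only
      rw [hl, Nat.cast_natAbs]
      have := norm_le_pi_norm m l
      rw [Int.norm_eq_abs] at this
      exact_mod_cast this
  have hr1 : ∀ m : Fin n → ℤ, m ≠ 0 → 1 ≤ r m := fun m hm => by
    rw [Nat.one_le_iff_ne_zero]
    intro h
    exact hm (norm_eq_zero.1 (by rw [hnorm, h, Nat.cast_zero]))
  calc ∑' m : Fin n → ℤ, (if m ≠ 0 ∧ ∑ l, A l * m l ^ 2 = k then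
        ENNReal.ofReal (‖m‖ ^ (-σ)) else 0)
      ≤ ∑' m : Fin n → ℤ, ENNReal.ofReal (2 ^ (σ + 1)) * ∑' M : ℕ,
          if m ≠ 0 ∧ ∑ l, A l * m l ^ 2 = k ∧ r m ≤ M
            then ENNReal.ofReal ((M : ℝ) ^ (-σ - 1)) else 0 := by
        refine ENNReal.tsum_le_tsum fun m => ?_
        split_ifs with h
        · rw [hnorm]
          refine (rpow_neg_le_tsum hσ0 (hr1 m h.1)).trans (le_of_eq ?_)
          simp only [h.1, h.2, ne_eq, not_false_eq_true, true_and]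
        · exact zero_le
    _ = ENNReal.ofReal (2 ^ (σ + 1)) * ∑' M : ℕ, ∑' m : Fin n → ℤ,
          if m ≠ 0 ∧ ∑ l, A l * m l ^ 2 = k ∧ r m ≤ M
            then ENNReal.ofReal ((M : ℝ) ^ (-σ - 1)) else 0 := by
        rw [ENNReal.tsum_mul_left, ENNReal.tsum_comm]
    _ ≤ _ := by
        gcongr with M
        rw [ENNReal.tsum_eq_iSup_sum]
        refine iSup_le fun s => ?_
        rw [← Finset.sum_filter, Finset.sum_const, nsmul_eq_mul]
        rcases Nat.eq_zero_or_pos M with rfl | hM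
        · have : (s.filter fun m => m ≠ 0 ∧ ∑ l, A l * m l ^ 2 = k ∧ r m ≤ 0) = ∅ := by
            refine Finset.filter_eq_empty_iff.2 fun m _ h => ?_
            have := hr1 m h.1
            omega
          rw [this]; simp
        have hM0 : (0 : ℝ) < M := by exact_mod_cast hM
        have := hlev k M (s.filter fun m => m ≠ 0 ∧ ∑ l, A l * m l ^ 2 = k ∧ r m ≤ M) hM
          (fun m hm => by
            obtain ⟨-, -, h1, h2⟩ := Finset.mem_filter.1 hm
            exact ⟨h1, hle m M h2⟩)
        rw [← ENNReal.ofReal_natCast, ← ENNReal.ofReal_mul (by positivity)]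
        refine ENNReal.ofReal_le_ofReal ?_
        refine (mul_le_mul_of_nonneg_right this (by positivity)).trans (le_of_eq ?_)
        rw [mul_assoc, ← Real.rpow_add hM0, hσ]
        congr 2; ring

/-- Cauchy-Schwarz inequality with a weight. -/
theorem lintegral_mul_sq_le {α : Type*} [MeasurableSpace α] {μ : Measure α} {w f : α → ℝ≥0∞}
    (hw : AEMeasurable w μ) (hf : AEMeasurable f μ) :
    (∫⁻ x, w x * f x ∂μ) ^ 2 ≤ (∫⁻ x, w x ∂μ) * ∫⁻ x, w x * f x ^ 2 ∂μ := by
  have h := ENNReal.lintegral_mul_le_Lp_mul_Lq μ Real.HolderConjugate.two_two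
    (f := fun x => w x ^ (1 / 2 : ℝ)) (g := fun x => w x ^ (1 / 2 : ℝ) * f x)
    (hw.pow_const _) ((hw.pow_const _).mul hf)
  have h2 : ∀ x : ℝ≥0∞, x ^ (1 / 2 : ℝ) * x ^ (1 / 2 : ℝ) = x := fun x => by
    rw [← ENNReal.rpow_add_of_nonneg _ _ (by norm_num) (by norm_num)]; norm_num
  have h3 : ∀ x : ℝ≥0∞, (x ^ (1 / 2 : ℝ)) ^ 2 = x := fun x => by rw [sq, h2]
  simp only [Pi.mul_apply, ← mul_assoc, h2, ENNReal.rpow_two, mul_pow, h3] at h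
  calc _ ≤ _ := pow_le_pow_left' h 2
    _ = _ := by rw [mul_pow, h3, h3]

theorem tsum_mul_sq_le {ι : Type*} (w f : ι → ℝ≥0∞) :
    (∑' i, w i * f i) ^ 2 ≤ (∑' i, w i) * ∑' i, w i * f i ^ 2 := by
  let _ : MeasurableSpace ι := ⊤
  have h := lintegral_mul_sq_le (μ := (Measure.count : Measure ι)) (w := w) (f := f)
    measurable_from_top.aemeasurable measurable_from_top.aemeasurable
  simpa only [lintegral_count] using h

/-- Parseval's inequality on an interval of length one. -/
theorem tsum_enorm_integral_Ioc_sq_le {V : ℝ → ℂ} (l : ℝ)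
    (hV : AEStronglyMeasurable V (volume.restrict (Set.Ioc l (l + 1)))) :
    ∑' k : ℤ,
        ‖∫ u in Set.Ioc l (l + 1), V u * Complex.exp ((-(2 * π * k * u) : ℝ) * Complex.I)‖ₑ ^ 2
      ≤ ∫⁻ u in Set.Ioc l (l + 1), ‖V u‖ₑ ^ 2 := by
  by_cases htop : ∫⁻ u in Set.Ioc l (l + 1), ‖V u‖ₑ ^ 2 = ⊤
  · rw [htop]; exact le_top
  have hlt : l < l + 1 := by linarith
  have hL2 : MemLp V 2 (volume.restrict (Set.Ioc l (l + 1))) := by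
    refine ⟨hV, ?_⟩
    rw [eLpNorm_lt_top_iff_lintegral_rpow_enorm_lt_top (by norm_num) (by norm_num)]
    simpa [lt_top_iff_ne_top] using htop
  have hs := hasSum_sq_fourierCoeffOn hlt hL2
  have hint : ∀ k : ℤ, fourierCoeffOn hlt V k =
      ∫ u in Set.Ioc l (l + 1), V u * Complex.exp ((-(2 * π * k * u) : ℝ) * Complex.I) :=
    fun k => by
    rw [fourierCoeffOn_eq_integral, intervalIntegral.integral_of_le hlt.le]
    simp only [add_sub_cancel_left, div_one, one_smul]
    refine integral_congr_ae (ae_of_all _ fun u => ?_)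
    dsimp only
    rw [fourier_coe_apply, smul_eq_mul, mul_comm]
    congr 2
    push_cast
    ring
  rw [add_sub_cancel_left, inv_one, one_smul, intervalIntegral.integral_of_le hlt.le] at hs
  have h1 : ∀ z : ℂ, ‖z‖ₑ ^ 2 = ENNReal.ofReal (‖z‖ ^ 2) := fun z => by
    rw [ENNReal.ofReal_pow (norm_nonneg _), ofReal_norm]
  simp only [h1, ← hint]
  rw [← ENNReal.ofReal_tsum_of_nonneg (fun k => by positivity) hs.summable, hs.tsum_eq,
    ofReal_integral_eq_lintegral_ofReal (by simpa using hL2.integrable_norm_pow (by norm_num))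
      (ae_of_all _ fun u => by positivity)]

theorem summable_int_one_add_abs_rpow {r : ℝ} (hr : 1 < r) :
    Summable fun l : ℤ => (1 + |(l : ℝ)|) ^ (-r) := by
  have hn : Summable fun k : ℕ => (1 + (k : ℝ)) ^ (-r) := by
    have := (summable_nat_add_iff 1).2 (Real.summable_nat_rpow.2 (by linarith : -r < -1))
    simpa [add_comm] using this
  exact Summable.of_nat_of_neg (by simpa using hn) (by simpa using hn)

/-- A weighted Bessel inequality for the values of a Fourier transform at the integers. -/
theorem exists_tsum_enorm_fourier_sq_le {r : ℝ} (hr : 1 < r) :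
    ∃ C : ℝ≥0∞, C ≠ ⊤ ∧ ∀ V : ℝ → ℂ, Integrable V →
      ∑' k : ℤ, ‖∫ u, V u * Complex.exp ((-(2 * π * k * u) : ℝ) * Complex.I)‖ₑ ^ 2 ≤
        C * ∫⁻ u, ‖V u‖ₑ ^ 2 * ENNReal.ofReal ((1 + |u|) ^ r) := by
  set S : ℝ≥0∞ := ∑' l : ℤ, ENNReal.ofReal ((1 + |(l : ℝ)|) ^ (-r)) with hS
  have hST : S ≠ ⊤ := (summable_int_one_add_abs_rpow hr).tsum_ofReal_ne_top
  refine ⟨S * ENNReal.ofReal (2 ^ r), ENNReal.mul_ne_top hST ENNReal.ofReal_ne_top,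
    fun V hV => ?_⟩
  set I : ℤ → Set ℝ := fun l => Set.Ioc (l : ℝ) (l + 1) with hI
  have hImeas : ∀ l, MeasurableSet (I l) := fun l => measurableSet_Ioc
  have hIdisj : Pairwise (Function.onFun Disjoint I) := Set.pairwise_disjoint_Ioc_intCast ℝ
  have hIun : ⋃ l, I l = Set.univ := iUnion_Ioc_intCast ℝ
  set a : ℤ → ℤ → ℂ := fun k l =>
    ∫ u in I l, V u * Complex.exp ((-(2 * π * k * u) : ℝ) * Complex.I) with ha
  have hVe : ∀ k : ℤ, Integrable fun u =>
      V u * Complex.exp ((-(2 * π * k * u) : ℝ) * Complex.I) := fun k => by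
    refine hV.mul_bdd (c := 1) (by fun_prop) (ae_of_all _ fun u => ?_)
    rw [Complex.norm_exp_ofReal_mul_I]
  have hw : ∀ l : ℤ, ENNReal.ofReal ((1 + |(l : ℝ)|) ^ (-r)) *
      ENNReal.ofReal ((1 + |(l : ℝ)|) ^ r) = 1 := fun l => by
    rw [← ENNReal.ofReal_mul (by positivity), ← Real.rpow_add (by positivity)]
    simp
  have h1 : ∀ k : ℤ, ‖∫ u, V u * Complex.exp ((-(2 * π * k * u) : ℝ) * Complex.I)‖ₑ ^ 2 ≤
      S * ∑' l : ℤ, ENNReal.ofReal ((1 + |(l : ℝ)|) ^ r) * ‖a k l‖ₑ ^ 2 := fun k => by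
    have hsum : ∫ u, V u * Complex.exp ((-(2 * π * k * u) : ℝ) * Complex.I) = ∑' l : ℤ, a k l := by
      rw [← setIntegral_univ, ← hIun]
      exact integral_iUnion hImeas hIdisj (hVe k).integrableOn
    rw [hsum]
    calc ‖∑' l : ℤ, a k l‖ₑ ^ 2 ≤ (∑' l : ℤ, ‖a k l‖ₑ) ^ 2 := by
          gcongr; exact enorm_tsum_le_tsum_enorm
      _ = (∑' l : ℤ, ENNReal.ofReal ((1 + |(l : ℝ)|) ^ (-r)) *
            (ENNReal.ofReal ((1 + |(l : ℝ)|) ^ r) * ‖a k l‖ₑ)) ^ 2 := by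
          simp only [← mul_assoc, hw, one_mul]
      _ ≤ _ := tsum_mul_sq_le _ _
      _ = _ := by
          congr 2; funext l
          rw [mul_pow, sq (ENNReal.ofReal _), ← mul_assoc, ← mul_assoc, hw, one_mul]
  calc _ ≤ ∑' k : ℤ, S * ∑' l : ℤ, ENNReal.ofReal ((1 + |(l : ℝ)|) ^ r) * ‖a k l‖ₑ ^ 2 :=
        ENNReal.tsum_le_tsum h1
    _ = S * ∑' l : ℤ, ENNReal.ofReal ((1 + |(l : ℝ)|) ^ r) * ∑' k, ‖a k l‖ₑ ^ 2 := by
        rw [ENNReal.tsum_mul_left, ENNReal.tsum_comm]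
        simp only [ENNReal.tsum_mul_left]
    _ ≤ S * ∑' l : ℤ, ENNReal.ofReal ((1 + |(l : ℝ)|) ^ r) * ∫⁻ u in I l, ‖V u‖ₑ ^ 2 := by
        gcongr with l
        exact tsum_enorm_integral_Ioc_sq_le _ hV.1.restrict
    _ ≤ S * ∑' l : ℤ, ∫⁻ u in I l,
          ENNReal.ofReal (2 ^ r) * (‖V u‖ₑ ^ 2 * ENNReal.ofReal ((1 + |u|) ^ r)) := by
        gcongr with l
        rw [← lintegral_const_mul' _ _ ENNReal.ofReal_ne_top]
        refine setLIntegral_mono' (hImeas l) fun u hu => ?_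
        rw [mul_comm, mul_left_comm, ← ENNReal.ofReal_mul (by positivity),
          ← Real.mul_rpow (by norm_num) (by positivity)]
        gcongr
        have : |(l : ℝ) - u| ≤ 1 := abs_le.2 ⟨by linarith [hu.2], by linarith [hu.1]⟩
        have h2 := abs_sub_abs_le_abs_sub (l : ℝ) u
        linarith [abs_nonneg u]
    _ = _ := by
        rw [← lintegral_iUnion hImeas hIdisj, hIun, setLIntegral_univ,
          lintegral_const_mul' _ _ ENNReal.ofReal_ne_top, mul_assoc]

/-- The weighted Bessel inequality after a change of variables in the phase. -/
theorem exists_tsum_enorm_phase_sq_le {r : ℝ} (hr : 1 < r) :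
    ∃ C : ℝ≥0∞, C ≠ ⊤ ∧ ∀ (E : Set ℝ) (ψ ψ' : ℝ → ℝ) (V : ℝ → ℂ), MeasurableSet E →
      (∀ x ∈ E, HasDerivWithinAt ψ (ψ' x) E x) → Set.InjOn ψ E → (∀ x ∈ E, ψ' x ≠ 0) →
      IntegrableOn V E →
      ∑' k : ℤ, ‖∫ x in E, V x * Complex.exp ((-(2 * π * k * ψ x) : ℝ) * Complex.I)‖ₑ ^ 2 ≤
        C * ∫⁻ x in E, ‖V x‖ₑ ^ 2 * ENNReal.ofReal (|ψ' x|⁻¹ * (1 + |ψ x|) ^ r) := by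
  obtain ⟨C, hC, h⟩ := exists_tsum_enorm_fourier_sq_le hr
  refine ⟨C, hC, fun E ψ ψ' V hE hψ hinj hne hV => ?_⟩
  set W : ℝ → ℂ := (ψ '' E).indicator fun u =>
    (|ψ' (Function.invFunOn ψ E u)|⁻¹ : ℝ) • V (Function.invFunOn ψ E u) with hW
  have hWψ : ∀ x ∈ E, W (ψ x) = (|ψ' x|⁻¹ : ℝ) • V x := fun x hx => by
    rw [hW, Set.indicator_of_mem (Set.mem_image_of_mem ψ hx), hinj.leftInvOn_invFunOn hx]
  have hψE : MeasurableSet (ψ '' E) := by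
    refine hE.image_of_continuousOn_injOn (fun x hx => (hψ x hx).continuousWithinAt) hinj
  have hcancel : ∀ x ∈ E, |ψ' x| • W (ψ x) = V x := fun x hx => by
    rw [hWψ x hx, smul_smul, mul_inv_cancel₀ (abs_ne_zero.2 (hne x hx)), one_smul]
  have hWint : Integrable W := by
    rw [← integrableOn_iff_integrable_of_support_subset
      (Set.support_indicator_subset : _ ⊆ ψ '' E),
      integrableOn_image_iff_integrableOn_abs_deriv_smul hE hψ hinj]
    exact hV.congr_fun (fun x hx => (hcancel x hx).symm) hE
  have h1 := h W hWint
  have h2 : ∀ k : ℤ, ∫ u, W u * Complex.exp ((-(2 * π * k * u) : ℝ) * Complex.I) =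
      ∫ x in E, V x * Complex.exp ((-(2 * π * k * ψ x) : ℝ) * Complex.I) := fun k => by
    rw [← setIntegral_eq_integral_of_forall_compl_eq_zero (s := ψ '' E),
      integral_image_eq_integral_abs_deriv_smul hE hψ hinj]
    · refine setIntegral_congr_fun hE fun x hx => ?_
      rw [← smul_mul_assoc, hcancel x hx]
    · intro u hu
      rw [hW, Set.indicator_of_notMem hu, zero_mul]
  have h3 : ∫⁻ u, ‖W u‖ₑ ^ 2 * ENNReal.ofReal ((1 + |u|) ^ r) =
      ∫⁻ x in E, ‖V x‖ₑ ^ 2 * ENNReal.ofReal (|ψ' x|⁻¹ * (1 + |ψ x|) ^ r) := by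
    rw [← setLIntegral_eq_of_support_subset (s := ψ '' E),
      lintegral_image_eq_lintegral_abs_deriv_mul hE hψ hinj]
    · refine setLIntegral_congr_fun hE fun x hx => ?_
      have hpos := abs_pos.2 (hne x hx)
      rw [hWψ x hx, enorm_smul, mul_pow, Real.enorm_eq_ofReal (by positivity),
        ENNReal.ofReal_mul (by positivity), ← mul_assoc, ← mul_assoc, sq (ENNReal.ofReal _),
        ← mul_assoc, ← ENNReal.ofReal_mul hpos.le, mul_inv_cancel₀ hpos.ne',
        ENNReal.ofReal_one, one_mul, mul_comm (ENNReal.ofReal _), mul_assoc]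
    · intro u hu
      by_contra hu'
      rw [Function.mem_support, hW, Set.indicator_of_notMem hu'] at hu
      simp at hu
  simp only [h2, h3] at h1
  exact h1

theorem exists_tsum_enorm_rational_phase_sq_le {r : ℝ} (hr : 1 < r) {a : ℝ} (ha : 1 ≤ |a|) :
    ∃ C : ℝ≥0∞, C ≠ ⊤ ∧ ∀ (s : ℝ) (V : ℝ → ℂ), 0 < s → IntegrableOn V (Set.Ioi s) →
      ∑' k : ℤ, ‖∫ θ in Set.Ioi s, V θ *
        Complex.exp ((-(2 * π * k * (θ / (a * (s ^ 2 + 4 * θ ^ 2)))) : ℝ) * Complex.I)‖ₑ ^ 2 ≤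
        C * ∫⁻ θ in Set.Ioi s, ‖V θ‖ₑ ^ 2 *
          ENNReal.ofReal ((s ^ 2 + 4 * θ ^ 2) * (1 + θ⁻¹) ^ r) := by
  obtain ⟨C, hC, h⟩ := exists_tsum_enorm_phase_sq_le hr
  have ha0 : a ≠ 0 := fun h => by rw [h, abs_zero] at ha; linarith
  refine ⟨C * ENNReal.ofReal (2 * |a|), ENNReal.mul_ne_top hC ENNReal.ofReal_ne_top,
    fun s V hs hV => ?_⟩
  have hD : ∀ θ : ℝ, 0 < s ^ 2 + 4 * θ ^ 2 := fun θ => by positivity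
  have key := h (Set.Ioi s) (fun θ => θ / (a * (s ^ 2 + 4 * θ ^ 2)))
    (fun θ => (s ^ 2 - 4 * θ ^ 2) / (a * (s ^ 2 + 4 * θ ^ 2) ^ 2)) V measurableSet_Ioi
    (fun θ _ => by
      have h1 : HasDerivAt (fun θ : ℝ => a * (s ^ 2 + 4 * θ ^ 2)) (a * (4 * (2 * θ))) θ := by
        have := (((hasDerivAt_pow 2 θ).const_mul 4).const_add (s ^ 2)).const_mul a
        simpa using this
      have h2 := (hasDerivAt_id' θ).div h1 (mul_ne_zero ha0 (hD θ).ne')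
      refine (h2.congr_deriv ?_).hasDerivWithinAt
      have := (hD θ).ne'
      field_simp
      ring)
    (fun x hx y hy hxy => by
      have hx' : s < x := hx
      have hy' : s < y := hy
      dsimp only at hxy
      rw [div_eq_div_iff (mul_ne_zero ha0 (hD x).ne') (mul_ne_zero ha0 (hD y).ne')] at hxy
      have h3 : a * ((x - y) * (s ^ 2 - 4 * (x * y))) = 0 := by linear_combination hxy
      rcases mul_eq_zero.1 ((mul_eq_zero.1 h3).resolve_left ha0) with h4 | h4
      · linarith
      · nlinarith)
    (fun θ hθ => by
      have hθ' : s < θ := hθ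
      refine div_ne_zero ?_ (mul_ne_zero ha0 (pow_ne_zero _ (hD θ).ne'))
      nlinarith) hV
  refine key.trans ?_
  rw [mul_assoc, ← lintegral_const_mul' _ _ ENNReal.ofReal_ne_top]
  gcongr C * ?_
  refine setLIntegral_mono' measurableSet_Ioi fun θ hθ => ?_
  have hθ' : s < θ := hθ
  have hθ0 : 0 < θ := hs.trans hθ'
  rw [mul_left_comm, ← ENNReal.ofReal_mul (by positivity), ← mul_assoc]
  gcongr
  · rw [abs_div, abs_mul, abs_of_pos (pow_pos (hD θ) 2), abs_of_neg (by nlinarith), inv_div,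
      div_le_iff₀ (by nlinarith), sq (s ^ 2 + 4 * θ ^ 2)]
    have h5 : s ^ 2 + 4 * θ ^ 2 ≤ 2 * -(s ^ 2 - 4 * θ ^ 2) := by nlinarith
    have h6 := mul_le_mul_of_nonneg_left h5 (mul_nonneg (abs_nonneg a) (hD θ).le)
    linarith
  · rw [abs_div, abs_mul, abs_of_pos hθ0, abs_of_pos (hD θ), div_le_iff₀ (by positivity),
      inv_mul_eq_div, le_div_iff₀ hθ0]
    nlinarith [sq_nonneg s, mul_le_mul_of_nonneg_right ha (hD θ).le]

theorem ofReal_exp_neg_mul_eq_lintegral {c x : ℝ} (hc : 0 < c) :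
    ∫⁻ v in Set.Ioi x, ENNReal.ofReal (c * Real.exp (-c * v)) =
      ENNReal.ofReal (Real.exp (-c * x)) := by
  rw [← ofReal_integral_eq_lintegral_ofReal
    ((integrableOn_exp_mul_Ioi (neg_lt_zero.2 hc) x).const_mul c)
    (ae_of_all _ fun v => by positivity), integral_const_mul,
    integral_exp_mul_Ioi (neg_lt_zero.2 hc)]
  congr 1
  field_simp

theorem enorm_integral_mul_exp_sq_le {μ : Measure ℝ} [SFinite μ] {c : ℝ} (hc : 0 < c) {X : ℝ → ℂ}
    (hX : Integrable X μ) {x : ℝ → ℝ} (hx : Measurable x) (hx0 : ∀ θ, 0 ≤ x θ) :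
    ‖∫ θ, X θ * (Real.exp (-c * x θ) : ℝ) ∂μ‖ₑ ^ 2 ≤
      ∫⁻ v in Set.Ioi 0, ENNReal.ofReal (c * Real.exp (-c * v)) *
        ‖∫ θ, (if x θ < v then X θ else 0) ∂μ‖ₑ ^ 2 := by
  set w : ℝ → ℝ := fun v => c * Real.exp (-c * v) with hw
  have hw0 : ∀ v, 0 ≤ w v := fun v => by rw [hw]; positivity
  have hwint : IntegrableOn w (Set.Ioi 0) :=
    (integrableOn_exp_mul_Ioi (neg_lt_zero.2 hc) 0).const_mul c
  have hset : MeasurableSet {z : ℝ × ℝ | x z.1 < z.2} :=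
    measurableSet_lt (hx.comp measurable_fst) measurable_snd
  have hXw : Integrable (fun z : ℝ × ℝ => X z.1 * (w z.2 : ℂ))
      (μ.prod (volume.restrict (Set.Ioi 0))) := hX.mul_prod hwint.ofReal
  have hXw' : Integrable (Function.uncurry fun θ v => if x θ < v then X θ * (w v : ℂ) else 0)
      (μ.prod (volume.restrict (Set.Ioi 0))) := by
    refine (hXw.indicator hset).congr (ae_of_all _ fun z => ?_)
    simp only [Set.indicator, Set.mem_ofPred_eq, Function.uncurry]
  have hexp : ∀ θ, X θ * (Real.exp (-c * x θ) : ℝ) =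
      ∫ v in Set.Ioi 0, if x θ < v then X θ * (w v : ℂ) else 0 := fun θ => by
    have h1 : ∫ v in Set.Ioi 0, (if x θ < v then X θ * (w v : ℂ) else 0) =
        ∫ v in Set.Ioi 0, (Set.Ioi (x θ)).indicator (fun v => X θ * (w v : ℂ)) v := by
      simp only [Set.indicator, Set.mem_Ioi]
    rw [h1, setIntegral_indicator measurableSet_Ioi, Set.Ioi_inter_Ioi, max_eq_right (hx0 θ),
      integral_const_mul, integral_complex_ofReal, hw, integral_const_mul,
      integral_exp_mul_Ioi (neg_lt_zero.2 hc)]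
    congr 2
    field_simp
  have hmeas : AEStronglyMeasurable (fun v => ∫ θ, (if x θ < v then X θ else 0) ∂μ)
      (volume.restrict (Set.Ioi 0)) := by
    have h2 : AEStronglyMeasurable (fun z : ℝ × ℝ => if x z.1 < z.2 then X z.1 else 0)
        (μ.prod (volume.restrict (Set.Ioi 0))) := by
      refine ((hX.1.comp_fst (ν := volume.restrict (Set.Ioi 0))).indicator hset).congr
        (ae_of_all _ fun z => ?_)
      simp only [Set.indicator, Set.mem_ofPred_eq]
    exact h2.prod_swap.integral_prod_right'
  have hswap : ∫ θ, X θ * (Real.exp (-c * x θ) : ℝ) ∂μ =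
      ∫ v in Set.Ioi 0, (w v : ℂ) * ∫ θ, (if x θ < v then X θ else 0) ∂μ := by
    simp only [hexp]
    rw [integral_integral_swap hXw']
    refine integral_congr_ae (ae_of_all _ fun v => ?_)
    dsimp only
    rw [← integral_const_mul]
    congr 1
    funext θ
    split_ifs
    · ring
    · simp
  calc ‖∫ θ, X θ * (Real.exp (-c * x θ) : ℝ) ∂μ‖ₑ ^ 2
      ≤ (∫⁻ v in Set.Ioi 0, ENNReal.ofReal (w v) *
          ‖∫ θ, (if x θ < v then X θ else 0) ∂μ‖ₑ) ^ 2 := by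
        rw [hswap]
        gcongr
        refine (enorm_integral_le_lintegral_enorm _).trans (le_of_eq ?_)
        refine lintegral_congr fun v => ?_
        rw [enorm_mul, ← Real.enorm_of_nonneg (hw0 v), ← ofReal_norm (w v : ℂ), Complex.norm_real,
          ofReal_norm]
    _ ≤ _ := lintegral_mul_sq_le (by fun_prop) hmeas.enorm
    _ ≤ _ := by
        rw [ofReal_exp_neg_mul_eq_lintegral hc]
        simp [hw]

theorem exists_exp_neg_le_rpow {r : ℝ} (hr : 0 < r) :
    ∃ C : ℝ, 0 < C ∧ ∀ y : ℝ, 0 < y → Real.exp (-y) ≤ C * y ^ (-r) := by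
  refine ⟨r ^ r, by positivity, fun y hy => ?_⟩
  have h1 : y / r ≤ Real.exp (y / r) := by linarith [Real.add_one_le_exp (y / r)]
  have h2 : (y / r) ^ r ≤ Real.exp y := by
    refine (Real.rpow_le_rpow (by positivity) h1 hr.le).trans (le_of_eq ?_)
    rw [← Real.exp_mul, div_mul_cancel₀ _ hr.ne']
  rw [Real.div_rpow hy.le hr.le, div_le_iff₀ (by positivity)] at h2
  rw [Real.exp_neg, Real.rpow_neg hy.le, ← div_eq_mul_inv,
    inv_le_comm₀ (by positivity) (by positivity), inv_div, div_le_iff₀ (by positivity)]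
  exact h2

theorem tsum_mul_comp_le {ι κ : Type*} (f : ι → κ) (α : ι → ℝ≥0∞) (β : κ → ℝ≥0∞) {C : ℝ≥0∞}
    (h : ∀ k, ∑' i, (open Classical in if f i = k then α i else 0) ≤ C) :
    ∑' i, α i * β (f i) ≤ C * ∑' k, β k := by
  classical
  calc ∑' i, α i * β (f i) = ∑' i, ∑' k, (if f i = k then α i else 0) * β k := by
        refine tsum_congr fun i => ?_
        rw [tsum_eq_single (f i) (fun k hk => by rw [if_neg (Ne.symm hk), zero_mul]), if_pos rfl]
    _ = ∑' k, (∑' i, if f i = k then α i else 0) * β k := by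
        rw [ENNReal.tsum_comm]
        simp only [ENNReal.tsum_mul_right]
    _ ≤ ∑' k, C * β k := by
        refine ENNReal.tsum_le_tsum fun k => mul_le_mul_left ?_ _
        convert h k
    _ = _ := ENNReal.tsum_mul_left

theorem lintegral_Ioi_rpow {b x : ℝ} (hb : 0 < b) (hx : 0 < x) :
    ∫⁻ v in Set.Ioi x, ENNReal.ofReal (v ^ (-1 - b)) = ENNReal.ofReal (x ^ (-b) / b) := by
  rw [← ofReal_integral_eq_lintegral_ofReal (integrableOn_Ioi_rpow_of_lt (by linarith) hx)
    ((ae_restrict_mem measurableSet_Ioi).mono fun v hv =>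
      Real.rpow_nonneg (hx.le.trans (le_of_lt hv)) _),
    integral_Ioi_rpow_of_lt (by linarith) hx]
  congr 1
  rw [show -1 - b + 1 = -b by ring, neg_div_neg_eq]

/-- The contribution of a half-line of frequencies to the variance. -/
theorem exists_tsum_halfline_le {n : ℕ} (hn : 3 ≤ n) (A : Fin n → ℤ) {i j : Fin n} (hij : i ≠ j)
    (hA : 0 < A i * A j) {ε : ℝ} (hε : 0 < ε) {r : ℝ} (hr : 1 < r) {a : ℝ} (ha : 1 ≤ |a|)
    {c₀ : ℝ} (hc₀ : 0 < c₀) :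
    ∃ C : ℝ≥0∞, C ≠ ⊤ ∧ ∀ (h : (Fin n → ℤ) → ℝ), (∀ m, c₀ * ‖m‖ ^ 2 ≤ h m) →
      ∀ (s : ℝ) (V : ℝ → ℂ), 0 < s → Measurable V → IntegrableOn V (Set.Ioi s) →
      ∑' m : Fin n → ℤ, (if m ≠ 0 then ‖∫ θ in Set.Ioi s, V θ *
        Complex.exp ((-(2 * π * (∑ l, A l * m l ^ 2 : ℤ) * (θ / (a * (s ^ 2 + 4 * θ ^ 2)))) : ℝ)
          * Complex.I) *
        (Real.exp (-(π * s * h m) * (s ^ 2 + 4 * θ ^ 2)⁻¹) : ℝ)‖ₑ ^ 2 else 0) ≤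
      C * ENNReal.ofReal (s ^ (-(((n : ℝ) - 2 + ε) / 2))) *
        ∫⁻ θ in Set.Ioi s, ‖V θ‖ₑ ^ 2 *
          ENNReal.ofReal ((s ^ 2 + 4 * θ ^ 2) ^ (((n : ℝ) - 2 + ε) / 2 + 1) * (1 + θ⁻¹) ^ r) := by
  obtain ⟨C₁, hC₁, hlev⟩ := exists_tsum_level_le hn A hij hA hε
  obtain ⟨C₂, hC₂, hphase⟩ := exists_tsum_enorm_rational_phase_sq_le hr ha
  have hn' : (3 : ℝ) ≤ n := by exact_mod_cast hn
  set b : ℝ := ((n : ℝ) - 2 + ε) / 2 with hb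
  have hb0 : 0 < b := by rw [hb]; linarith
  obtain ⟨C₃, hC₃, hexp⟩ := exists_exp_neg_le_rpow (by linarith : 0 < 1 + b)
  refine ⟨ENNReal.ofReal (C₃ * (π * c₀) ^ (-b)) * C₁ * C₂ * ENNReal.ofReal (1 / b),
    by finiteness, fun h hh s V hs hVm hV => ?_⟩
  set κ : (Fin n → ℤ) → ℤ := fun m => ∑ l, A l * m l ^ 2 with hκ
  set D : ℝ → ℝ := fun θ => s ^ 2 + 4 * θ ^ 2 with hD
  have hD0 : ∀ θ, 0 < D θ := fun θ => by rw [hD]; positivity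
  have hDm : Measurable D := by rw [hD]; fun_prop
  set e : ℤ → ℝ → ℂ := fun k θ =>
    Complex.exp ((-(2 * π * k * (θ / (a * D θ))) : ℝ) * Complex.I) with he
  have hem : ∀ k, Measurable (e k) := fun k => by
    rw [he]
    exact Complex.continuous_exp.measurable.comp ((Complex.measurable_ofReal.comp
      (by fun_prop)).mul_const _)
  have heV : ∀ k, IntegrableOn (fun θ => V θ * e k θ) (Set.Ioi s) := fun k =>
    hV.mul_bdd (c := 1) (hem k).aestronglyMeasurable (ae_of_all _ fun u => by
      rw [he, Complex.norm_exp_ofReal_mul_I])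
  set G : ℤ → ℝ → ℂ := fun k v =>
    ∫ θ in Set.Ioi s, (if (D θ)⁻¹ < v then V θ * e k θ else 0) with hG
  have hGm : ∀ k, Measurable (G k) := fun k => by
    have h1 : Measurable fun z : ℝ × ℝ => if (D z.2)⁻¹ < z.1 then V z.2 * e k z.2 else 0 :=
      Measurable.ite (measurableSet_lt (by fun_prop) measurable_fst)
        ((hVm.comp measurable_snd).mul ((hem k).comp measurable_snd)) measurable_const
    exact h1.stronglyMeasurable.integral_prod_right'.measurable
  have hGsum : ∀ v, ∑' k, ‖G k v‖ₑ ^ 2 ≤ C₂ * ∫⁻ θ in Set.Ioi s,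
      if (D θ)⁻¹ < v then ‖V θ‖ₑ ^ 2 * ENNReal.ofReal (D θ * (1 + θ⁻¹) ^ r) else 0 := fun v => by
    have hset : MeasurableSet {θ | (D θ)⁻¹ < v} := measurableSet_lt hDm.inv measurable_const
    have h1 := hphase s ({θ | (D θ)⁻¹ < v}.indicator V) hs (hV.indicator hset)
    refine (le_of_eq ?_).trans (h1.trans (le_of_eq ?_))
    · refine tsum_congr fun k => ?_
      congr 2
      refine integral_congr_ae (ae_of_all _ fun θ => ?_)
      simp only [Set.indicator, Set.mem_ofPred_eq, ite_mul, zero_mul, he, hD]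
    · congr 1
      refine lintegral_congr fun θ => ?_
      simp only [Set.indicator, Set.mem_ofPred_eq]
      split_ifs <;> simp [hD]
  have hterm : ∀ m : Fin n → ℤ, (if m ≠ 0 then ‖∫ θ in Set.Ioi s, V θ * e (κ m) θ *
        (Real.exp (-(π * s * h m) * (D θ)⁻¹) : ℝ)‖ₑ ^ 2 else 0) ≤
      ∫⁻ v in Set.Ioi 0, ENNReal.ofReal (C₃ * (π * c₀) ^ (-b)) * ENNReal.ofReal (s ^ (-b)) *
        ENNReal.ofReal (v ^ (-1 - b)) *
        ((if m ≠ 0 then ENNReal.ofReal (‖m‖ ^ (-((n : ℝ) - 2 + ε))) else 0) *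
          ‖G (κ m) v‖ₑ ^ 2) := fun m => by
    split_ifs with hm
    swap
    · exact zero_le
    have hm0 : 0 < ‖m‖ := norm_pos_iff.2 hm
    have hhm : 0 < h m := lt_of_lt_of_le (by positivity) (hh m)
    have hc : 0 < π * s * h m := by positivity
    refine (enorm_integral_mul_exp_sq_le hc (heV (κ m)) hDm.inv
      (fun θ => (inv_pos.2 (hD0 θ)).le)).trans ?_
    refine setLIntegral_mono' measurableSet_Ioi fun v hv => ?_
    have hv0 : 0 < v := hv
    rw [← mul_assoc]
    gcongr
    rw [← ENNReal.ofReal_mul (by positivity), ← ENNReal.ofReal_mul (by positivity),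
      ← ENNReal.ofReal_mul (by positivity)]
    refine ENNReal.ofReal_le_ofReal ?_
    calc π * s * h m * Real.exp (-(π * s * h m) * v)
        ≤ π * s * h m * (C₃ * (π * s * h m * v) ^ (-(1 + b))) := by
          gcongr
          rw [neg_mul]
          exact hexp _ (by positivity)
      _ = C₃ * (π * s * h m) ^ (-b) * v ^ (-1 - b) := by
          rw [Real.mul_rpow hc.le hv0.le, show -(1 + b) = -1 + -b by ring,
            Real.rpow_add hc, Real.rpow_neg_one]
          rw [show -1 + -b = -1 - b by ring]
          field_simp
      _ ≤ C₃ * (π * s * (c₀ * ‖m‖ ^ 2)) ^ (-b) * v ^ (-1 - b) := by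
          gcongr ?_ * ?_ * ?_
          refine Real.rpow_le_rpow_of_nonpos (by positivity) ?_ (by linarith)
          gcongr
          exact hh m
      _ = _ := by
          rw [show π * s * (c₀ * ‖m‖ ^ 2) = (π * c₀) * s * ‖m‖ ^ 2 by ring,
            Real.mul_rpow (by positivity) (by positivity),
            Real.mul_rpow (by positivity) (by positivity), ← Real.rpow_natCast ‖m‖ 2,
            ← Real.rpow_mul hm0.le]
          rw [show ((2 : ℕ) : ℝ) * -b = -((n : ℝ) - 2 + ε) by rw [hb]; push_cast; ring]
          ring
    exact le_rfl
  calc _ ≤ ∑' m : Fin n → ℤ, ∫⁻ v in Set.Ioi 0, ENNReal.ofReal (C₃ * (π * c₀) ^ (-b)) *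
          ENNReal.ofReal (s ^ (-b)) * ENNReal.ofReal (v ^ (-1 - b)) *
        ((if m ≠ 0 then ENNReal.ofReal (‖m‖ ^ (-((n : ℝ) - 2 + ε))) else 0) *
          ‖G (κ m) v‖ₑ ^ 2) := ENNReal.tsum_le_tsum hterm
    _ = ∫⁻ v in Set.Ioi 0, ENNReal.ofReal (C₃ * (π * c₀) ^ (-b)) *
          ENNReal.ofReal (s ^ (-b)) * ENNReal.ofReal (v ^ (-1 - b)) *
        ∑' m : Fin n → ℤ, ((if m ≠ 0 then ENNReal.ofReal (‖m‖ ^ (-((n : ℝ) - 2 + ε))) else 0) *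
          ‖G (κ m) v‖ₑ ^ 2) := by
        rw [← lintegral_tsum fun m => by
          have := hGm (κ m)
          fun_prop]
        simp only [ENNReal.tsum_mul_left]
    _ ≤ ∫⁻ v in Set.Ioi 0, ENNReal.ofReal (C₃ * (π * c₀) ^ (-b)) *
          ENNReal.ofReal (s ^ (-b)) * ENNReal.ofReal (v ^ (-1 - b)) *
        (C₁ * (C₂ * ∫⁻ θ in Set.Ioi s,
          if (D θ)⁻¹ < v then ‖V θ‖ₑ ^ 2 * ENNReal.ofReal (D θ * (1 + θ⁻¹) ^ r) else 0)) := by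
        gcongr with v
        refine (tsum_mul_comp_le κ _ (fun k => ‖G k v‖ₑ ^ 2) (C := C₁) fun k => ?_).trans ?_
        · refine (le_of_eq ?_).trans (hlev k)
          refine tsum_congr fun m => ?_
          simp only [← ite_and, hκ]
          congr 1
          rw [and_comm]
        · gcongr
          exact hGsum v
    _ = ENNReal.ofReal (C₃ * (π * c₀) ^ (-b)) * ENNReal.ofReal (s ^ (-b)) * C₁ * C₂ *
        ∫⁻ v in Set.Ioi 0, ∫⁻ θ in Set.Ioi s, if (D θ)⁻¹ < v then ENNReal.ofReal (v ^ (-1 - b)) *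
          (‖V θ‖ₑ ^ 2 * ENNReal.ofReal (D θ * (1 + θ⁻¹) ^ r)) else 0 := by
        rw [← lintegral_const_mul' _ _ (by finiteness)]
        refine lintegral_congr fun v => ?_
        have h5 : ∀ θ, (if (D θ)⁻¹ < v then ENNReal.ofReal (v ^ (-1 - b)) *
          (‖V θ‖ₑ ^ 2 * ENNReal.ofReal (D θ * (1 + θ⁻¹) ^ r)) else 0) =
          ENNReal.ofReal (v ^ (-1 - b)) * (if (D θ)⁻¹ < v then
          (‖V θ‖ₑ ^ 2 * ENNReal.ofReal (D θ * (1 + θ⁻¹) ^ r)) else 0) := fun θ => by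
          rw [mul_ite, mul_zero]
        simp only [h5]
        rw [lintegral_const_mul' _ _ (by finiteness)]
        ring
    _ = ENNReal.ofReal (C₃ * (π * c₀) ^ (-b)) * ENNReal.ofReal (s ^ (-b)) * C₁ * C₂ *
        ∫⁻ θ in Set.Ioi s, ENNReal.ofReal (D θ ^ b / b) *
          (‖V θ‖ₑ ^ 2 * ENNReal.ofReal (D θ * (1 + θ⁻¹) ^ r)) := by
        congr 1
        rw [lintegral_lintegral_swap]
        · refine lintegral_congr fun θ => ?_
          have h6 : ∀ v, (if (D θ)⁻¹ < v then ENNReal.ofReal (v ^ (-1 - b)) *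
              (‖V θ‖ₑ ^ 2 * ENNReal.ofReal (D θ * (1 + θ⁻¹) ^ r)) else 0) =
            (Set.Ioi (D θ)⁻¹).indicator (fun v => ENNReal.ofReal (v ^ (-1 - b)) *
              (‖V θ‖ₑ ^ 2 * ENNReal.ofReal (D θ * (1 + θ⁻¹) ^ r))) v := fun v => by
            simp only [Set.indicator, Set.mem_Ioi]
          simp only [h6]
          rw [setLIntegral_indicator measurableSet_Ioi, Set.Ioi_inter_Ioi,
            max_eq_left (inv_pos.2 (hD0 θ)).le, lintegral_mul_const' _ _ (by finiteness),
            lintegral_Ioi_rpow hb0 (inv_pos.2 (hD0 θ)), Real.inv_rpow (hD0 θ).le,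
            Real.rpow_neg (hD0 θ).le, inv_inv]
        · refine Measurable.aemeasurable ?_
          refine Measurable.ite (measurableSet_lt (by fun_prop) measurable_fst) ?_ measurable_const
          fun_prop
    _ = _ := by
        rw [show ∀ x y z w t u : ℝ≥0∞, x * z * w * t * y * u = (x * y * z * w) * (t * u) from
          fun x y z w t u => by ring, ← lintegral_const_mul' (ENNReal.ofReal (1 / b)) _
            (by finiteness)]
        congr 1
        refine setLIntegral_congr_fun measurableSet_Ioi fun θ hθ => ?_
        have hθ0 : 0 < θ := hs.trans hθ
        have hDθ := hD0 θ
        change _ = ENNReal.ofReal (1 / b) * (‖V θ‖ₑ ^ 2 *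
          ENNReal.ofReal (D θ ^ (b + 1) * (1 + θ⁻¹) ^ r))
        rw [mul_left_comm, mul_left_comm (ENNReal.ofReal (1 / b)),
          ← ENNReal.ofReal_mul (by positivity), ← ENNReal.ofReal_mul (by positivity),
          Real.rpow_add hDθ, Real.rpow_one]
        congr 2
        ring

theorem integrableOn_rpow_mul_inv_one_add_sq {ε : ℝ} (hε : 0 < ε) (hε1 : ε < 1) :
    IntegrableOn (fun u : ℝ => (u ^ ε + u ^ (ε / 2 - 1)) / (1 + u ^ 2) ^ 2) (Set.Ioi 0) := by
  have hmeas : Measurable fun u : ℝ => (u ^ ε + u ^ (ε / 2 - 1)) / (1 + u ^ 2) ^ 2 := by fun_prop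
  rw [← Set.Ioc_union_Ioi_eq_Ioi (zero_le_one : (0 : ℝ) ≤ 1)]
  refine IntegrableOn.union ?_ ?_
  · have h1 : IntegrableOn (fun u : ℝ => 2 * u ^ (ε / 2 - 1)) (Set.Ioc 0 1) := by
      have := (intervalIntegral.intervalIntegrable_rpow' (a := 0) (b := 1)
        (by linarith : -1 < ε / 2 - 1)).const_mul 2
      rwa [intervalIntegrable_iff_integrableOn_Ioc_of_le zero_le_one] at this
    refine Integrable.mono' h1 hmeas.aestronglyMeasurable ?_
    filter_upwards [ae_restrict_mem measurableSet_Ioc] with u hu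
    have hu0 : 0 < u := hu.1
    have h2 : u ^ ε ≤ u ^ (ε / 2 - 1) :=
      Real.rpow_le_rpow_of_exponent_ge hu0 hu.2 (by linarith)
    have h3 := Real.rpow_pos_of_pos hu0 ε
    rw [Real.norm_of_nonneg (by positivity), div_le_iff₀ (by positivity)]
    have h4 : (1 : ℝ) ≤ (1 + u ^ 2) ^ 2 := one_le_pow₀ (by nlinarith)
    nlinarith
  · have h1 : IntegrableOn (fun u : ℝ => 2 * u ^ (-2 : ℝ)) (Set.Ioi 1) :=
      (integrableOn_Ioi_rpow_of_lt (by norm_num) zero_lt_one).const_mul 2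
    refine Integrable.mono' h1 hmeas.aestronglyMeasurable ?_
    filter_upwards [ae_restrict_mem measurableSet_Ioi] with u hu
    have hu1 : 1 < u := hu
    have hu0 : 0 < u := by linarith
    have h2 : u ^ ε ≤ u ^ (2 : ℝ) := Real.rpow_le_rpow_of_exponent_le hu1.le (by linarith)
    have h3 : u ^ (ε / 2 - 1) ≤ u ^ (2 : ℝ) :=
      Real.rpow_le_rpow_of_exponent_le hu1.le (by linarith)
    rw [Real.norm_of_nonneg (by positivity), div_le_iff₀ (by positivity), Real.rpow_neg hu0.le]
    rw [Real.rpow_two] at *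
    have h4 : u ^ 2 * u ^ 2 ≤ (1 + u ^ 2) ^ 2 := by nlinarith [sq_nonneg u]
    calc _ ≤ 2 * u ^ 2 := by linarith
      _ = 2 * (u ^ 2)⁻¹ * (u ^ 2 * u ^ 2) := by field_simp
      _ ≤ _ := by gcongr

theorem exists_lintegral_weight_le (n : ℕ) {ε : ℝ} (hε : 0 < ε) (hε1 : ε < 1) :
    ∃ C : ℝ, 0 ≤ C ∧ ∀ s δ : ℝ, 0 < s → 0 < δ → δ ≤ 1 →
      ∫⁻ θ in Set.Ioi s, ENNReal.ofReal ((δ / (1 + (δ * θ) ^ 2) *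
        (s ^ 2 + 4 * θ ^ 2) ^ (-(n : ℝ) / 4)) ^ 2) * ENNReal.ofReal
        ((s ^ 2 + 4 * θ ^ 2) ^ (((n : ℝ) - 2 + ε) / 2 + 1) * (1 + θ⁻¹) ^ (1 + ε / 2)) ≤
      ENNReal.ofReal (C * δ ^ (1 - ε)) := by
  set Ψ : ℝ → ℝ := fun u : ℝ => (u ^ ε + u ^ (ε / 2 - 1)) / (1 + u ^ 2) ^ 2 with hΨ
  have hΨi := integrableOn_rpow_mul_inv_one_add_sq hε hε1
  have hΨ0 : ∀ u, 0 < u → 0 ≤ Ψ u := fun u hu => by rw [hΨ]; positivity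
  refine ⟨20 * ∫ u in Set.Ioi 0, Ψ u, mul_nonneg (by norm_num)
    (setIntegral_nonneg measurableSet_Ioi fun u hu => hΨ0 u hu), fun s δ hs hδ hδ1 => ?_⟩
  have hpt : ∀ θ ∈ Set.Ioi s, ENNReal.ofReal ((δ / (1 + (δ * θ) ^ 2) *
        (s ^ 2 + 4 * θ ^ 2) ^ (-(n : ℝ) / 4)) ^ 2) * ENNReal.ofReal
        ((s ^ 2 + 4 * θ ^ 2) ^ (((n : ℝ) - 2 + ε) / 2 + 1) * (1 + θ⁻¹) ^ (1 + ε / 2)) ≤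
      ENNReal.ofReal (20 * δ ^ (2 - ε) * Ψ (δ * θ)) := by
    intro θ hθ
    have hθs : s < θ := hθ
    have hθ0 : 0 < θ := hs.trans hθs
    have hD : 0 < s ^ 2 + 4 * θ ^ 2 := by positivity
    rw [← ENNReal.ofReal_mul (by positivity)]
    refine ENNReal.ofReal_le_ofReal ?_
    have e1 : ((s ^ 2 + 4 * θ ^ 2) ^ (-(n : ℝ) / 4)) ^ 2 *
        (s ^ 2 + 4 * θ ^ 2) ^ (((n : ℝ) - 2 + ε) / 2 + 1) = (s ^ 2 + 4 * θ ^ 2) ^ (ε / 2) := by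
      rw [← Real.rpow_natCast, ← Real.rpow_mul hD.le, ← Real.rpow_add hD]
      congr 1; push_cast; ring
    have e2 : (s ^ 2 + 4 * θ ^ 2) ^ (ε / 2) ≤ 5 * θ ^ ε := by
      calc _ ≤ (5 * θ ^ 2) ^ (ε / 2) :=
            Real.rpow_le_rpow hD.le (by nlinarith) (by positivity)
        _ = 5 ^ (ε / 2) * θ ^ ε := by
            rw [Real.mul_rpow (by norm_num) (by positivity), ← Real.rpow_natCast θ 2,
              ← Real.rpow_mul hθ0.le]
            congr 2; push_cast; ring
        _ ≤ 5 ^ (1 : ℝ) * θ ^ ε := by gcongr <;> linarith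
        _ = _ := by rw [Real.rpow_one]
    have e3 : (1 + θ⁻¹) ^ (1 + ε / 2) ≤ 4 * (1 + θ ^ (-(1 + ε / 2))) := by
      have h2 : (2 : ℝ) ^ (1 + ε / 2) ≤ 4 := by
        calc (2 : ℝ) ^ (1 + ε / 2) ≤ 2 ^ (2 : ℝ) :=
              Real.rpow_le_rpow_of_exponent_le (by norm_num) (by linarith)
          _ = 4 := by norm_num
      have h3 := Real.rpow_pos_of_pos hθ0 (-(1 + ε / 2))
      rcases le_total 1 θ with h | h
      · have : θ⁻¹ ≤ 1 := inv_le_one_of_one_le₀ h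
        calc _ ≤ (2 : ℝ) ^ (1 + ε / 2) :=
              Real.rpow_le_rpow (by positivity) (by linarith) (by positivity)
          _ ≤ _ := by linarith
      · have : 1 ≤ θ⁻¹ := (one_le_inv₀ hθ0).2 h
        calc _ ≤ (2 * θ⁻¹ : ℝ) ^ (1 + ε / 2) :=
              Real.rpow_le_rpow (by positivity) (by linarith) (by positivity)
          _ = 2 ^ (1 + ε / 2) * θ ^ (-(1 + ε / 2)) := by
              rw [Real.mul_rpow (by norm_num) (by positivity), Real.inv_rpow hθ0.le,
                Real.rpow_neg hθ0.le]
          _ ≤ 4 * θ ^ (-(1 + ε / 2)) := by gcongr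
          _ ≤ _ := by linarith
    have e4 : θ ^ ε * (1 + θ ^ (-(1 + ε / 2))) ≤
        δ ^ (-ε) * ((δ * θ) ^ ε + (δ * θ) ^ (ε / 2 - 1)) := by
      have h1 : θ ^ ε * θ ^ (-(1 + ε / 2)) = θ ^ (ε / 2 - 1) := by
        rw [← Real.rpow_add hθ0]; congr 1; ring
      have h2 : δ ^ (-ε) * (δ * θ) ^ ε = θ ^ ε := by
        rw [Real.mul_rpow hδ.le hθ0.le, ← mul_assoc, ← Real.rpow_add hδ, neg_add_cancel,
          Real.rpow_zero, one_mul]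
      have h3 : θ ^ (ε / 2 - 1) ≤ δ ^ (-ε) * (δ * θ) ^ (ε / 2 - 1) := by
        rw [Real.mul_rpow hδ.le hθ0.le, ← mul_assoc, ← Real.rpow_add hδ]
        refine le_mul_of_one_le_left (by positivity) ?_
        exact Real.one_le_rpow_of_pos_of_le_one_of_nonpos hδ hδ1 (by linarith)
      rw [mul_add, mul_add, mul_one, h1, h2]; linarith
    calc _ = δ ^ 2 / (1 + (δ * θ) ^ 2) ^ 2 * (((s ^ 2 + 4 * θ ^ 2) ^ (-(n : ℝ) / 4)) ^ 2 *
          (s ^ 2 + 4 * θ ^ 2) ^ (((n : ℝ) - 2 + ε) / 2 + 1) * (1 + θ⁻¹) ^ (1 + ε / 2)) := by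
          field_simp
      _ ≤ δ ^ 2 / (1 + (δ * θ) ^ 2) ^ 2 * (5 * θ ^ ε * (4 * (1 + θ ^ (-(1 + ε / 2))))) := by
          rw [e1]; gcongr
      _ = 20 * (δ ^ 2 / (1 + (δ * θ) ^ 2) ^ 2 * (θ ^ ε * (1 + θ ^ (-(1 + ε / 2))))) := by ring
      _ ≤ 20 * (δ ^ 2 / (1 + (δ * θ) ^ 2) ^ 2 *
          (δ ^ (-ε) * ((δ * θ) ^ ε + (δ * θ) ^ (ε / 2 - 1)))) := by gcongr
      _ = _ := by
          rw [hΨ, show 2 - ε = 2 + -ε by ring, Real.rpow_add hδ, Real.rpow_two]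
          ring
  calc _ ≤ ∫⁻ θ in Set.Ioi s, ENNReal.ofReal (20 * δ ^ (2 - ε) * Ψ (δ * θ)) :=
        setLIntegral_mono' measurableSet_Ioi hpt
    _ ≤ ∫⁻ θ in Set.Ioi 0, ENNReal.ofReal (20 * δ ^ (2 - ε) * Ψ (δ * θ)) :=
        lintegral_mono_set (Set.Ioi_subset_Ioi hs.le)
    _ = ENNReal.ofReal (∫ θ in Set.Ioi 0, 20 * δ ^ (2 - ε) * Ψ (δ * θ)) := by
        rw [ofReal_integral_eq_lintegral_ofReal]
        · refine Integrable.const_mul ?_ _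
          exact (integrableOn_Ioi_comp_mul_left_iff Ψ 0 hδ).2 (by rwa [mul_zero])
        · filter_upwards [ae_restrict_mem measurableSet_Ioi] with θ hθ
          exact mul_nonneg (by positivity) (hΨ0 _ (mul_pos hδ hθ))
    _ = _ := by
        rw [integral_const_mul, integral_comp_mul_left_Ioi _ _ hδ, mul_zero]
        congr 1
        rw [show 2 - ε = (1 - ε) + 1 by ring, Real.rpow_add hδ, Real.rpow_one, smul_eq_mul]
        field_simp

/-- The product of the other coefficients. -/
def coprod {n : ℕ} (a : Fin n → ℤ) (l : Fin n) : ℤ := ∏ i ∈ Finset.univ.erase l, a i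

theorem mul_coprod {n : ℕ} (a : Fin n → ℤ) (l : Fin n) : a l * coprod a l = ∏ i, a i :=
  Finset.mul_prod_erase _ _ (Finset.mem_univ l)

/-- The complex Gaussian parameters `s |aⱼ| - 2 i θ aⱼ`. -/
def gaussParam {n : ℕ} (a : Fin n → ℤ) (s θ : ℝ) (j : Fin n) : ℂ :=
  ((s * |(a j : ℝ)| : ℝ) : ℂ) - ((2 * θ * a j : ℝ) : ℂ) * Complex.I

theorem norm_gaussParam {n : ℕ} (a : Fin n → ℤ) (s θ : ℝ) (j : Fin n) :
    ‖gaussParam a s θ j‖ = |(a j : ℝ)| * (s ^ 2 + 4 * θ ^ 2) ^ (1 / 2 : ℝ) := by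
  rw [← Real.sqrt_eq_rpow, ← Real.sqrt_sq_eq_abs, ← Real.sqrt_mul (sq_nonneg _),
    gaussParam, sub_eq_add_neg, ← neg_mul, ← Complex.ofReal_neg, Complex.norm_add_mul_I]
  congr 1
  rw [mul_pow, sq_abs]; ring

theorem gaussParam_re_pos {n : ℕ} {a : Fin n → ℤ} (ha : ∀ j, a j ≠ 0) {s : ℝ} (hs : 0 < s)
    (θ : ℝ) (j : Fin n) : 0 < (gaussParam a s θ j).re := by
  have : 0 < |(a j : ℝ)| := abs_pos.2 (by exact_mod_cast ha j)
  have h : (gaussParam a s θ j).re = s * |(a j : ℝ)| := by simp [gaussParam]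
  rw [h]; positivity

theorem inv_gaussParam {n : ℕ} {a : Fin n → ℤ} (ha : ∀ j, a j ≠ 0) {s : ℝ} (hs : 0 < s)
    (θ : ℝ) (j : Fin n) : (gaussParam a s θ j)⁻¹ =
      ((s / (|(a j : ℝ)| * (s ^ 2 + 4 * θ ^ 2)) : ℝ) : ℂ) +
        ((2 * θ / (a j * (s ^ 2 + 4 * θ ^ 2)) : ℝ) : ℂ) * Complex.I := by
  have h0 : gaussParam a s θ j ≠ 0 := fun h => by
    simpa [h] using gaussParam_re_pos ha hs θ j
  have haj : (a j : ℝ) ≠ 0 := by exact_mod_cast ha j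
  have hD : s ^ 2 + 4 * θ ^ 2 ≠ 0 := by positivity
  have habs : |(a j : ℝ)| ≠ 0 := abs_ne_zero.2 haj
  have hsq := sq_abs (a j : ℝ)
  refine inv_eq_of_mul_eq_one_right ?_
  apply Complex.ext
  · simp only [gaussParam, Complex.mul_re, Complex.mul_im, Complex.add_re, Complex.add_im,
      Complex.sub_re, Complex.sub_im, Complex.ofReal_re, Complex.ofReal_im, Complex.I_re,
      Complex.I_im,
      Complex.one_re]
    ring_nf
    field_simp
  · simp only [gaussParam, Complex.mul_re, Complex.mul_im, Complex.add_re, Complex.add_im,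
      Complex.sub_re, Complex.sub_im, Complex.ofReal_re, Complex.ofReal_im, Complex.I_re,
      Complex.I_im,
      Complex.one_im]
    ring_nf
    field_simp
    ring_nf
    rw [hsq]; ring

/-- The amplitude in the frequency representation of the Fourier coefficients. -/
noncomputable def amplitude {n : ℕ} (a : Fin n → ℤ) (G : ℝ → ℂ) (ξ s δ θ : ℝ) : ℂ :=
  δ * G (δ * θ) * Complex.exp ((-(2 * π * θ * ξ) : ℝ) * Complex.I) *
    ∏ j, (gaussParam a s θ j)⁻¹ ^ (1 / 2 : ℂ)

theorem measurable_amplitude {n : ℕ} (a : Fin n → ℤ) {G : ℝ → ℂ} (hG : Continuous G)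
    (ξ s δ : ℝ) : Measurable (amplitude a G ξ s δ) := by
  unfold amplitude gaussParam
  have := hG.measurable
  fun_prop

theorem norm_amplitude_le {n : ℕ} {a : Fin n → ℤ} (ha : ∀ j, a j ≠ 0) {G : ℝ → ℂ} {K : ℝ}
    (hK : ∀ t, ‖G t‖ ≤ K / (1 + t ^ 2)) (ξ : ℝ) {s δ : ℝ} (hs : 0 < s) (hδ : 0 < δ) (θ : ℝ) :
    ‖amplitude a G ξ s δ θ‖ ≤
      K * (δ / (1 + (δ * θ) ^ 2) * (s ^ 2 + 4 * θ ^ 2) ^ (-(n : ℝ) / 4)) := by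
  have hD : 0 < s ^ 2 + 4 * θ ^ 2 := by positivity
  have h1 : ‖∏ j, (gaussParam a s θ j)⁻¹ ^ (1 / 2 : ℂ)‖ ≤
      (s ^ 2 + 4 * θ ^ 2) ^ (-(n : ℝ) / 4) := by
    rw [norm_prod]
    calc _ ≤ ∏ _j : Fin n, (s ^ 2 + 4 * θ ^ 2) ^ (-(1 : ℝ) / 4) := by
          refine Finset.prod_le_prod (fun j _ => norm_nonneg _) fun j _ => ?_
          have haj : 1 ≤ |(a j : ℝ)| := by exact_mod_cast Int.one_le_abs (ha j)
          rw [show (1 / 2 : ℂ) = ((1 / 2 : ℝ) : ℂ) by norm_num, Complex.norm_cpow_real, norm_inv,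
            norm_gaussParam, mul_inv, Real.mul_rpow (by positivity) (by positivity)]
          rw [← Real.rpow_neg hD.le, ← Real.rpow_mul hD.le]
          calc _ ≤ 1 * (s ^ 2 + 4 * θ ^ 2) ^ (-(1 / 2) * (1 / 2) : ℝ) := by
                gcongr
                exact Real.rpow_le_one (by positivity) (inv_le_one_of_one_le₀ haj) (by norm_num)
            _ = _ := by rw [one_mul]; norm_num
      _ = _ := by
          rw [Finset.prod_const, Finset.card_univ, Fintype.card_fin, ← Real.rpow_natCast,
            ← Real.rpow_mul hD.le]
          congr 1; ring
  rw [amplitude, norm_mul, norm_mul, norm_mul, Complex.norm_exp_ofReal_mul_I, mul_one,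
    Complex.norm_real, Real.norm_of_nonneg hδ.le]
  calc _ ≤ δ * (K / (1 + (δ * θ) ^ 2)) * (s ^ 2 + 4 * θ ^ 2) ^ (-(n : ℝ) / 4) := by
        gcongr
        · exact mul_nonneg hδ.le ((norm_nonneg _).trans (hK _))
        · exact hK _
    _ = _ := by ring

theorem integral_gauss_eq {n : ℕ} {a : Fin n → ℤ} (ha : ∀ j, a j ≠ 0) {s : ℝ} (hs : 0 < s)
    (θ : ℝ) (m : Fin n → ℤ) :
    ∫ x : Fin n → ℝ, Complex.exp (-∑ j, (π * gaussParam a s θ j) * (x j : ℂ) ^ 2 +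
      ∑ j, (-(2 * π * m j : ℝ) * Complex.I) * x j) =
    (∏ j, (gaussParam a s θ j)⁻¹ ^ (1 / 2 : ℂ)) *
      Complex.exp ((-(2 * π * (∑ l, coprod a l * m l ^ 2 : ℤ) *
        (θ / ((∏ i, a i : ℤ) * (s ^ 2 + 4 * θ ^ 2)))) : ℝ) * Complex.I) *
      (Real.exp (-(π * s * ∑ j, (m j : ℝ) ^ 2 / |(a j : ℝ)|) * (s ^ 2 + 4 * θ ^ 2)⁻¹) : ℝ) := by
  have hre : ∀ j, 0 < ((π : ℂ) * gaussParam a s θ j).re := fun j => by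
    rw [Complex.re_ofReal_mul]; exact mul_pos Real.pi_pos (gaussParam_re_pos ha hs θ j)
  have h0 : ∀ j, gaussParam a s θ j ≠ 0 := fun j h => by
    simpa [h] using gaussParam_re_pos ha hs θ j
  have hpi : (π : ℂ) ≠ 0 := by exact_mod_cast Real.pi_ne_zero
  rw [GaussianFourier.integral_cexp_neg_sum_mul_add hre, Finset.prod_mul_distrib,
    ← Complex.exp_sum, mul_assoc, Complex.ofReal_exp, ← Complex.exp_add]
  congr 1
  · refine Finset.prod_congr rfl fun j _ => ?_
    congr 1
    field_simp
  · congr 1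
    have hD : s ^ 2 + 4 * θ ^ 2 ≠ 0 := by positivity
    have ht : ∀ j, (-(2 * π * m j : ℝ) * Complex.I) ^ 2 / (4 * ((π : ℂ) * gaussParam a s θ j)) =
        ((-(2 * π * (coprod a j * m j ^ 2 : ℤ) *
          (θ / ((∏ i, a i : ℤ) * (s ^ 2 + 4 * θ ^ 2)))) : ℝ) : ℂ) * Complex.I +
        ((-(π * s * ((m j : ℝ) ^ 2 / |(a j : ℝ)|)) * (s ^ 2 + 4 * θ ^ 2)⁻¹ : ℝ) : ℂ) := fun j => by
      have haj : (a j : ℝ) ≠ 0 := by exact_mod_cast ha j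
      have hc : (coprod a j : ℝ) ≠ 0 := by
        have : coprod a j ≠ 0 := Finset.prod_ne_zero_iff.2 fun i _ => ha i
        exact_mod_cast this
      have hnum : (-(2 * π * m j : ℝ) * Complex.I) ^ 2 / (4 * ((π : ℂ) * gaussParam a s θ j)) =
          ((-(π * m j ^ 2) : ℝ) : ℂ) * (gaussParam a s θ j)⁻¹ := by
        have := h0 j
        field_simp
        push_cast
        rw [Complex.I_sq]; ring
      rw [hnum, inv_gaussParam ha hs, ← mul_coprod a j]
      have habs : |(a j : ℝ)| ≠ 0 := abs_ne_zero.2 haj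
      apply Complex.ext
      · simp only [Complex.mul_re, Complex.mul_im, Complex.add_re, Complex.add_im,
          Complex.ofReal_re, Complex.ofReal_im, Complex.I_re, Complex.I_im]
        push_cast
        field_simp
        ring_nf
      · simp only [Complex.mul_re, Complex.mul_im, Complex.add_re, Complex.add_im,
          Complex.ofReal_re, Complex.ofReal_im, Complex.I_re, Complex.I_im]
        push_cast
        field_simp
        ring_nf
    rw [Finset.sum_congr rfl fun j _ => ht j, Finset.sum_add_distrib, ← Finset.sum_mul,
      ← Complex.ofReal_sum, ← Complex.ofReal_sum]
    congr 3
    · push_cast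
      rw [Finset.mul_sum, Finset.sum_mul, ← Finset.sum_neg_distrib]
    · rw [Finset.mul_sum, ← Finset.sum_neg_distrib, Finset.sum_mul]

/-- The diagonal form with integer coefficients. -/
def diagForm {n : ℕ} (a : Fin n → ℤ) (x : Fin n → ℝ) : ℝ := ∑ j, (a j : ℝ) * x j ^ 2

/-- The positive definite majorant of the diagonal form. -/
def diagMajorant {n : ℕ} (a : Fin n → ℤ) (x : Fin n → ℝ) : ℝ := ∑ j, |(a j : ℝ)| * x j ^ 2

/-- The smoothed counting weight. -/
noncomputable def smoothWeight {n : ℕ} (a : Fin n → ℤ) (g : ℝ → ℝ) (ξ s δ : ℝ)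
    (x : Fin n → ℝ) : ℝ :=
  Real.exp (-(π * s * diagMajorant a x)) * g ((diagForm a x - ξ) / δ)

/-- The Fourier coefficient of the weight. -/
noncomputable def weightFourier {n : ℕ} (a : Fin n → ℤ) (g : ℝ → ℝ) (ξ s δ : ℝ)
    (m : Fin n → ℤ) : ℂ :=
  ∫ x : Fin n → ℝ, (smoothWeight a g ξ s δ x : ℂ) *
    Complex.exp ((-(2 * π * ∑ j, m j * x j) : ℝ) * Complex.I)

theorem integrable_exp_neg_diagMajorant {n : ℕ} {a : Fin n → ℤ} (ha : ∀ j, a j ≠ 0) {s : ℝ}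
    (hs : 0 < s) : Integrable fun x : Fin n → ℝ => Real.exp (-(π * s * diagMajorant a x)) := by
  have h := GaussianFourier.integrable_cexp_neg_sum_mul_add
    (b := fun j => ((π * s * |(a j : ℝ)| : ℝ) : ℂ)) (fun j => by
      have : 0 < |(a j : ℝ)| := abs_pos.2 (by exact_mod_cast ha j)
      rw [Complex.ofReal_re]; positivity) 0
  refine h.norm.congr (ae_of_all _ fun x => ?_)
  dsimp only
  rw [Complex.norm_exp]
  congr 1
  have : (-∑ j, ((π * s * |(a j : ℝ)| : ℝ) : ℂ) * (x j : ℂ) ^ 2 +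
      ∑ j, (0 : Fin n → ℂ) j * (x j : ℂ)) = ((-(π * s * diagMajorant a x) : ℝ) : ℂ) := by
    rw [diagMajorant, Finset.mul_sum]
    push_cast
    simp [mul_assoc]
  rw [this, Complex.ofReal_re]

theorem exp_gaussParam_eq {n : ℕ} (a : Fin n → ℤ) (s θ : ℝ) (m : Fin n → ℤ) (x : Fin n → ℝ) :
    Complex.exp (-∑ j, (π * gaussParam a s θ j) * (x j : ℂ) ^ 2 +
      ∑ j, (-(2 * π * m j : ℝ) * Complex.I) * x j) =
    (Real.exp (-(π * s * diagMajorant a x)) : ℝ) *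
      Complex.exp ((2 * π * θ * diagForm a x : ℝ) * Complex.I) *
      Complex.exp ((-(2 * π * ∑ j, m j * x j) : ℝ) * Complex.I) := by
  rw [Complex.ofReal_exp, ← Complex.exp_add, ← Complex.exp_add]
  congr 1
  rw [diagMajorant, diagForm, Finset.mul_sum, Finset.mul_sum, Finset.mul_sum]
  push_cast
  rw [← Finset.sum_neg_distrib, ← Finset.sum_neg_distrib, ← Finset.sum_neg_distrib,
    Finset.sum_mul, Finset.sum_mul, ← Finset.sum_add_distrib, ← Finset.sum_add_distrib,
    ← Finset.sum_add_distrib]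
  refine Finset.sum_congr rfl fun j _ => ?_
  rw [gaussParam]
  push_cast
  ring

theorem weightFourier_eq {n : ℕ} {a : Fin n → ℤ} (ha : ∀ j, a j ≠ 0) {G : ℝ → ℂ}
    (hG : Continuous G) (hGi : Integrable G) {g : ℝ → ℝ}
    (hg : ∀ y, (g y : ℂ) = ∫ t, G t * Complex.exp ((2 * π * t * y : ℝ) * Complex.I))
    (ξ : ℝ) {s δ : ℝ} (hs : 0 < s) (hδ : 0 < δ) (m : Fin n → ℤ) :
    weightFourier a g ξ s δ m = ∫ θ, amplitude a G ξ s δ θ *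
      Complex.exp ((-(2 * π * (∑ l, coprod a l * m l ^ 2 : ℤ) *
        (θ / ((∏ i, a i : ℤ) * (s ^ 2 + 4 * θ ^ 2)))) : ℝ) * Complex.I) *
      (Real.exp (-(π * s * ∑ j, (m j : ℝ) ^ 2 / |(a j : ℝ)|) * (s ^ 2 + 4 * θ ^ 2)⁻¹) : ℝ) := by
  set φ : ℝ → ℂ := fun θ =>
    δ * G (δ * θ) * Complex.exp ((-(2 * π * θ * ξ) : ℝ) * Complex.I) with hφ
  set E : (Fin n → ℝ) → ℝ → ℂ := fun x θ => (Real.exp (-(π * s * diagMajorant a x)) : ℝ) *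
      Complex.exp ((2 * π * θ * diagForm a x : ℝ) * Complex.I) *
      Complex.exp ((-(2 * π * ∑ j, m j * x j) : ℝ) * Complex.I) with hE
  have hx : ∀ x : Fin n → ℝ, (smoothWeight a g ξ s δ x : ℂ) *
      Complex.exp ((-(2 * π * ∑ j, m j * x j) : ℝ) * Complex.I) = ∫ θ, φ θ * E x θ := by
    intro x
    have h1 : (g ((diagForm a x - ξ) / δ) : ℂ) = ∫ θ, φ θ *
        Complex.exp ((2 * π * θ * diagForm a x : ℝ) * Complex.I) := by
      rw [hg]
      have h2 := Measure.integral_comp_mul_left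
        (fun t => G t * Complex.exp ((2 * π * t * ((diagForm a x - ξ) / δ) : ℝ) * Complex.I)) δ
      rw [abs_of_pos (inv_pos.2 hδ)] at h2
      have h3 : ∫ t, G t * Complex.exp ((2 * π * t * ((diagForm a x - ξ) / δ) : ℝ) * Complex.I) =
          (δ : ℂ) * ∫ θ, G (δ * θ) *
            Complex.exp ((2 * π * (δ * θ) * ((diagForm a x - ξ) / δ) : ℝ) * Complex.I) := by
        rw [h2, Complex.real_smul, ← mul_assoc, ← Complex.ofReal_mul, mul_inv_cancel₀ hδ.ne',
          Complex.ofReal_one, one_mul]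
      rw [h3, ← integral_const_mul]
      refine integral_congr_ae (ae_of_all _ fun θ => ?_)
      simp only [hφ]
      rw [mul_assoc (δ * G (δ * θ)), ← Complex.exp_add, ← add_mul, ← Complex.ofReal_add,
        ← mul_assoc]
      congr 4
      field_simp
      ring
    rw [smoothWeight, Complex.ofReal_mul, h1, mul_comm ((Real.exp _ : ℝ) : ℂ), mul_assoc,
      ← integral_mul_const]
    refine integral_congr_ae (ae_of_all _ fun θ => ?_)
    simp only [hE]
    ring
  have hφi : Integrable φ := by
    have h1 : Integrable fun θ => δ * G (δ * θ) :=
      ((integrable_comp_mul_left_iff G hδ.ne').2 hGi).const_mul _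
    refine h1.mono ?_ (ae_of_all _ fun θ => ?_)
    · exact Continuous.aestronglyMeasurable (by rw [hφ]; fun_prop)
    · simp only [hφ]
      rw [norm_mul _ (Complex.exp _), Complex.norm_exp_ofReal_mul_I, mul_one]
  have hint : Integrable (Function.uncurry fun x θ => φ θ * E x θ)
      ((volume : Measure (Fin n → ℝ)).prod volume) := by
    have h1 := ((integrable_exp_neg_diagMajorant ha hs).ofReal (𝕜 := ℂ)).mul_prod hφi
    refine h1.mono ?_ (ae_of_all _ fun z => ?_)
    · refine Continuous.aestronglyMeasurable ?_
      unfold Function.uncurry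
      simp only [hφ, hE, diagMajorant, diagForm]
      fun_prop
    · simp only [Function.uncurry, hE]
      simp only [norm_mul, Complex.norm_exp_ofReal_mul_I, mul_one]
      exact (mul_comm _ _).le
  rw [weightFourier]
  simp only [hx]
  rw [integral_integral_swap hint]
  refine integral_congr_ae (ae_of_all _ fun θ => ?_)
  dsimp only
  rw [integral_const_mul]
  have h4 := integral_gauss_eq ha hs θ m
  simp only [exp_gaussParam_eq] at h4
  rw [h4, hφ, amplitude]
  ring

theorem ENNReal.tsum_pi_prod_eq_pow {ι : Type*} (f : ι → ℝ≥0∞) (n : ℕ) :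
    ∑' m : Fin n → ι, ∏ i, f (m i) = (∑' k, f k) ^ n := by
  induction n with
  | zero => simp
  | succ n ih =>
    rw [← (Fin.consEquiv fun _ => ι).tsum_eq, ENNReal.tsum_prod', pow_succ, mul_comm, ← ih,
      ← ENNReal.tsum_mul_right]
    refine tsum_congr fun k => ?_
    rw [← ENNReal.tsum_mul_left]
    refine tsum_congr fun m => ?_
    simp [Fin.prod_univ_succ, Fin.consEquiv]

theorem tsum_inv_one_add_sq_ne_top :
    ∑' k : ℤ, ENNReal.ofReal ((1 + (k : ℝ) ^ 2)⁻¹) ≠ ⊤ := by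
  have h : Summable fun k : ℤ => (1 + (k : ℝ) ^ 2)⁻¹ := by
    have h1 : Summable fun k : ℤ => 2 * (1 + |(k : ℝ)|) ^ (-(2 : ℝ)) :=
      (summable_int_one_add_abs_rpow (by norm_num)).mul_left 2
    refine Summable.of_nonneg_of_le (fun k => by positivity) (fun k => ?_) h1
    rw [Real.rpow_neg (by positivity), Real.rpow_two, ← div_eq_mul_inv, inv_eq_one_div,
      div_le_div_iff₀ (by positivity) (by positivity)]
    have := sq_abs (k : ℝ)
    nlinarith [sq_nonneg (1 - |(k : ℝ)|)]
  exact h.tsum_ofReal_ne_top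

theorem exists_tsum_exp_neg_le (n : ℕ) {c : ℝ} (hc : 0 < c) :
    ∃ C : ℝ≥0∞, C ≠ ⊤ ∧ ∀ (h : (Fin n → ℤ) → ℝ), (∀ m, c * ‖m‖ ^ 2 ≤ h m) → ∀ s : ℝ, 0 < s →
      ∑' m : Fin n → ℤ, (if m ≠ 0 then ENNReal.ofReal (Real.exp (-(h m / s))) else 0) ≤
        C * ENNReal.ofReal (s ^ n) := by
  rcases n.eq_zero_or_pos with rfl | hn
  · refine ⟨0, by simp, fun h _ s _ => le_of_eq ?_⟩
    rw [ENNReal.tsum_eq_zero.2 fun m => if_neg (not_not.2 (Subsingleton.elim m 0)), zero_mul]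
  obtain ⟨C, hC, hCle⟩ := exists_exp_neg_le_rpow (r := n) (by exact_mod_cast hn)
  refine ⟨ENNReal.ofReal (C * (2 / c) ^ n) *
    (∑' k : ℤ, ENNReal.ofReal ((1 + (k : ℝ) ^ 2)⁻¹)) ^ n,
    ENNReal.mul_ne_top ENNReal.ofReal_ne_top (ENNReal.pow_ne_top tsum_inv_one_add_sq_ne_top),
    fun h hh s hs => ?_⟩
  rw [← ENNReal.tsum_pi_prod_eq_pow, mul_right_comm, ← ENNReal.ofReal_mul (by positivity),
    ← ENNReal.tsum_mul_left]
  refine ENNReal.tsum_le_tsum fun m => ?_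
  split_ifs with hm
  swap
  · exact zero_le
  rw [← ENNReal.ofReal_prod_of_nonneg fun i _ => by positivity,
    ← ENNReal.ofReal_mul (by positivity)]
  refine ENNReal.ofReal_le_ofReal ?_
  have hm1 : 1 ≤ ‖m‖ := by
    obtain ⟨i, hi⟩ := Function.ne_iff.1 hm
    have h1 : (1 : ℝ) ≤ ‖m i‖ := by
      rw [Int.norm_eq_abs]; exact_mod_cast Int.one_le_abs hi
    exact h1.trans (norm_le_pi_norm m i)
  have hy : 0 < c * ‖m‖ ^ 2 / s := by positivity
  calc Real.exp (-(h m / s)) ≤ Real.exp (-(c * ‖m‖ ^ 2 / s)) := by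
        gcongr; exact hh m
    _ ≤ C * (c * ‖m‖ ^ 2 / s) ^ (-(n : ℝ)) := hCle _ hy
    _ = C * ((2 / c) ^ n * s ^ n * ∏ _i : Fin n, (2 * ‖m‖ ^ 2)⁻¹) := by
        rw [Real.rpow_neg hy.le, Real.rpow_natCast, Finset.prod_const, Finset.card_univ,
          Fintype.card_fin, ← inv_pow, ← mul_pow, ← mul_pow]
        congr 2
        field_simp
    _ ≤ C * ((2 / c) ^ n * s ^ n * ∏ i : Fin n, (1 + (m i : ℝ) ^ 2)⁻¹) := by
        gcongr with i
        have h2 : (m i : ℝ) ^ 2 ≤ ‖m‖ ^ 2 := by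
          rw [← sq_abs]
          have := norm_le_pi_norm m i
          rw [Int.norm_eq_abs] at this
          gcongr
        nlinarith
    _ = _ := by ring

theorem enorm_add_add_sq_le (x y z : ℂ) :
    ‖x + y + z‖ₑ ^ 2 ≤ 3 * (‖x‖ₑ ^ 2 + ‖y‖ₑ ^ 2 + ‖z‖ₑ ^ 2) := by
  simp only [← ofReal_norm, ← ENNReal.ofReal_pow (norm_nonneg _)]
  rw [show (3 : ℝ≥0∞) = ENNReal.ofReal 3 by norm_num,
    ← ENNReal.ofReal_add (by positivity) (by positivity),
    ← ENNReal.ofReal_add (by positivity) (by positivity), ← ENNReal.ofReal_mul (by norm_num)]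
  refine ENNReal.ofReal_le_ofReal ?_
  calc ‖x + y + z‖ ^ 2 ≤ (‖x‖ + ‖y‖ + ‖z‖) ^ 2 := by
        gcongr; exact norm_add₃_le
    _ ≤ _ := by
        nlinarith [sq_nonneg (‖x‖ - ‖y‖), sq_nonneg (‖x‖ - ‖z‖), sq_nonneg (‖y‖ - ‖z‖)]

theorem integrable_amplitude {n : ℕ} {a : Fin n → ℤ} (ha : ∀ j, a j ≠ 0) {G : ℝ → ℂ}
    (hG : Continuous G) {K : ℝ} (hK : ∀ t, ‖G t‖ ≤ K / (1 + t ^ 2)) (ξ : ℝ) {s δ : ℝ}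
    (hs : 0 < s) (hδ : 0 < δ) : Integrable (amplitude a G ξ s δ) := by
  have hK0 : 0 ≤ K := by simpa using (norm_nonneg _).trans (hK 0)
  have h1 : Integrable fun θ : ℝ => (1 + (δ * θ) ^ 2)⁻¹ :=
    (integrable_comp_mul_left_iff (fun t : ℝ => (1 + t ^ 2)⁻¹) hδ.ne').2 integrable_inv_one_add_sq
  refine Integrable.mono' (h1.const_mul (K * δ * (s ^ 2) ^ (-(n : ℝ) / 4)))
    (measurable_amplitude a hG ξ s δ).aestronglyMeasurable (ae_of_all _ fun θ => ?_)
  refine (norm_amplitude_le ha hK ξ hs hδ θ).trans ?_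
  have h2 : (s ^ 2 + 4 * θ ^ 2) ^ (-(n : ℝ) / 4) ≤ (s ^ 2) ^ (-(n : ℝ) / 4) :=
    Real.rpow_le_rpow_of_nonpos (by positivity) (by nlinarith [sq_nonneg θ])
      (by rw [neg_div]; exact neg_nonpos.2 (by positivity))
  calc _ ≤ K * (δ / (1 + (δ * θ) ^ 2) * (s ^ 2) ^ (-(n : ℝ) / 4)) := by gcongr
    _ = _ := by ring

/-- The integrand in the frequency representation of the Fourier coefficients. -/
noncomputable def freqIntegrand {n : ℕ} (a : Fin n → ℤ) (G : ℝ → ℂ) (ξ s δ : ℝ) (m : Fin n → ℤ)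
    (θ : ℝ) : ℂ :=
  amplitude a G ξ s δ θ *
    Complex.exp ((-(2 * π * (∑ l, coprod a l * m l ^ 2 : ℤ) *
      (θ / ((∏ i, a i : ℤ) * (s ^ 2 + 4 * θ ^ 2)))) : ℝ) * Complex.I) *
    (Real.exp (-(π * s * ∑ j, (m j : ℝ) ^ 2 / |(a j : ℝ)|) * (s ^ 2 + 4 * θ ^ 2)⁻¹) : ℝ)

theorem norm_freqIntegrand {n : ℕ} (a : Fin n → ℤ) (G : ℝ → ℂ) (ξ s δ : ℝ) (m : Fin n → ℤ)
    (θ : ℝ) : ‖freqIntegrand a G ξ s δ m θ‖ = ‖amplitude a G ξ s δ θ‖ *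
      Real.exp (-(π * s * ∑ j, (m j : ℝ) ^ 2 / |(a j : ℝ)|) * (s ^ 2 + 4 * θ ^ 2)⁻¹) := by
  rw [freqIntegrand, norm_mul, norm_mul, Complex.norm_exp_ofReal_mul_I, mul_one,
    Complex.norm_real, Real.norm_of_nonneg (Real.exp_nonneg _)]

theorem integrable_freqIntegrand {n : ℕ} {a : Fin n → ℤ} (ha : ∀ j, a j ≠ 0) {G : ℝ → ℂ}
    (hG : Continuous G) {K : ℝ} (hK : ∀ t, ‖G t‖ ≤ K / (1 + t ^ 2)) (ξ : ℝ) {s δ : ℝ}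
    (hs : 0 < s) (hδ : 0 < δ) (m : Fin n → ℤ) : Integrable (freqIntegrand a G ξ s δ m) := by
  refine (integrable_amplitude ha hG hK ξ hs hδ).mono ?_ (ae_of_all _ fun θ => ?_)
  · have := measurable_amplitude a hG ξ s δ
    refine Measurable.aestronglyMeasurable ?_
    unfold freqIntegrand
    fun_prop
  · rw [norm_freqIntegrand]
    refine mul_le_of_le_one_right (norm_nonneg _) (Real.exp_le_one_iff.2 ?_)
    rw [neg_mul]
    exact neg_nonpos.2 (by positivity)

theorem norm_integral_freqIntegrand_small_le {n : ℕ} {a : Fin n → ℤ} (ha : ∀ j, a j ≠ 0)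
    {G : ℝ → ℂ} {K : ℝ} (hK : ∀ t, ‖G t‖ ≤ K / (1 + t ^ 2)) (ξ : ℝ) {s δ : ℝ}
    (hs : 0 < s) (hδ : 0 < δ) (m : Fin n → ℤ) :
    ‖∫ θ in Set.Ioc (-s) s, freqIntegrand a G ξ s δ m θ‖ ^ 2 ≤ 4 * K ^ 2 * δ ^ 2 * s ^ 2 *
      (s ^ n)⁻¹ * Real.exp (-(2 * π / 5 * ∑ j, (m j : ℝ) ^ 2 / |(a j : ℝ)|) / s) := by
  have hK0 : 0 ≤ K := by simpa using (norm_nonneg _).trans (hK 0)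
  set h := ∑ j, (m j : ℝ) ^ 2 / |(a j : ℝ)| with hh
  have hh0 : 0 ≤ h := by positivity
  have hb : ∀ θ ∈ Set.Ioc (-s) s, ‖freqIntegrand a G ξ s δ m θ‖ ≤
      K * δ * (s ^ 2) ^ (-(n : ℝ) / 4) * Real.exp (-(π / 5 * h) / s) := by
    intro θ hθ
    have hθ2 : θ ^ 2 ≤ s ^ 2 := sq_le_sq' hθ.1.le hθ.2
    rw [norm_freqIntegrand, ← hh]
    have h1 : (s ^ 2 + 4 * θ ^ 2) ^ (-(n : ℝ) / 4) ≤ (s ^ 2) ^ (-(n : ℝ) / 4) :=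
      Real.rpow_le_rpow_of_nonpos (by positivity) (by nlinarith [sq_nonneg θ])
        (by rw [neg_div]; exact neg_nonpos.2 (by positivity))
    have h2 : δ / (1 + (δ * θ) ^ 2) ≤ δ :=
      div_le_self hδ.le (by nlinarith [sq_nonneg (δ * θ)])
    have h3 : -(π * s * h) * (s ^ 2 + 4 * θ ^ 2)⁻¹ ≤ -(π / 5 * h) / s := by
      rw [neg_mul, neg_div, neg_le_neg_iff]
      calc _ = π * s * h * (5 * s ^ 2)⁻¹ := by field_simp
        _ ≤ _ := by gcongr; linarith
    calc _ ≤ K * (δ / (1 + (δ * θ) ^ 2) * (s ^ 2 + 4 * θ ^ 2) ^ (-(n : ℝ) / 4)) *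
          Real.exp (-(π / 5 * h) / s) := by
          gcongr
          exact norm_amplitude_le ha hK ξ hs hδ θ
      _ ≤ K * (δ * (s ^ 2) ^ (-(n : ℝ) / 4)) * Real.exp (-(π / 5 * h) / s) := by gcongr
      _ = _ := by ring
  have h4 := norm_setIntegral_le_of_norm_le_const (μ := volume) (by simp) hb
  rw [Real.volume_real_Ioc_of_le (by linarith)] at h4
  calc _ ≤ (K * δ * (s ^ 2) ^ (-(n : ℝ) / 4) * Real.exp (-(π / 5 * h) / s) * (s - -s)) ^ 2 := by
        gcongr
    _ = 4 * K ^ 2 * δ ^ 2 * s ^ 2 * ((s ^ 2) ^ (-(n : ℝ) / 4)) ^ 2 *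
        Real.exp (-(π / 5 * h) / s) ^ 2 := by ring
    _ = _ := by
        congr 1
        · congr 1
          rw [← Real.rpow_natCast s 2, ← Real.rpow_mul hs.le, ← Real.rpow_natCast (_ ^ _) 2,
            ← Real.rpow_mul hs.le, ← Real.rpow_natCast s n, ← Real.rpow_neg hs.le]
          congr 1; push_cast; ring
        · rw [← Real.exp_nat_mul]
          congr 1; push_cast; ring

theorem exists_lt_abs_sq_norm_le {n : ℕ} {a : Fin n → ℤ} (ha : ∀ j, a j ≠ 0) :
    ∃ c : ℝ, 0 < c ∧ ∀ m : Fin n → ℤ, c * ‖m‖ ^ 2 ≤ ∑ j, (m j : ℝ) ^ 2 / |(a j : ℝ)| := by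
  have hpos : ∀ j, 0 < |(a j : ℝ)| := fun j => abs_pos.2 (by exact_mod_cast ha j)
  have hA : 0 < 1 + ∑ j, |(a j : ℝ)| := by
    have : 0 ≤ ∑ j, |(a j : ℝ)| := by positivity
    linarith
  refine ⟨(1 + ∑ j, |(a j : ℝ)|)⁻¹, inv_pos.2 hA, fun m => ?_⟩
  have h0 : ∀ S : ℝ, 0 ≤ S → (∀ j, (m j : ℝ) ^ 2 ≤ S) → ‖m‖ ^ 2 ≤ S := by
    intro S hS h
    have : ‖m‖ ≤ Real.sqrt S := (pi_norm_le_iff_of_nonneg (Real.sqrt_nonneg _)).2 fun j => by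
      rw [Int.norm_eq_abs]; exact Real.abs_le_sqrt (h j)
    calc ‖m‖ ^ 2 ≤ Real.sqrt S ^ 2 := by gcongr
      _ = S := Real.sq_sqrt hS
  rw [inv_mul_le_iff₀ hA]
  refine h0 _ (by positivity) fun j => ?_
  have h1 : (m j : ℝ) ^ 2 / |(a j : ℝ)| ≤ ∑ j, (m j : ℝ) ^ 2 / |(a j : ℝ)| :=
    Finset.single_le_sum (f := fun j => (m j : ℝ) ^ 2 / |(a j : ℝ)|)
      (fun i _ => by positivity) (Finset.mem_univ j)
  have h2 : |(a j : ℝ)| ≤ 1 + ∑ j, |(a j : ℝ)| := by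
    have := Finset.single_le_sum (f := fun j => |(a j : ℝ)|) (fun i _ => by positivity)
      (Finset.mem_univ j)
    linarith
  calc (m j : ℝ) ^ 2 = |(a j : ℝ)| * ((m j : ℝ) ^ 2 / |(a j : ℝ)|) := by
        have := (hpos j).ne'
        field_simp
    _ ≤ _ := by gcongr

theorem exists_ne_mul_pos {n : ℕ} (hn : 3 ≤ n) {a : Fin n → ℤ} (ha : ∀ j, a j ≠ 0) :
    ∃ i j : Fin n, i ≠ j ∧ 0 < a i * a j := by
  let f : Fin 3 → Fin n := Fin.castLE hn
  have hf : Function.Injective f := Fin.castLE_injective hn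
  have h01 : f 0 ≠ f 1 := hf.ne (by decide)
  have h02 : f 0 ≠ f 2 := hf.ne (by decide)
  have h12 : f 1 ≠ f 2 := hf.ne (by decide)
  rcases (ha (f 0)).lt_or_gt with h0 | h0 <;> rcases (ha (f 1)).lt_or_gt with h1 | h1 <;>
    rcases (ha (f 2)).lt_or_gt with h2 | h2
  · exact ⟨_, _, h01, mul_pos_of_neg_of_neg h0 h1⟩
  · exact ⟨_, _, h01, mul_pos_of_neg_of_neg h0 h1⟩
  · exact ⟨_, _, h02, mul_pos_of_neg_of_neg h0 h2⟩
  · exact ⟨_, _, h12, mul_pos h1 h2⟩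
  · exact ⟨_, _, h12, mul_pos_of_neg_of_neg h1 h2⟩
  · exact ⟨_, _, h02, mul_pos h0 h2⟩
  · exact ⟨_, _, h01, mul_pos h0 h1⟩
  · exact ⟨_, _, h01, mul_pos h0 h1⟩

theorem coprod_mul_pos {n : ℕ} {a : Fin n → ℤ} (ha : ∀ j, a j ≠ 0) {i j : Fin n}
    (h : 0 < a i * a j) : 0 < coprod a i * coprod a j := by
  have h1 : (a i * a j) * (coprod a i * coprod a j) = (∏ l, a l) ^ 2 := by
    rw [sq]; nth_rewrite 1 [← mul_coprod a i]; rw [← mul_coprod a j]; ring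
  have h2 : 0 < (∏ l, a l) ^ 2 :=
    sq_pos_of_ne_zero (Finset.prod_ne_zero_iff.2 fun i _ => ha i)
  exact (mul_pos_iff_of_pos_left h).1 (h1 ▸ h2)

theorem lintegral_amplitude_sq_le {n : ℕ} {a : Fin n → ℤ} (ha : ∀ j, a j ≠ 0) {G : ℝ → ℂ} {K : ℝ}
    (hK : ∀ t, ‖G t‖ ≤ K / (1 + t ^ 2)) (ξ : ℝ) {s δ : ℝ} (hs : 0 < s) (hδ : 0 < δ)
    {σ : ℝ} (hσ : σ = 1 ∨ σ = -1) (w : ℝ → ℝ) :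
    ∫⁻ θ in Set.Ioi s, ‖amplitude a G ξ s δ (σ * θ)‖ₑ ^ 2 * ENNReal.ofReal (w θ) ≤
      ENNReal.ofReal (K ^ 2) * ∫⁻ θ in Set.Ioi s, ENNReal.ofReal ((δ / (1 + (δ * θ) ^ 2) *
        (s ^ 2 + 4 * θ ^ 2) ^ (-(n : ℝ) / 4)) ^ 2) * ENNReal.ofReal (w θ) := by
  rw [← lintegral_const_mul' _ _ ENNReal.ofReal_ne_top]
  refine lintegral_mono fun θ => ?_
  rw [← mul_assoc]
  refine mul_le_mul_left ?_ _
  rw [← ENNReal.ofReal_mul (by positivity), ← ofReal_norm, ← ENNReal.ofReal_pow (norm_nonneg _),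
    ← mul_pow]
  refine ENNReal.ofReal_le_ofReal (pow_le_pow_left₀ (norm_nonneg _) ?_ 2)
  have h1 : (σ * θ) ^ 2 = θ ^ 2 := by rcases hσ with rfl | rfl <;> ring
  have h2 : (δ * (σ * θ)) ^ 2 = (δ * θ) ^ 2 := by rw [mul_pow, h1, mul_pow]
  simpa only [h1, h2] using norm_amplitude_le ha hK ξ hs hδ (σ * θ)

/-- The variance bound for the smoothed counting function. -/
theorem exists_tsum_weightFourier_le {n : ℕ} (hn : 3 ≤ n) {a : Fin n → ℤ} (ha : ∀ j, a j ≠ 0)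
    {G : ℝ → ℂ} (hG : Continuous G) {K : ℝ} (hK : ∀ t, ‖G t‖ ≤ K / (1 + t ^ 2)) {g : ℝ → ℝ}
    (hg : ∀ y, (g y : ℂ) = ∫ t, G t * Complex.exp ((2 * π * t * y : ℝ) * Complex.I)) (ξ : ℝ)
    {ε : ℝ} (hε : 0 < ε) (hε1 : ε < 1) :
    ∃ C : ℝ≥0∞, C ≠ ⊤ ∧ ∀ s δ : ℝ, 0 < s → s ≤ 1 → 0 < δ → δ ≤ 1 →
      ∑' m : Fin n → ℤ, (if m ≠ 0 then ‖weightFourier a g ξ s δ m‖ₑ ^ 2 else 0) ≤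
        C * ENNReal.ofReal (δ ^ (1 - ε) * s ^ (-(((n : ℝ) - 2 + ε) / 2))) := by
  obtain ⟨i, j, hij, haij⟩ := exists_ne_mul_pos hn ha
  have hA := coprod_mul_pos ha haij
  obtain ⟨c₀, hc₀, hh⟩ := exists_lt_abs_sq_norm_le ha
  have hprod : (1 : ℝ) ≤ |((∏ i, a i : ℤ) : ℝ)| := by
    exact_mod_cast Int.one_le_abs (Finset.prod_ne_zero_iff.2 fun i _ => ha i)
  have hr : 1 < 1 + ε / 2 := by linarith
  obtain ⟨C₁, hC₁, H₁⟩ := exists_tsum_halfline_le hn (coprod a) hij hA hε hr hprod hc₀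
  obtain ⟨C₂, hC₂, H₂⟩ := exists_tsum_halfline_le hn (coprod a) hij hA hε hr
    (a := -((∏ i, a i : ℤ) : ℝ)) (by rwa [abs_neg]) hc₀
  obtain ⟨C₃, hC₃, H₃⟩ := exists_lintegral_weight_le n hε hε1
  obtain ⟨C₄, hC₄, H₄⟩ := exists_tsum_exp_neg_le n (c := 2 * π / 5 * c₀) (by positivity)
  have hGi : Integrable G := Integrable.mono' (integrable_inv_one_add_sq.const_mul K)
    hG.aestronglyMeasurable (ae_of_all _ fun t => by simpa [div_eq_mul_inv] using hK t)
  refine ⟨3 * (C₂ * ENNReal.ofReal (K ^ 2) * ENNReal.ofReal C₃ +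
    ENNReal.ofReal (4 * K ^ 2) * C₄ + C₁ * ENNReal.ofReal (K ^ 2) * ENNReal.ofReal C₃),
    by finiteness, fun s δ hs hs1 hδ hδ1 => ?_⟩
  set h : (Fin n → ℤ) → ℝ := fun m => ∑ j, (m j : ℝ) ^ 2 / |(a j : ℝ)| with hhdef
  set b : ℝ := ((n : ℝ) - 2 + ε) / 2 with hb
  have hn' : (3 : ℝ) ≤ n := by exact_mod_cast hn
  have hb0 : 0 ≤ b := by rw [hb]; linarith
  set I := fun m θ => freqIntegrand a G ξ s δ m θ with hI
  set Em := fun m => ‖∫ θ in Set.Iic (-s), I m θ‖ₑ ^ 2 with hEm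
  set E0 := fun m => ‖∫ θ in Set.Ioc (-s) s, I m θ‖ₑ ^ 2 with hE0
  set Ep := fun m => ‖∫ θ in Set.Ioi s, I m θ‖ₑ ^ 2 with hEp
  have hsplit : ∀ m, ‖weightFourier a g ξ s δ m‖ₑ ^ 2 ≤ 3 * (Em m + E0 m + Ep m) := by
    intro m
    have hint := integrable_freqIntegrand ha hG hK ξ hs hδ m
    have e1 : weightFourier a g ξ s δ m = (∫ θ in Set.Iic (-s), I m θ) +
        (∫ θ in Set.Ioc (-s) s, I m θ) + ∫ θ in Set.Ioi s, I m θ := by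
      rw [weightFourier_eq ha hG hGi hg ξ hs hδ m,
        ← setIntegral_union (Set.Iic_disjoint_Ioc le_rfl) measurableSet_Ioc hint.integrableOn
          hint.integrableOn, Set.Iic_union_Ioc_eq_Iic (by linarith),
        intervalIntegral.integral_Iic_add_Ioi hint.integrableOn hint.integrableOn]
      rfl
    rw [e1]
    exact enorm_add_add_sq_le _ _ _
  have hVi := integrable_amplitude ha hG hK ξ hs hδ
  have hVm := measurable_amplitude a hG ξ s δ
  set X := ENNReal.ofReal (δ ^ (1 - ε) * s ^ (-b)) with hX
  have hfin : ∀ C : ℝ≥0∞, ∀ σ : ℝ, σ = 1 ∨ σ = -1 → C * ENNReal.ofReal (s ^ (-b)) *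
      ∫⁻ θ in Set.Ioi s, ‖amplitude a G ξ s δ (σ * θ)‖ₑ ^ 2 *
        ENNReal.ofReal ((s ^ 2 + 4 * θ ^ 2) ^ (b + 1) * (1 + θ⁻¹) ^ (1 + ε / 2)) ≤
      C * ENNReal.ofReal (K ^ 2) * ENNReal.ofReal C₃ * X := by
    intro C σ hσ
    calc _ ≤ C * ENNReal.ofReal (s ^ (-b)) * (ENNReal.ofReal (K ^ 2) *
          ENNReal.ofReal (C₃ * δ ^ (1 - ε))) := by
          gcongr
          exact (lintegral_amplitude_sq_le ha hK ξ hs hδ hσ _).trans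
            (mul_le_mul_right (H₃ s δ hs hδ hδ1) _)
      _ = _ := by
          rw [hX, ENNReal.ofReal_mul hC₃, ENNReal.ofReal_mul (by positivity)]
          ring
  have hp : ∑' m, (if m ≠ 0 then Ep m else 0) ≤
      C₁ * ENNReal.ofReal (K ^ 2) * ENNReal.ofReal C₃ * X := by
    have := (H₁ h hh s _ hs hVm hVi.integrableOn).trans
      (by simpa only [one_mul] using hfin C₁ 1 (Or.inl rfl))
    exact this
  have hm : ∑' m, (if m ≠ 0 then Em m else 0) ≤
      C₂ * ENNReal.ofReal (K ^ 2) * ENNReal.ofReal C₃ * X := by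
    have hVi' : Integrable fun θ => amplitude a G ξ s δ (-1 * θ) := by
      simpa only [neg_one_mul] using hVi.comp_neg
    have h1 := (H₂ h hh s _ hs (hVm.comp (measurable_const_mul (-1))) hVi'.integrableOn).trans
      (hfin C₂ (-1) (Or.inr rfl))
    refine le_trans (le_of_eq (tsum_congr fun m => ?_)) h1
    congr 1
    rw [hEm]
    dsimp only
    rw [← integral_comp_neg_Ioi]
    congr 3
    funext θ
    rw [hI]
    simp only [freqIntegrand, Function.comp, neg_one_mul, neg_sq, hhdef]
    congr 6
    rw [neg_mul, neg_div, div_neg]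
  have h0 : ∑' m, (if m ≠ 0 then E0 m else 0) ≤ ENNReal.ofReal (4 * K ^ 2) * C₄ * X := by
    have h1 := H₄ (fun m => 2 * π / 5 * h m) (fun m => by
      rw [mul_assoc]; exact mul_le_mul_of_nonneg_left (hh m) (by positivity)) s hs
    calc _ ≤ ∑' m, ENNReal.ofReal (4 * K ^ 2) * ENNReal.ofReal (δ ^ 2 * s ^ 2 * (s ^ n)⁻¹) *
          (if m ≠ 0 then ENNReal.ofReal (Real.exp (-(2 * π / 5 * h m / s))) else 0) := by
          refine ENNReal.tsum_le_tsum fun m => ?_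
          split_ifs with hm
          · rw [← ENNReal.ofReal_mul (by positivity), ← ENNReal.ofReal_mul (by positivity), hE0]
            dsimp only
            rw [← ofReal_norm, ← ENNReal.ofReal_pow (norm_nonneg _)]
            refine ENNReal.ofReal_le_ofReal ?_
            refine (norm_integral_freqIntegrand_small_le ha hK ξ hs hδ m).trans (le_of_eq ?_)
            rw [neg_div]
            ring
          · exact zero_le
      _ ≤ ENNReal.ofReal (4 * K ^ 2) * ENNReal.ofReal (δ ^ 2 * s ^ 2 * (s ^ n)⁻¹) *
          (C₄ * ENNReal.ofReal (s ^ n)) := by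
          rw [ENNReal.tsum_mul_left]; gcongr
      _ = ENNReal.ofReal (4 * K ^ 2) * C₄ * ENNReal.ofReal (δ ^ 2 * s ^ 2) := by
          have e : ENNReal.ofReal (δ ^ 2 * s ^ 2) =
              ENNReal.ofReal (δ ^ 2 * s ^ 2 * (s ^ n)⁻¹) * ENNReal.ofReal (s ^ n) := by
            rw [← ENNReal.ofReal_mul (by positivity), inv_mul_cancel_right₀ (by positivity)]
          rw [e]
          ring
      _ ≤ _ := by
          refine mul_le_mul_right (ENNReal.ofReal_le_ofReal
            (mul_le_mul ?_ ?_ (by positivity) (by positivity))) _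
          · rw [← Real.rpow_two]
            exact Real.rpow_le_rpow_of_exponent_ge hδ hδ1 (by linarith)
          · exact (pow_le_one₀ hs.le hs1).trans
              (Real.one_le_rpow_of_pos_of_le_one_of_nonpos hs hs1 (by linarith))
  calc _ ≤ ∑' m, 3 * ((if m ≠ 0 then Em m else 0) + (if m ≠ 0 then E0 m else 0) +
        (if m ≠ 0 then Ep m else 0)) := by
        refine ENNReal.tsum_le_tsum fun m => ?_
        split_ifs with hm
        · exact hsplit m
        · exact zero_le
    _ ≤ 3 * (C₂ * ENNReal.ofReal (K ^ 2) * ENNReal.ofReal C₃ * X +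
        ENNReal.ofReal (4 * K ^ 2) * C₄ * X + C₁ * ENNReal.ofReal (K ^ 2) * ENNReal.ofReal C₃ * X)
        := by
        rw [ENNReal.tsum_mul_left, ENNReal.tsum_add, ENNReal.tsum_add]
        gcongr
    _ = _ := by ring

/-- The half-open unit box. -/
def unitBox (n : ℕ) : Set (Fin n → ℝ) := {x | ∀ i, x i ∈ Set.Ioc (0 : ℝ) 1}

theorem measurableSet_unitBox (n : ℕ) : MeasurableSet (unitBox n) :=
  MeasurableSet.univ_pi' fun _ => measurableSet_Ioc

theorem unitBox_eq_pi (n : ℕ) : unitBox n = Set.univ.pi fun _ => Set.Ioc (0 : ℝ) 1 := by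
  ext x; simp [unitBox]

theorem volume_unitBox (n : ℕ) : volume (unitBox n) = 1 := by
  rw [unitBox_eq_pi, volume_pi_pi]; simp

theorem unitBox_eq (n : ℕ) : unitBox n =
    {x : Fin n → ℝ | ∀ i, x i ∈ Set.Ioc ((0 : Fin n → ℝ) i) ((0 : Fin n → ℝ) i + 1)} := by
  simp [unitBox]

noncomputable section Parseval

local instance : MeasureSpace UnitAddCircle := ⟨AddCircle.haarAddCircle⟩

local instance : Measure.IsAddHaarMeasure (volume : Measure UnitAddCircle) :=
  inferInstanceAs (Measure.IsAddHaarMeasure AddCircle.haarAddCircle)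

local instance : IsProbabilityMeasure (volume : Measure UnitAddCircle) :=
  inferInstanceAs (IsProbabilityMeasure AddCircle.haarAddCircle)

theorem mFourier_neg_coe {n : ℕ} (m : Fin n → ℤ) (x : Fin n → ℝ) :
    UnitAddTorus.mFourier (-m) (fun i => (x i : UnitAddCircle)) =
      Complex.exp ((-(2 * π * ∑ j, m j * x j) : ℝ) * Complex.I) := by
  simp only [UnitAddTorus.mFourier, ContinuousMap.coe_mk, Pi.neg_apply, fourier_coe_apply]
  rw [← Complex.exp_sum]
  congr 1
  push_cast
  rw [Finset.mul_sum, ← Finset.sum_neg_distrib, Finset.sum_mul]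
  refine Finset.sum_congr rfl fun j _ => ?_
  simp
  ring

/-- Parseval's identity on the unit box. -/
theorem lintegral_unitBox_sq_eq {n : ℕ} {f : (Fin n → ℝ) → ℂ} (hf : Measurable f) {B : ℝ}
    (hB : ∀ x ∈ unitBox n, ‖f x‖ ≤ B) :
    ∫⁻ x in unitBox n, ‖f x‖ₑ ^ 2 = ∑' m : Fin n → ℤ, ‖∫ x in unitBox n,
      Complex.exp ((-(2 * π * ∑ j, m j * x j) : ℝ) * Complex.I) * f x‖ₑ ^ 2 := by
  set e := UnitAddTorus.measurableEquivPiIoc (0 : Fin n → ℝ) with he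
  set F : UnitAddTorus (Fin n) → ℂ := fun y => f (e y).1 with hF
  have hFm : Measurable F := hf.comp (measurable_subtype_coe.comp e.measurable)
  have hFB : ∀ y, ‖F y‖ ≤ B := fun y => hB _ (by rw [unitBox_eq]; exact (e y).2)
  have hFx : ∀ x ∈ unitBox n, F (fun i => (x i : UnitAddCircle)) = f x := fun x hx => by
    have h1 : e (fun i => (x i : UnitAddCircle)) = ⟨x, by rw [unitBox_eq] at hx; exact hx⟩ := by
      rw [← e.apply_symm_apply ⟨x, by rw [unitBox_eq] at hx; exact hx⟩]
      rfl
    rw [hF]; dsimp only; rw [h1]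
  have hLp : MemLp F 2 volume := MemLp.of_bound hFm.aestronglyMeasurable B (ae_of_all _ hFB)
  have hP := UnitAddTorus.hasSum_sq_mFourierCoeff hLp.toLp
  have hco : ∀ m, UnitAddTorus.mFourierCoeff hLp.toLp m = ∫ x in unitBox n,
      Complex.exp ((-(2 * π * ∑ j, m j * x j) : ℝ) * Complex.I) * f x := fun m => by
    have h1 : UnitAddTorus.mFourierCoeff hLp.toLp m = UnitAddTorus.mFourierCoeff F m :=
      integral_congr_ae (by
        filter_upwards [hLp.coeFn_toLp] with y hy
        rw [hy])
    rw [h1, UnitAddTorus.mFourierCoeff_eq_integral F m 0, ← unitBox_eq]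
    refine setIntegral_congr_fun (measurableSet_unitBox n) fun x hx => ?_
    rw [hFx x hx, mFourier_neg_coe, smul_eq_mul]
  have hI : ∫ t, ‖(hLp.toLp F) t‖ ^ 2 = ∫ t, ‖F t‖ ^ 2 := integral_congr_ae (by
    filter_upwards [hLp.coeFn_toLp] with y hy
    rw [hy])
  have hL : ∫⁻ x in unitBox n, ‖f x‖ₑ ^ 2 = ENNReal.ofReal (∫ t, ‖F t‖ ^ 2) := by
    rw [ofReal_integral_eq_lintegral_ofReal]
    · have h2 := UnitAddTorus.lintegral_preimage (fun t => ENNReal.ofReal (‖F t‖ ^ 2))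
        (0 : Fin n → ℝ)
      rw [← unitBox_eq] at h2
      refine Eq.trans ?_ h2.symm
      refine setLIntegral_congr_fun (measurableSet_unitBox n) fun x hx => ?_
      rw [hFx x hx, ENNReal.ofReal_pow (norm_nonneg _), ofReal_norm]
    · refine Integrable.of_bound (hFm.norm.pow_const 2).aestronglyMeasurable (B ^ 2)
        (ae_of_all _ fun y => ?_)
      rw [Real.norm_of_nonneg (by positivity)]
      exact pow_le_pow_left₀ (norm_nonneg _) (hFB y) 2
    · exact ae_of_all _ fun y => by positivity
  rw [hL, ← hI, ← hP.tsum_eq, ENNReal.ofReal_tsum_of_nonneg (fun m => by positivity) hP.summable]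
  refine tsum_congr fun m => ?_
  rw [ENNReal.ofReal_pow (norm_nonneg _), ofReal_norm, hco]

end Parseval

theorem iUnion_add_image_unitBox (n : ℕ) :
    (⋃ v : Fin n → ℤ, (fun x => (fun i => (v i : ℝ)) + x) '' unitBox n) = Set.univ := by
  refine Set.eq_univ_of_forall fun x => Set.mem_iUnion.2 ⟨fun i => ⌈x i⌉ - 1,
    fun i => x i - (⌈x i⌉ - 1), fun i => ⟨?_, ?_⟩, ?_⟩
  · have := Int.ceil_lt_add_one (x i); linarith
  · have := Int.le_ceil (x i); linarith
  · funext i; simp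

theorem pairwise_disjoint_add_image_unitBox (n : ℕ) : Pairwise (Function.onFun Disjoint
    fun v : Fin n → ℤ => (fun x => (fun i => (v i : ℝ)) + x) '' unitBox n) := by
  intro v w hvw
  refine Set.disjoint_left.2 ?_
  rintro _ ⟨x, hx, rfl⟩ ⟨y, hy, hxy⟩
  refine hvw (funext fun i => ?_)
  have h1 : (w i : ℝ) + y i = v i + x i := congrFun hxy i
  have hx1 := hx i
  have hy1 := hy i
  have h2 : (w i : ℝ) < v i + 1 := by linarith [hx1.2, hy1.1]
  have h3 : (v i : ℝ) < w i + 1 := by linarith [hx1.1, hy1.2]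
  have h2' : w i < v i + 1 := by exact_mod_cast h2
  have h3' : v i < w i + 1 := by exact_mod_cast h3
  omega

theorem measurableSet_add_image_unitBox {n : ℕ} (v : Fin n → ℤ) :
    MeasurableSet ((fun x => (fun i => (v i : ℝ)) + x) '' unitBox n) :=
  (MeasurableEquiv.addLeft _).measurableEmbedding.measurableSet_image.2 (measurableSet_unitBox n)

theorem lintegral_eq_tsum_unitBox {n : ℕ} (h : (Fin n → ℝ) → ℝ≥0∞) :
    ∫⁻ x, h x = ∑' v : Fin n → ℤ, ∫⁻ x in unitBox n, h ((fun i => (v i : ℝ)) + x) := by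
  rw [← setLIntegral_univ, ← iUnion_add_image_unitBox,
    lintegral_iUnion measurableSet_add_image_unitBox (pairwise_disjoint_add_image_unitBox n)]
  refine tsum_congr fun v => ?_
  exact (measurePreserving_add_left volume (fun i => (v i : ℝ))).setLIntegral_comp_emb
    (MeasurableEquiv.addLeft _).measurableEmbedding h (unitBox n) |>.symm

theorem integral_eq_tsum_unitBox {n : ℕ} {h : (Fin n → ℝ) → ℂ} (hi : Integrable h) :
    ∫ x, h x = ∫ x in unitBox n, ∑' v : Fin n → ℤ, h ((fun i => (v i : ℝ)) + x) := by
  have hsh : ∀ v : Fin n → ℤ, AEStronglyMeasurable (fun x => h ((fun i => (v i : ℝ)) + x))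
      (volume.restrict (unitBox n)) := fun v =>
    (hi.1.comp_measurePreserving (measurePreserving_add_left volume (fun i => (v i : ℝ)))).restrict
  rw [integral_tsum hsh]
  · rw [← setIntegral_univ, ← iUnion_add_image_unitBox,
      integral_iUnion measurableSet_add_image_unitBox (pairwise_disjoint_add_image_unitBox n)
        hi.integrableOn]
    refine tsum_congr fun v => ?_
    exact (measurePreserving_add_left volume (fun i => (v i : ℝ))).setIntegral_image_emb
      (MeasurableEquiv.addLeft _).measurableEmbedding h (unitBox n)
  · rw [← lintegral_eq_tsum_unitBox (fun x => ‖h x‖ₑ)]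
    exact hi.2.ne

theorem exp_neg_inner_int_add {n : ℕ} (m v : Fin n → ℤ) (x : Fin n → ℝ) :
    Complex.exp ((-(2 * π * ∑ j, m j * ((fun i => (v i : ℝ)) + x) j) : ℝ) * Complex.I) =
      Complex.exp ((-(2 * π * ∑ j, m j * x j) : ℝ) * Complex.I) := by
  refine Complex.exp_eq_exp_iff_exists_int.2 ⟨-∑ j, m j * v j, ?_⟩
  simp only [Pi.add_apply, mul_add, Finset.sum_add_distrib]
  push_cast
  ring

theorem integral_unitBox_exp_mul_eq {n : ℕ} {h N : (Fin n → ℝ) → ℝ} (hi : Integrable h)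
    (hN : ∀ x ∈ unitBox n, HasSum (fun v : Fin n → ℤ => h ((fun i => (v i : ℝ)) + x)) (N x))
    (m : Fin n → ℤ) :
    ∫ x in unitBox n, Complex.exp ((-(2 * π * ∑ j, m j * x j) : ℝ) * Complex.I) * (N x : ℂ) =
      ∫ x, (h x : ℂ) * Complex.exp ((-(2 * π * ∑ j, m j * x j) : ℝ) * Complex.I) := by
  have hint : Integrable fun x : Fin n → ℝ =>
      (h x : ℂ) * Complex.exp ((-(2 * π * ∑ j, m j * x j) : ℝ) * Complex.I) := by
    refine hi.ofReal.mul_bdd (c := 1) ?_ (ae_of_all _ fun x => ?_)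
    · exact (Continuous.aestronglyMeasurable (by fun_prop))
    · rw [Complex.norm_exp_ofReal_mul_I]
  rw [integral_eq_tsum_unitBox hint]
  refine setIntegral_congr_fun (measurableSet_unitBox n) fun x hx => ?_
  simp only [exp_neg_inner_int_add]
  rw [tsum_mul_right, mul_comm, ← (hN x hx).tsum_eq, Complex.ofReal_tsum]

theorem lintegral_sub_integral_sq_eq {Ω : Type*} [MeasurableSpace Ω] {μ : Measure Ω}
    [IsProbabilityMeasure μ] {N : Ω → ℝ} (hNm : Measurable N) {B : ℝ} (hB : ∀ᵐ x ∂μ, |N x| ≤ B) :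
    ∫⁻ x, ENNReal.ofReal ((N x - ∫ y, N y ∂μ) ^ 2) ∂μ =
      ∫⁻ x, ‖(N x : ℂ)‖ₑ ^ 2 ∂μ - ENNReal.ofReal ((∫ y, N y ∂μ) ^ 2) := by
  have hNi : Integrable N μ := Integrable.of_bound hNm.aestronglyMeasurable B hB
  have hNi2 : Integrable (fun x => N x ^ 2) μ :=
    Integrable.of_bound (hNm.pow_const 2).aestronglyMeasurable (B ^ 2) (by
      filter_upwards [hB] with x hx
      rw [Real.norm_of_nonneg (by positivity)]
      exact sq_le_sq' (by linarith [neg_abs_le (N x), hx]) ((le_abs_self _).trans hx))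
  set c := ∫ y, N y ∂μ with hc
  have he : ∀ x, (N x - c) ^ 2 = N x ^ 2 - (2 * c) * N x + c ^ 2 := fun x => by ring
  have hint : Integrable (fun x => (N x - c) ^ 2) μ := by
    simp only [he]
    exact (hNi2.sub (hNi.const_mul _)).add (integrable_const _)
  have hv : ∫ x, (N x - c) ^ 2 ∂μ = (∫ x, N x ^ 2 ∂μ) - c ^ 2 := by
    have h1 : Integrable (fun x => N x ^ 2 - (2 * c) * N x) μ := hNi2.sub (hNi.const_mul _)
    simp only [he]
    rw [integral_add h1 (integrable_const _), integral_sub hNi2 (hNi.const_mul _),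
      integral_const_mul, ← hc]
    simp
    ring
  have hl : ∫⁻ x, ‖(N x : ℂ)‖ₑ ^ 2 ∂μ = ENNReal.ofReal (∫ x, N x ^ 2 ∂μ) := by
    rw [ofReal_integral_eq_lintegral_ofReal hNi2 (ae_of_all _ fun x => sq_nonneg _)]
    refine lintegral_congr fun x => ?_
    rw [← ofReal_norm, ← ENNReal.ofReal_pow (norm_nonneg _), Complex.norm_real, Real.norm_eq_abs,
      sq_abs]
  rw [← ofReal_integral_eq_lintegral_ofReal hint (ae_of_all _ fun x => sq_nonneg _), hv,
    ENNReal.ofReal_sub _ (sq_nonneg _), hl]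

theorem ENNReal.tsum_ite_ne_eq_sub {ι : Type*} [DecidableEq ι] (F : ι → ℝ≥0∞) {i : ι}
    (hi : F i ≠ ⊤) : ∑' m, (if m ≠ i then F m else 0) = ∑' m, F m - F i := by
  rw [ENNReal.tsum_eq_add_tsum_ite (f := F) i, ENNReal.add_sub_cancel_left hi]
  refine tsum_congr fun m => ?_
  by_cases hm : m = i <;> simp [hm]

/-- The variance of a periodised function in terms of its nonzero Fourier coefficients. -/
theorem lintegral_unitBox_sub_sq_eq {n : ℕ} {h N : (Fin n → ℝ) → ℝ} (hi : Integrable h)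
    (hNm : Measurable N)
    (hN : ∀ x ∈ unitBox n, HasSum (fun v : Fin n → ℤ => h ((fun i => (v i : ℝ)) + x)) (N x))
    {B : ℝ} (hB : ∀ x ∈ unitBox n, |N x| ≤ B) :
    ∫⁻ x in unitBox n, ENNReal.ofReal ((N x - ∫ y, h y) ^ 2) =
      ∑' m : Fin n → ℤ, (if m ≠ 0 then ‖∫ x, (h x : ℂ) *
        Complex.exp ((-(2 * π * ∑ j, m j * x j) : ℝ) * Complex.I)‖ₑ ^ 2 else 0) := by
  have hone : IsProbabilityMeasure (volume.restrict (unitBox n)) :=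
    ⟨by rw [Measure.restrict_apply_univ, volume_unitBox]⟩
  have hNB : ∀ x ∈ unitBox n, ‖(N x : ℂ)‖ ≤ B := fun x hx =>
    (Complex.norm_real (N x)).trans_le (hB x hx)
  have hNc : Measurable fun x => (N x : ℂ) := Complex.measurable_ofReal.comp hNm
  have hc0 := integral_unitBox_exp_mul_eq hi hN 0
  have hz : ∀ x : Fin n → ℝ, Complex.exp ((-(2 * π * ∑ j, ((0 : Fin n → ℤ) j : ℝ) * x j) : ℝ) *
      Complex.I) = 1 := fun x => by simp
  have hc : ∫ x in unitBox n, N x = ∫ y, h y := by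
    simp only [hz, one_mul, mul_one] at hc0
    rw [integral_complex_ofReal, integral_complex_ofReal] at hc0
    exact Complex.ofReal_injective hc0
  have hP : ∫⁻ x in unitBox n, ‖(N x : ℂ)‖ₑ ^ 2 = ∑' m : Fin n → ℤ, ‖∫ x, (h x : ℂ) *
      Complex.exp ((-(2 * π * ∑ j, m j * x j) : ℝ) * Complex.I)‖ₑ ^ 2 :=
    (lintegral_unitBox_sq_eq hNc hNB).trans
      (tsum_congr fun m => congrArg (fun z => ‖z‖ₑ ^ 2) (integral_unitBox_exp_mul_eq hi hN m))
  have h0 : ‖∫ x, (h x : ℂ) * Complex.exp ((-(2 * π * ∑ j, ((0 : Fin n → ℤ) j : ℝ) * x j) : ℝ) *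
      Complex.I)‖ₑ ^ 2 = ENNReal.ofReal ((∫ x in unitBox n, N x) ^ 2) := by
    rw [hc]
    simp only [hz, mul_one]
    rw [integral_complex_ofReal, ← ofReal_norm, ← ENNReal.ofReal_pow (norm_nonneg _),
      Complex.norm_real, Real.norm_eq_abs, sq_abs]
  have hV := lintegral_sub_integral_sq_eq (μ := volume.restrict (unitBox n)) hNm
    ((ae_restrict_iff' (measurableSet_unitBox n)).2 (ae_of_all _ hB))
  have hT := ENNReal.tsum_ite_ne_eq_sub (fun m : Fin n → ℤ => ‖∫ x, (h x : ℂ) *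
    Complex.exp ((-(2 * π * ∑ j, m j * x j) : ℝ) * Complex.I)‖ₑ ^ 2) (i := 0)
    (h0.trans_ne ENNReal.ofReal_ne_top)
  rw [← hc]
  exact hV.trans ((congrArg₂ _ hP h0.symm).trans hT.symm)

/-- The periodisation of a nonnegative function over `ℤⁿ`. -/
noncomputable def latticeSum {n : ℕ} (h : (Fin n → ℝ) → ℝ) (x : Fin n → ℝ) : ℝ :=
  (∑' v : Fin n → ℤ, ENNReal.ofReal (h ((fun i => (v i : ℝ)) + x))).toReal

theorem measurable_latticeSum {n : ℕ} {h : (Fin n → ℝ) → ℝ} (hh : Measurable h) :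
    Measurable (latticeSum h) := by
  unfold latticeSum
  refine Measurable.ennreal_toReal (Measurable.tsum fun v => ?_)
  exact (hh.comp (measurable_const_add _)).ennreal_ofReal

theorem hasSum_latticeSum {n : ℕ} {h : (Fin n → ℝ) → ℝ} (h0 : ∀ x, 0 ≤ h x) {x : Fin n → ℝ}
    (hx : ∑' v : Fin n → ℤ, ENNReal.ofReal (h ((fun i => (v i : ℝ)) + x)) ≠ ⊤) :
    HasSum (fun v : Fin n → ℤ => h ((fun i => (v i : ℝ)) + x)) (latticeSum h x) := by
  have h1 := ENNReal.hasSum_toReal hx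
  simp only [ENNReal.toReal_ofReal (h0 _)] at h1
  unfold latticeSum
  rw [ENNReal.tsum_toReal_eq (fun v => ENNReal.ofReal_ne_top)]
  simpa only [ENNReal.toReal_ofReal (h0 _)] using h1

theorem sum_sq_le_diagMajorant {n : ℕ} {a : Fin n → ℤ} (ha : ∀ j, a j ≠ 0) (x : Fin n → ℝ) :
    ∑ j, x j ^ 2 ≤ diagMajorant a x := by
  unfold diagMajorant
  refine Finset.sum_le_sum fun j _ => ?_
  have h1 : (1 : ℝ) ≤ |(a j : ℝ)| := by
    rw [← Int.cast_abs]; exact_mod_cast Int.one_le_abs (ha j)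
  nlinarith [sq_nonneg (x j)]

theorem exp_neg_mul_shift_sq_le {s α : ℝ} (hs : 0 < s) (hs1 : s ≤ 1) (hα : α ∈ Set.Ioc (0 : ℝ) 1)
    (k : ℤ) : Real.exp (-(π * s * (k + α) ^ 2)) ≤ 3 * s⁻¹ * (1 + (k : ℝ) ^ 2)⁻¹ := by
  have h1 := Real.add_one_le_exp (π * s * (k + α) ^ 2)
  have h2 : (k : ℝ) ^ 2 ≤ 2 * (k + α) ^ 2 + 2 := by
    nlinarith [sq_nonneg ((k : ℝ) + 2 * α), hα.1, hα.2]
  have h3 : s * (1 + (k : ℝ) ^ 2) ≤ 3 * Real.exp (π * s * (k + α) ^ 2) := by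
    have h4 : s * (k + α) ^ 2 ≤ π * s * (k + α) ^ 2 := by
      have := Real.pi_gt_three
      have : 0 ≤ s * (k + α) ^ 2 := by positivity
      nlinarith
    have h5 : s * (k : ℝ) ^ 2 ≤ s * (2 * (k + α) ^ 2 + 2) := mul_le_mul_of_nonneg_left h2 hs.le
    have : 0 ≤ s * (k + α) ^ 2 := by positivity
    nlinarith
  rw [Real.exp_neg, ← div_eq_mul_inv, ← div_eq_mul_inv, div_div, le_div_iff₀ (by positivity),
    inv_mul_le_iff₀ (Real.exp_pos _)]
  linarith

theorem exists_tsum_exp_neg_diagMajorant_le {n : ℕ} {a : Fin n → ℤ} (ha : ∀ j, a j ≠ 0) :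
    ∃ C : ℝ, 0 < C ∧ ∀ s : ℝ, 0 < s → s ≤ 1 → ∀ x ∈ unitBox n,
      ∑' v : Fin n → ℤ, ENNReal.ofReal
        (Real.exp (-(π * s * diagMajorant a ((fun i => (v i : ℝ)) + x)))) ≤
          ENNReal.ofReal (C * s⁻¹ ^ n) := by
  set S : ℝ≥0∞ := ∑' k : ℤ, ENNReal.ofReal ((1 + (k : ℝ) ^ 2)⁻¹) with hS
  have hSt : S ≠ ⊤ := tsum_inv_one_add_sq_ne_top
  refine ⟨(3 * (S.toReal + 1)) ^ n, by positivity, fun s hs hs1 x hx => ?_⟩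
  calc ∑' v : Fin n → ℤ, ENNReal.ofReal
        (Real.exp (-(π * s * diagMajorant a ((fun i => (v i : ℝ)) + x))))
      ≤ ∑' v : Fin n → ℤ, ∏ i, ENNReal.ofReal (3 * s⁻¹ * (1 + (v i : ℝ) ^ 2)⁻¹) := by
        refine ENNReal.tsum_le_tsum fun v => ?_
        rw [← ENNReal.ofReal_prod_of_nonneg (fun i _ => by positivity)]
        refine ENNReal.ofReal_le_ofReal ?_
        calc Real.exp (-(π * s * diagMajorant a ((fun i => (v i : ℝ)) + x)))
            ≤ Real.exp (∑ i, -(π * s * (v i + x i) ^ 2)) := by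
              refine Real.exp_le_exp.2 ?_
              rw [Finset.sum_neg_distrib, ← Finset.mul_sum]
              have := sum_sq_le_diagMajorant ha ((fun i => (v i : ℝ)) + x)
              simp only [Pi.add_apply] at this
              exact neg_le_neg (mul_le_mul_of_nonneg_left this (by positivity))
          _ = ∏ i, Real.exp (-(π * s * (v i + x i) ^ 2)) := Real.exp_sum _ _
          _ ≤ _ := Finset.prod_le_prod (fun i _ => (Real.exp_pos _).le)
              fun i _ => exp_neg_mul_shift_sq_le hs hs1 (hx i) (v i)
    _ = (∑' k : ℤ, ENNReal.ofReal (3 * s⁻¹ * (1 + (k : ℝ) ^ 2)⁻¹)) ^ n :=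
        ENNReal.tsum_pi_prod_eq_pow
          (fun k : ℤ => ENNReal.ofReal (3 * s⁻¹ * (1 + (k : ℝ) ^ 2)⁻¹)) n
    _ = (ENNReal.ofReal (3 * s⁻¹) * S) ^ n := by
        rw [hS, ← ENNReal.tsum_mul_left]
        congr 2
        funext k
        rw [← ENNReal.ofReal_mul (by positivity)]
    _ ≤ (ENNReal.ofReal (3 * s⁻¹) * ENNReal.ofReal (S.toReal + 1)) ^ n := by
        refine pow_le_pow_left' ?_ n
        gcongr
        rw [ENNReal.le_ofReal_iff_toReal_le hSt (by positivity)]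
        linarith
    _ = ENNReal.ofReal ((3 * (S.toReal + 1)) ^ n * s⁻¹ ^ n) := by
        rw [← ENNReal.ofReal_mul (by positivity), ← ENNReal.ofReal_pow (by positivity), ← mul_pow]
        congr 2
        ring

theorem measurable_smoothWeight {n : ℕ} (a : Fin n → ℤ) {g : ℝ → ℝ} (hg : Continuous g)
    (ξ s δ : ℝ) : Measurable (smoothWeight a g ξ s δ) := by
  unfold smoothWeight diagMajorant diagForm
  exact Continuous.measurable (by fun_prop)

theorem smoothWeight_nonneg {n : ℕ} (a : Fin n → ℤ) {g : ℝ → ℝ} (hg0 : ∀ y, 0 ≤ g y)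
    (ξ s δ : ℝ) (x : Fin n → ℝ) : 0 ≤ smoothWeight a g ξ s δ x :=
  mul_nonneg (Real.exp_pos _).le (hg0 _)

theorem smoothWeight_le {n : ℕ} (a : Fin n → ℤ) {g : ℝ → ℝ} (hg1 : ∀ y, g y ≤ 1)
    (ξ s δ : ℝ) (x : Fin n → ℝ) :
    smoothWeight a g ξ s δ x ≤ Real.exp (-(π * s * diagMajorant a x)) :=
  mul_le_of_le_one_right (Real.exp_pos _).le (hg1 _)

theorem integrable_smoothWeight {n : ℕ} {a : Fin n → ℤ} (ha : ∀ j, a j ≠ 0) {g : ℝ → ℝ}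
    (hg : Continuous g) (hg0 : ∀ y, 0 ≤ g y) (hg1 : ∀ y, g y ≤ 1) (ξ : ℝ) {s : ℝ} (hs : 0 < s)
    (δ : ℝ) : Integrable (smoothWeight a g ξ s δ) :=
  (integrable_exp_neg_diagMajorant ha hs).mono'
    (measurable_smoothWeight a hg ξ s δ).aestronglyMeasurable (ae_of_all _ fun x => by
      rw [Real.norm_of_nonneg (smoothWeight_nonneg a hg0 ξ s δ x)]
      exact smoothWeight_le a hg1 ξ s δ x)

/-- If no shifted lattice point in the ball of radius `ρ` is a near-solution, then the weighted
count is exponentially small. -/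
theorem exists_latticeSum_smoothWeight_le {n : ℕ} {a : Fin n → ℤ} (ha : ∀ j, a j ≠ 0) {g : ℝ → ℝ}
    (hg1 : ∀ y, g y ≤ 1) (hgs : ∀ y, 1 ≤ |y| → g y = 0) (ξ : ℝ) :
    ∃ C : ℝ, 0 < C ∧ ∀ s δ ρ : ℝ, 0 < s → s ≤ 1 → 0 < δ → 0 ≤ ρ → ∀ x ∈ unitBox n,
      (∀ v : Fin n → ℤ, (∀ i, |v i + x i| ≤ ρ) →
        δ ≤ |diagForm a ((fun i => (v i : ℝ)) + x) - ξ|) →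
      latticeSum (smoothWeight a g ξ s δ) x ≤ C * s⁻¹ ^ n * Real.exp (-(s * ρ ^ 2)) := by
  obtain ⟨C, hC, h⟩ := exists_tsum_exp_neg_diagMajorant_le ha
  refine ⟨C * 2 ^ n, by positivity, fun s δ ρ hs hs1 hδ hρ x hx hbad => ?_⟩
  refine ENNReal.toReal_le_of_le_ofReal (by positivity) ?_
  calc ∑' v : Fin n → ℤ, ENNReal.ofReal (smoothWeight a g ξ s δ ((fun i => (v i : ℝ)) + x))
      ≤ ∑' v : Fin n → ℤ, ENNReal.ofReal (Real.exp (-(s * ρ ^ 2))) * ENNReal.ofReal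
        (Real.exp (-(π * (s / 2) * diagMajorant a ((fun i => (v i : ℝ)) + x)))) := by
        refine ENNReal.tsum_le_tsum fun v => ?_
        rw [← ENNReal.ofReal_mul (Real.exp_pos _).le]
        refine ENNReal.ofReal_le_ofReal ?_
        by_cases hv : ∀ i, |v i + x i| ≤ ρ
        · have h1 : smoothWeight a g ξ s δ ((fun i => (v i : ℝ)) + x) = 0 := by
            unfold smoothWeight
            rw [hgs, mul_zero]
            rw [abs_div, abs_of_pos hδ, le_div_iff₀ hδ, one_mul]
            exact hbad v hv
          rw [h1]; positivity
        · push Not at hv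
          obtain ⟨i, hi⟩ := hv
          refine (smoothWeight_le a hg1 ξ s δ _).trans ?_
          rw [← Real.exp_add]
          refine Real.exp_le_exp.2 ?_
          have h2 : ρ ^ 2 ≤ diagMajorant a ((fun i => (v i : ℝ)) + x) := by
            refine le_trans ?_ (sum_sq_le_diagMajorant ha _)
            refine le_trans ?_ (Finset.single_le_sum (f := fun j =>
              (((fun i => (v i : ℝ)) + x) j) ^ 2) (fun j _ => sq_nonneg _) (Finset.mem_univ i))
            simp only [Pi.add_apply]
            rw [← sq_abs (v i + x i : ℝ)]
            exact pow_le_pow_left₀ hρ hi.le 2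
          have h3 : s * ρ ^ 2 ≤ π * (s / 2) * ρ ^ 2 := by
            have := Real.pi_gt_three
            have : 0 ≤ s * ρ ^ 2 := by positivity
            nlinarith
          have h4 := mul_le_mul_of_nonneg_left h2 (by positivity : 0 ≤ π * (s / 2))
          linarith
    _ ≤ ENNReal.ofReal (Real.exp (-(s * ρ ^ 2))) * ENNReal.ofReal (C * (s / 2)⁻¹ ^ n) := by
        rw [ENNReal.tsum_mul_left]
        gcongr
        exact h (s / 2) (by positivity) (by linarith) x hx
    _ = ENNReal.ofReal (C * 2 ^ n * s⁻¹ ^ n * Real.exp (-(s * ρ ^ 2))) := by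
        rw [← ENNReal.ofReal_mul (Real.exp_pos _).le]
        congr 1
        rw [inv_div, div_eq_mul_inv, mul_pow]
        ring

theorem exists_bump_fourier : ∃ (g : ℝ → ℝ) (G : ℝ → ℂ) (K : ℝ), Continuous g ∧ Continuous G ∧
    (∀ y, 0 ≤ g y) ∧ (∀ y, g y ≤ 1) ∧ (∀ y, |y| ≤ 1 / 2 → g y = 1) ∧ (∀ y, 1 ≤ |y| → g y = 0) ∧
    (∀ t, ‖G t‖ ≤ K / (1 + t ^ 2)) ∧
    ∀ y, (g y : ℂ) = ∫ t, G t * Complex.exp ((2 * π * t * y : ℝ) * Complex.I) := by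
  let b : ContDiffBump (0 : ℝ) := ⟨1 / 2, 1, by norm_num, by norm_num⟩
  have hcs : HasCompactSupport fun y => (b y : ℂ) :=
    b.hasCompactSupport.comp_left (g := fun r : ℝ => (r : ℂ)) Complex.ofReal_zero
  have hcd : ContDiff ℝ (⊤ : ℕ∞) fun y => (b y : ℂ) := Complex.ofRealCLM.contDiff.comp b.contDiff
  let φ : SchwartzMap ℝ ℂ := hcs.toSchwartzMap hcd
  let Γ : SchwartzMap ℝ ℂ := FourierTransform.fourier φ
  obtain ⟨K0, -, hK0⟩ := Γ.decay 0 0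
  obtain ⟨K2, -, hK2⟩ := Γ.decay 2 0
  refine ⟨b, Γ, K0 + K2, b.continuous, Γ.continuous, fun y => b.nonneg, fun y => b.le_one,
    fun y hy => b.one_of_mem_closedBall (by simpa [b] using hy),
    fun y hy => b.zero_of_le_dist (by simpa [b] using hy), fun t => ?_, fun y => ?_⟩
  · have h0 := hK0 t
    have h2 := hK2 t
    simp only [norm_iteratedFDeriv_zero, pow_zero, one_mul, Real.norm_eq_abs, sq_abs] at h0 h2
    rw [le_div_iff₀ (by positivity)]
    nlinarith
  · have h1 : FourierTransformInv.fourierInv Γ = φ := FourierPair.fourierInv_fourier_eq φ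
    have h2 : FourierTransformInv.fourierInv (Γ : ℝ → ℂ) y = φ y := by
      rw [← SchwartzMap.fourierInv_coe, h1]
    have h3 : φ y = (b y : ℂ) := rfl
    rw [← h3, ← h2, Real.fourierInv_eq']
    refine integral_congr_ae (ae_of_all _ fun t => ?_)
    simp only [smul_eq_mul, mul_comm (Γ t)]
    congr 2
    simp
    ring

theorem le_sqrt_sub_sqrt {D η B : ℝ} (hD : 0 ≤ D) (hη : 0 ≤ η) (hB : 0 < B) (h : D + η ≤ B ^ 2) :
    η / (2 * B) ≤ √(D + η) - √D := by
  have h1 : √(D + η) ≤ B := Real.sqrt_le_left hB.le |>.2 h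
  have h2 : √D ≤ √(D + η) := Real.sqrt_le_sqrt (by linarith)
  have h3 := Real.sq_sqrt hD
  have h4 := Real.sq_sqrt (add_nonneg hD hη)
  rw [div_le_iff₀ (by positivity)]
  nlinarith [Real.sqrt_nonneg D]

theorem exists_le_integral_smoothWeight {m : ℕ} {a : Fin (m + 1) → ℤ} (ha : ∀ j, a j ≠ 0)
    {i : Fin (m + 1)} {k : Fin m} (hi : 0 < a i) (hk : a (i.succAbove k) < 0) {g : ℝ → ℝ}
    (hg : Continuous g) (hg0 : ∀ y, 0 ≤ g y) (hg1 : ∀ y, g y ≤ 1)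
    (hgh : ∀ y, |y| ≤ 1 / 2 → g y = 1) (ξ : ℝ) :
    ∃ c T₀ : ℝ, 0 < c ∧ 1 ≤ T₀ ∧ ∀ T ≥ T₀, ∀ δ : ℝ, 0 < δ → δ ≤ 1 →
      c * δ * (T ^ m / T) ≤ ∫ x, smoothWeight a g ξ (T ^ 2)⁻¹ δ x := by
  set A : ℝ := ∑ j : Fin m, |(a (i.succAbove j) : ℝ)| with hA
  have hA0 : 0 ≤ A := by positivity
  set M : ℝ := A + 2 with hM
  set B : ℝ := A * (M + 1) ^ 2 with hB
  have hB0 : 0 ≤ B := by positivity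
  have hai : (1 : ℝ) ≤ a i := by exact_mod_cast hi
  set c : ℝ := Real.exp (-(π * (2 * B + 2))) * (4 * a i * (B + 2))⁻¹ with hc
  refine ⟨c, 1 + |ξ|, by positivity, by linarith [abs_nonneg ξ], fun T hT δ hδ hδ1 => ?_⟩
  have hT1 : 1 ≤ T := by linarith [abs_nonneg ξ]
  have hT0 : 0 < T := by linarith
  have hξ : |ξ| ≤ T ^ 2 := by nlinarith [abs_nonneg ξ]
  let lo : Fin m → ℝ := fun j => if j = k then M * T else 0
  set Y : Set (Fin m → ℝ) := Set.Icc lo (fun j => lo j + T) with hY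
  have hYm : MeasurableSet Y := measurableSet_Icc
  have hYv : volume Y = ENNReal.ofReal (T ^ m) := by
    rw [hY, Real.volume_Icc_pi]
    simp [ENNReal.ofReal_pow hT0.le]
  have key : ∀ y ∈ Y, ENNReal.ofReal (c * δ / T) ≤
      ∫⁻ u : ℝ, ENNReal.ofReal (smoothWeight a g ξ (T ^ 2)⁻¹ δ (i.insertNth u y)) := by
    intro y hy
    set D : ℝ := ξ - ∑ j, (a (i.succAbove j) : ℝ) * y j ^ 2 with hD
    have hy0 : ∀ j, 0 ≤ y j := fun j => le_trans (by dsimp [lo]; split_ifs <;> positivity) (hy.1 j)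
    have hy1 : ∀ j, y j ≤ (M + 1) * T := fun j => (hy.2 j).trans (by
      dsimp [lo]; split_ifs
      · linarith
      · nlinarith)
    have habs : ∑ j, |(a (i.succAbove j) : ℝ)| * y j ^ 2 ≤ B * T ^ 2 := by
      calc ∑ j, |(a (i.succAbove j) : ℝ)| * y j ^ 2
          ≤ ∑ j, |(a (i.succAbove j) : ℝ)| * ((M + 1) * T) ^ 2 :=
            Finset.sum_le_sum fun j _ => mul_le_mul_of_nonneg_left
              (pow_le_pow_left₀ (hy0 j) (hy1 j) 2) (abs_nonneg _)
        _ = B * T ^ 2 := by rw [← Finset.sum_mul, hB]; ring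
    have hDu : D ≤ (B + 1) * T ^ 2 := by
      have h1 : -∑ j, (a (i.succAbove j) : ℝ) * y j ^ 2 ≤
          ∑ j, |(a (i.succAbove j) : ℝ)| * y j ^ 2 := by
        rw [← Finset.sum_neg_distrib]
        refine Finset.sum_le_sum fun j _ => ?_
        rw [← neg_mul]
        exact mul_le_mul_of_nonneg_right (neg_le_abs _) (sq_nonneg _)
      linarith [le_abs_self ξ]
    have hDl : 0 ≤ D := by
      have h1 : ∑ j, (a (i.succAbove j) : ℝ) * y j ^ 2 ≤
          ∑ j, (|(a (i.succAbove j) : ℝ)| * T ^ 2 - if j = k then M ^ 2 * T ^ 2 else 0) := by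
        refine Finset.sum_le_sum fun j _ => ?_
        by_cases hjk : j = k
        · subst hjk
          rw [if_pos rfl]
          have h2 : (a (i.succAbove j) : ℝ) ≤ -1 := by
            have : a (i.succAbove j) ≤ -1 := by omega
            exact_mod_cast this
          have h3 : M * T ≤ y j := by have := hy.1 j; simpa [lo] using this
          have h4 : (M * T) ^ 2 ≤ y j ^ 2 := pow_le_pow_left₀ (by positivity) h3 2
          have h5 : 0 ≤ |(a (i.succAbove j) : ℝ)| * T ^ 2 := by positivity
          nlinarith [sq_nonneg (y j)]
        · rw [if_neg hjk, sub_zero]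
          have h3 : y j ≤ T := by have := hy.2 j; simpa [lo, hjk] using this
          have h4 : y j ^ 2 ≤ T ^ 2 := pow_le_pow_left₀ (hy0 j) h3 2
          exact (mul_le_mul_of_nonneg_right (le_abs_self _) (sq_nonneg _)).trans
            (mul_le_mul_of_nonneg_left h4 (abs_nonneg _))
      rw [Finset.sum_sub_distrib, ← Finset.sum_mul, ← hA, Finset.sum_ite_eq' Finset.univ k,
        if_pos (Finset.mem_univ k)] at h1
      have h2 : A + 1 ≤ M ^ 2 := by rw [hM]; nlinarith
      have h3 : (A + 1) * T ^ 2 ≤ M ^ 2 * T ^ 2 := mul_le_mul_of_nonneg_right h2 (by positivity)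
      linarith [neg_abs_le ξ]
    set D' := D / a i with hD'
    set η := δ / 2 / a i with hη
    have haD : a i * D' = D := by rw [hD']; field_simp
    have haη : a i * η = δ / 2 := by rw [hη]; field_simp
    have hη0 : 0 ≤ η := by positivity
    have hD'0 : 0 ≤ D' := by positivity
    have hD'u : D' + η ≤ ((B + 2) * T) ^ 2 := by
      have h1 : D' ≤ D := div_le_self hDl hai
      have h2 : η ≤ δ / 2 := div_le_self (by positivity) hai
      have h3 : 1 ≤ T ^ 2 := by nlinarith
      have h4 : (B + 2) * T ^ 2 ≤ ((B + 2) * T) ^ 2 := by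
        rw [mul_pow]; exact mul_le_mul_of_nonneg_right (by nlinarith) (by positivity)
      linarith
    have hlen := le_sqrt_sub_sqrt hD'0 hη0 (by positivity : 0 < (B + 2) * T) hD'u
    set E : ℝ := Real.exp (-(π * (2 * B + 2))) with hE
    calc ENNReal.ofReal (c * δ / T)
        = ENNReal.ofReal E * ENNReal.ofReal (η / (2 * ((B + 2) * T))) := by
          rw [← ENNReal.ofReal_mul (Real.exp_pos _).le, hc, hη, hE]
          congr 1
          field_simp
          ring
      _ ≤ ENNReal.ofReal E * volume (Set.Icc √D' √(D' + η)) := by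
          rw [Real.volume_Icc]
          gcongr
      _ = ∫⁻ u in Set.Icc √D' √(D' + η), ENNReal.ofReal E := by
          rw [setLIntegral_const]
      _ ≤ ∫⁻ u in Set.Icc √D' √(D' + η),
            ENNReal.ofReal (smoothWeight a g ξ (T ^ 2)⁻¹ δ (i.insertNth u y)) := by
          refine setLIntegral_mono_ae' measurableSet_Icc (ae_of_all _ fun u hu => ?_)
          refine ENNReal.ofReal_le_ofReal ?_
          have hu0 : 0 ≤ u := (Real.sqrt_nonneg _).trans hu.1
          have hul : D' ≤ u ^ 2 := (Real.sqrt_le_left hu0).1 hu.1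
          have huu : u ^ 2 ≤ D' + η := (Real.le_sqrt hu0 (by positivity)).1 hu.2
          have hl : D ≤ a i * u ^ 2 := by rw [← haD]; gcongr
          have hr : a i * u ^ 2 ≤ D + δ / 2 := by rw [← haD, ← haη, ← mul_add]; gcongr
          have hQ : diagForm a (i.insertNth u y) - ξ = a i * u ^ 2 - D := by
            unfold diagForm
            rw [Fin.sum_univ_succAbove _ i]
            simp only [Fin.insertNth_apply_same, Fin.insertNth_apply_succAbove]
            rw [hD]; ring
          have hH : diagMajorant a (i.insertNth u y) ≤ (2 * B + 2) * T ^ 2 := by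
            unfold diagMajorant
            rw [Fin.sum_univ_succAbove _ i]
            simp only [Fin.insertNth_apply_same, Fin.insertNth_apply_succAbove]
            rw [abs_of_pos (by linarith : (0 : ℝ) < a i)]
            nlinarith
          unfold smoothWeight
          rw [hgh, mul_one]
          · refine Real.exp_le_exp.2 (neg_le_neg ?_)
            rw [mul_assoc]
            refine mul_le_mul_of_nonneg_left ?_ Real.pi_pos.le
            rw [inv_mul_le_iff₀ (by positivity)]
            linarith
          · rw [hQ, abs_div, abs_of_pos hδ, abs_of_nonneg (by linarith), div_le_iff₀ hδ]
            linarith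
      _ ≤ _ := setLIntegral_le_lintegral _ _
  have hint := integrable_smoothWeight ha hg hg0 hg1 ξ (by positivity : 0 < (T ^ 2)⁻¹) δ
  have hmeas := (measurable_smoothWeight a hg ξ (T ^ 2)⁻¹ δ).ennreal_ofReal
  have hmp := (volume_preserving_piFinSuccAbove (fun _ : Fin (m + 1) => ℝ) i).symm
  have hmeas' : Measurable fun z : ℝ × (Fin m → ℝ) => ENNReal.ofReal (smoothWeight a g ξ (T ^ 2)⁻¹ δ
      ((MeasurableEquiv.piFinSuccAbove (fun _ : Fin (m + 1) => ℝ) i).symm z)) :=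
    hmeas.comp (MeasurableEquiv.measurable _)
  refine (ENNReal.ofReal_le_ofReal_iff
    (integral_nonneg fun x => smoothWeight_nonneg a hg0 _ _ _ x)).1 ?_
  rw [ofReal_integral_eq_lintegral_ofReal hint
    (ae_of_all _ fun x => smoothWeight_nonneg a hg0 _ _ _ x), ← hmp.lintegral_comp hmeas,
    Measure.volume_eq_prod, lintegral_prod_symm' _ hmeas']
  calc ENNReal.ofReal (c * δ * (T ^ m / T))
      = ∫⁻ y in Y, ENNReal.ofReal (c * δ / T) := by
        rw [setLIntegral_const, hYv, ← ENNReal.ofReal_mul (by positivity)]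
        congr 1; ring
    _ ≤ ∫⁻ y in Y, ∫⁻ u : ℝ,
          ENNReal.ofReal (smoothWeight a g ξ (T ^ 2)⁻¹ δ (i.insertNth u y)) :=
        setLIntegral_mono_ae' hYm (ae_of_all _ key)
    _ ≤ _ := setLIntegral_le_lintegral _ _

/-- Chebyshev's inequality for a periodised weight: the set of `x` where the count is at most half
of its mean. -/
theorem volume_latticeSum_le_mul_le {n : ℕ} {h : (Fin n → ℝ) → ℝ} (hm : Measurable h)
    (h0 : ∀ x, 0 ≤ h x) (hi : Integrable h) {B : ℝ}
    (hB : ∀ x ∈ unitBox n,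
      ∑' v : Fin n → ℤ, ENNReal.ofReal (h ((fun i => (v i : ℝ)) + x)) ≤ ENNReal.ofReal B)
    (hB0 : 0 ≤ B) {q : ℝ} (hq : 0 ≤ q) (hqi : q ≤ ∫ x, h x) :
    ENNReal.ofReal (q ^ 2 / 4) * volume {x ∈ unitBox n | latticeSum h x ≤ q / 2} ≤
      ∑' m : Fin n → ℤ, (if m ≠ 0 then ‖∫ x, (h x : ℂ) *
        Complex.exp ((-(2 * π * ∑ j, m j * x j) : ℝ) * Complex.I)‖ₑ ^ 2 else 0) := by
  have hNm := measurable_latticeSum hm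
  rw [← lintegral_unitBox_sub_sq_eq hi hNm
    (fun x hx => hasSum_latticeSum h0 (ne_top_of_le_ne_top ENNReal.ofReal_ne_top (hB x hx)))
    (B := B) (fun x hx => (abs_of_nonneg ENNReal.toReal_nonneg).trans_le
      (ENNReal.toReal_le_of_le_ofReal hB0 (hB x hx)))]
  have hfm : Measurable fun x => ENNReal.ofReal ((latticeSum h x - ∫ y, h y) ^ 2) := by fun_prop
  refine le_trans ?_ (mul_meas_ge_le_lintegral hfm (ENNReal.ofReal (q ^ 2 / 4)))
  refine mul_le_mul_right ?_ _
  rw [Measure.restrict_apply (measurableSet_le measurable_const hfm)]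
  refine measure_mono fun x hx => ⟨?_, hx.1⟩
  refine ENNReal.ofReal_le_ofReal ?_
  have hx2 : latticeSum h x ≤ q / 2 := hx.2
  nlinarith

/-- The set of shifts in the unit box without a near-solution of size at most `ρ`. -/
def badShifts {n : ℕ} (a : Fin n → ℤ) (ξ ρ δ : ℝ) : Set (Fin n → ℝ) :=
  {x ∈ unitBox n | ∀ v : Fin n → ℤ, (∀ i, |v i + x i| ≤ ρ) →
    δ ≤ |diagForm a ((fun i => (v i : ℝ)) + x) - ξ|}

theorem exists_volume_badShifts_le {m : ℕ} (hm : 2 ≤ m) {a : Fin (m + 1) → ℤ} (ha : ∀ j, a j ≠ 0)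
    {i : Fin (m + 1)} {k : Fin m} (hi : 0 < a i) (hk : a (i.succAbove k) < 0) (ξ : ℝ) {κ η : ℝ}
    (hκ0 : 0 ≤ κ) (hκ : κ < (m : ℝ) - 1) (hη : 0 < η) :
    ∃ θ C T₁ : ℝ, 0 < θ ∧ 0 ≤ C ∧ ∀ T ≥ T₁,
      volume (badShifts a ξ (T ^ (1 + η)) (T ^ (-κ))) ≤ ENNReal.ofReal (C * T ^ (-θ)) := by
  obtain ⟨g, G, K, hg, hG, hg0, hg1, hgh, hgs, hK, hgG⟩ := exists_bump_fourier
  obtain ⟨c, T₀, hc, hT₀, hmean⟩ := exists_le_integral_smoothWeight ha hi hk hg hg0 hg1 hgh ξ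
  obtain ⟨C₁, hC₁, htail⟩ := exists_latticeSum_smoothWeight_le ha hg1 hgs ξ
  obtain ⟨C₂, hC₂, hsum⟩ := exists_tsum_exp_neg_diagMajorant_le ha
  obtain ⟨C₃, hC₃, hexp⟩ := exists_exp_neg_le_rpow
    (r := (2 * (m + 1) + κ + 1) / (2 * η)) (by positivity)
  set ε : ℝ := min (1 / 2) (((m : ℝ) - 1 - κ) / (2 * (κ + 1))) with hε
  have hε0 : 0 < ε := lt_min (by norm_num) (div_pos (by linarith) (by positivity))
  have hε1 : ε < 1 := (min_le_left _ _).trans_lt (by norm_num)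
  have hε2 : ε * (κ + 1) ≤ ((m : ℝ) - 1 - κ) / 2 := by
    have h1 : ε ≤ ((m : ℝ) - 1 - κ) / (2 * (κ + 1)) := min_le_right _ _
    rw [le_div_iff₀ (by positivity)] at h1
    linarith
  obtain ⟨C₄, hC₄, hvar⟩ := exists_tsum_weightFourier_le (by omega : 3 ≤ m + 1) ha hG hK hgG ξ
    hε0 hε1
  refine ⟨(m : ℝ) - 1 - κ - ε * (κ + 1), C₄.toReal * (4 / c ^ 2),
    max T₀ (2 * (C₁ * C₃) / c), by linarith, by positivity, fun T hT => ?_⟩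
  have hTT : T₀ ≤ T := (le_max_left _ _).trans hT
  have hTC : 2 * (C₁ * C₃) / c ≤ T := (le_max_right _ _).trans hT
  have hT1 : 1 ≤ T := hT₀.trans hTT
  have hT0 : 0 < T := by linarith
  set δ := T ^ (-κ) with hδ
  set s := (T ^ 2)⁻¹ with hs
  have hs0 : 0 < s := by positivity
  have hs1 : s ≤ 1 := inv_le_one_of_one_le₀ (by nlinarith)
  have hδ0 : 0 < δ := by positivity
  have hδ1 : δ ≤ 1 := Real.rpow_le_one_of_one_le_of_nonpos hT1 (by linarith)
  set q := c * δ * (T ^ m / T) with hq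
  have hq0 : 0 < q := by positivity
  have hTm : T ^ m / T = T ^ ((m : ℝ) - 1) := by
    rw [Real.rpow_sub hT0, Real.rpow_one, Real.rpow_natCast]
  have hsub : badShifts a ξ (T ^ (1 + η)) δ ⊆
      {x ∈ unitBox (m + 1) | latticeSum (smoothWeight a g ξ s δ) x ≤ q / 2} := by
    intro x hx
    refine ⟨hx.1, (htail s δ (T ^ (1 + η)) hs0 hs1 hδ0 (by positivity) x hx.1 hx.2).trans ?_⟩
    have h1 : s * (T ^ (1 + η)) ^ 2 = T ^ (2 * η) := by
      rw [hs, ← Real.rpow_natCast (T ^ (1 + η)), ← Real.rpow_natCast T, ← Real.rpow_neg hT0.le,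
        ← Real.rpow_mul hT0.le, ← Real.rpow_add hT0]
      congr 1; push_cast; ring
    have h2 : s⁻¹ ^ (m + 1) = T ^ (2 * ((m : ℝ) + 1)) := by
      rw [hs, inv_inv, ← pow_mul, ← Real.rpow_natCast]
      congr 1; push_cast; ring
    have h3 := hexp (T ^ (2 * η)) (by positivity)
    rw [← Real.rpow_mul hT0.le] at h3
    have h4 : 2 * η * -((2 * ((m : ℝ) + 1) + κ + 1) / (2 * η)) =
        -(2 * (m + 1) + κ + 1) := by field_simp
    rw [h4] at h3
    rw [h1, h2]
    calc C₁ * T ^ (2 * ((m : ℝ) + 1)) * Real.exp (-T ^ (2 * η))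
        ≤ C₁ * T ^ (2 * ((m : ℝ) + 1)) * (C₃ * T ^ (-(2 * ((m : ℝ) + 1) + κ + 1))) := by gcongr
      _ = C₁ * C₃ * (T ^ (-κ) * T ^ (-1 : ℝ)) := by
          rw [← Real.rpow_add hT0]
          rw [show -κ + -1 = 2 * ((m : ℝ) + 1) + -(2 * ((m : ℝ) + 1) + κ + 1) by ring,
            Real.rpow_add hT0]
          ring
      _ ≤ q / 2 := by
          rw [Real.rpow_neg_one, ← hδ, hq, hTm]
          have h5 : 1 ≤ T ^ ((m : ℝ) - 1) := Real.one_le_rpow hT1 (by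
            have : (2 : ℝ) ≤ m := by exact_mod_cast hm
            linarith)
          have h6 : C₁ * C₃ * T⁻¹ ≤ c / 2 := by
            rw [← div_eq_mul_inv, div_le_iff₀ hT0]
            rw [div_le_iff₀ hc] at hTC
            linarith
          have h7 : c / 2 ≤ c / 2 * T ^ ((m : ℝ) - 1) := le_mul_of_one_le_right (by positivity) h5
          nlinarith
  have hcheb := volume_latticeSum_le_mul_le (measurable_smoothWeight a hg ξ s δ)
    (smoothWeight_nonneg a hg0 ξ s δ) (integrable_smoothWeight ha hg hg0 hg1 ξ hs0 δ)
    (fun x hx => (ENNReal.tsum_le_tsum fun v =>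
      ENNReal.ofReal_le_ofReal (smoothWeight_le a hg1 ξ s δ _)).trans (hsum s hs0 hs1 x hx))
    (by positivity) hq0.le (hmean T hTT δ hδ0 hδ1)
  have hfin := hcheb.trans (hvar s δ hs0 hs1 hδ0 hδ1)
  refine (measure_mono hsub).trans ?_
  rw [mul_comm, ← ENNReal.le_div_iff_mul_le
    (Or.inl (ENNReal.ofReal_pos.2 (by positivity)).ne') (Or.inl ENNReal.ofReal_ne_top),
    ← ENNReal.ofReal_toReal hC₄, ← ENNReal.ofReal_mul ENNReal.toReal_nonneg,
    ← ENNReal.ofReal_div_of_pos (by positivity)] at hfin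
  refine hfin.trans (ENNReal.ofReal_le_ofReal (le_of_eq ?_))
  have hw1 : δ ^ (1 - ε) = T ^ (-κ * (1 - ε)) := by rw [hδ, ← Real.rpow_mul hT0.le]
  have hw2 : s ^ (-((((m + 1 : ℕ) : ℝ) - 2 + ε) / 2)) = T ^ ((m : ℝ) - 1 + ε) := by
    rw [hs, ← Real.rpow_natCast, ← Real.rpow_neg hT0.le, ← Real.rpow_mul hT0.le]
    congr 1; push_cast; ring
  have hq2 : q ^ 2 / 4 = c ^ 2 / 4 * T ^ (2 * ((m : ℝ) - 1 - κ)) := by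
    rw [hq, hTm, hδ, mul_assoc, ← Real.rpow_add hT0, mul_pow, ← Real.rpow_natCast (T ^ _),
      ← Real.rpow_mul hT0.le]
    rw [show (-κ + ((m : ℝ) - 1)) * ((2 : ℕ) : ℝ) = 2 * ((m : ℝ) - 1 - κ) by push_cast; ring]
    ring
  have hex : T ^ (-κ * (1 - ε)) * T ^ ((m : ℝ) - 1 + ε) =
      T ^ (2 * ((m : ℝ) - 1 - κ)) * T ^ (-((m : ℝ) - 1 - κ - ε * (κ + 1))) := by
    rw [← Real.rpow_add hT0, ← Real.rpow_add hT0]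
    congr 1; ring
  rw [hw1, hw2, hex, hq2]
  have hP : 0 < T ^ (2 * ((m : ℝ) - 1 - κ)) := by positivity
  field_simp

theorem exists_two_pow_rpow_le {κ κ₁ η : ℝ} (hη : 0 < η) (hκ₁ : 0 ≤ κ₁)
    (hκ : κ * (1 + η) < κ₁) (J : ℕ) :
    ∃ t₀ : ℝ, ∀ t ≥ t₀, ∃ j ≥ J, ((2 : ℝ) ^ j) ^ (1 + η) ≤ t ∧
      ((2 : ℝ) ^ j) ^ (-κ₁) ≤ t ^ (-κ) := by
  have hpos : 0 < κ₁ / (1 + η) - κ := by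
    rw [sub_pos, lt_div_iff₀ (by positivity)]; exact hκ
  have h1 := (tendsto_rpow_atTop hpos).eventually_ge_atTop ((2 : ℝ) ^ κ₁)
  have h2 := (tendsto_rpow_atTop (by positivity : 0 < (1 + η)⁻¹)).eventually_ge_atTop ((2 : ℝ) ^ J)
  obtain ⟨t₀, ht₀⟩ := eventually_atTop.1 ((h1.and h2).and (eventually_ge_atTop (1 : ℝ)))
  refine ⟨t₀, fun t ht => ?_⟩
  obtain ⟨⟨ha, hb⟩, hc⟩ := ht₀ t ht
  have ht0 : 0 < t := by linarith
  set u := t ^ (1 + η)⁻¹ with hu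
  have hu1 : 1 ≤ u := Real.one_le_rpow hc (by positivity)
  obtain ⟨j, hj1, hj2⟩ := exists_nat_pow_near hu1 (one_lt_two : (1 : ℝ) < 2)
  refine ⟨j, ?_, ?_, ?_⟩
  · have h3 : (2 : ℝ) ^ J < 2 ^ (j + 1) := hb.trans_lt hj2
    have := (pow_lt_pow_iff_right₀ (one_lt_two : (1 : ℝ) < 2)).1 h3
    omega
  · calc ((2 : ℝ) ^ j) ^ (1 + η) ≤ u ^ (1 + η) := by gcongr
      _ = t := by rw [hu, ← Real.rpow_mul ht0.le, inv_mul_cancel₀ (by positivity), Real.rpow_one]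
  · have h4 : u / 2 ≤ (2 : ℝ) ^ j := by rw [pow_succ] at hj2; linarith
    have h5 : t ^ (κ₁ / (1 + η) - κ) * t ^ (-(κ₁ / (1 + η))) = t ^ (-κ) := by
      rw [← Real.rpow_add ht0]; congr 1; ring
    calc ((2 : ℝ) ^ j) ^ (-κ₁) ≤ (u / 2) ^ (-κ₁) :=
          Real.rpow_le_rpow_of_nonpos (by positivity) h4 (by linarith)
      _ = (2 : ℝ) ^ κ₁ * t ^ (-(κ₁ / (1 + η))) := by
          rw [Real.div_rpow (by positivity) (by norm_num), hu, ← Real.rpow_mul ht0.le,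
            Real.rpow_neg (by norm_num : (0 : ℝ) ≤ 2), div_inv_eq_mul, mul_comm]
          congr 2; field_simp
      _ ≤ t ^ (κ₁ / (1 + η) - κ) * t ^ (-(κ₁ / (1 + η))) := by gcongr
      _ = _ := h5

theorem ae_of_ae_unitBox {n : ℕ} {P : (Fin n → ℝ) → Prop}
    (hP : ∀ (w : Fin n → ℤ) x, P x → P ((fun i => (w i : ℝ)) + x))
    (h : ∀ᵐ x, x ∈ unitBox n → P x) : ∀ᵐ x, P x := by
  rw [ae_iff] at h ⊢
  have hsub : {x | ¬ P x} ⊆ ⋃ w : Fin n → ℤ,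
      (fun x => (-fun i => (w i : ℝ)) + x) ⁻¹' {x | ¬ (x ∈ unitBox n → P x)} := by
    intro x hx
    have hx1 : x ∈ ⋃ v : Fin n → ℤ, (fun x => (fun i => (v i : ℝ)) + x) '' unitBox n := by
      rw [iUnion_add_image_unitBox]; trivial
    obtain ⟨w, y, hy, hyx⟩ := Set.mem_iUnion.1 hx1
    refine Set.mem_iUnion.2 ⟨w, ?_⟩
    have h1 : (-fun i => (w i : ℝ)) + x = y := by rw [← hyx]; simp
    change ¬ ((-fun i => (w i : ℝ)) + x ∈ unitBox n → P ((-fun i => (w i : ℝ)) + x))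
    rw [h1]
    exact fun hc => hx (hyx ▸ hP w y (hc hy))
  refine measure_mono_null hsub (measure_iUnion_null fun w => ?_)
  rw [measure_preimage_add]
  exact h

theorem ae_diagForm_near {m : ℕ} (hm : 2 ≤ m) {a : Fin (m + 1) → ℤ} (ha : ∀ j, a j ≠ 0)
    {i : Fin (m + 1)} {k : Fin m} (hi : 0 < a i) (hk : a (i.succAbove k) < 0) (ξ : ℝ) {κ : ℝ}
    (hκ : κ < (m : ℝ) - 1) :
    ∀ᵐ α : Fin (m + 1) → ℝ, ∃ t₀ : ℝ, ∀ t ≥ t₀, ∃ v : Fin (m + 1) → ℤ,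
      (∀ i, |v i + α i| ≤ t) ∧ |diagForm a ((fun i => (v i : ℝ)) + α) - ξ| < t ^ (-κ) := by
  have hm2 : (2 : ℝ) ≤ m := by exact_mod_cast hm
  set κ₀ := max κ 0 with hκ₀
  have hκ₀0 : 0 ≤ κ₀ := le_max_right _ _
  have hκ₀m : κ₀ < (m : ℝ) - 1 := max_lt hκ (by linarith)
  set κ₁ := (κ₀ + ((m : ℝ) - 1)) / 2 with hκ₁
  have h01 : κ₀ < κ₁ := by rw [hκ₁]; linarith
  have h1m : κ₁ < (m : ℝ) - 1 := by rw [hκ₁]; linarith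
  set η := (κ₁ - κ₀) / (κ₀ + 1) with hη
  have hη0 : 0 < η := div_pos (by linarith) (by linarith)
  have hηκ : κ₀ * (1 + η) < κ₁ := by
    have h2 : η * (κ₀ + 1) = κ₁ - κ₀ := by rw [hη]; field_simp
    nlinarith
  have hηκ' : κ * (1 + η) < κ₁ :=
    (mul_le_mul_of_nonneg_right (le_max_left _ _) (by positivity)).trans_lt hηκ
  obtain ⟨θ, C, T₁, hθ, hC, hbad⟩ := exists_volume_badShifts_le hm ha hi hk ξ
    (hκ₀0.trans h01.le) h1m hη0
  obtain ⟨J₀, hJ₀⟩ := pow_unbounded_of_one_lt T₁ (one_lt_two : (1 : ℝ) < 2)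
  let s : ℕ → Set (Fin (m + 1) → ℝ) := fun j =>
    badShifts a ξ (((2 : ℝ) ^ (j + J₀)) ^ (1 + η)) (((2 : ℝ) ^ (j + J₀)) ^ (-κ₁))
  have hs : ∑' j, volume (s j) ≠ ⊤ := by
    have hr1 : (2 : ℝ) ^ (-θ) < 1 := Real.rpow_lt_one_of_one_lt_of_neg one_lt_two (by linarith)
    have hsm : Summable fun j : ℕ => C * ((2 : ℝ) ^ (-θ)) ^ (j + J₀) :=
      (((summable_nat_add_iff J₀).2 (summable_geometric_of_lt_one (by positivity) hr1))).mul_left C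
    refine ne_top_of_le_ne_top hsm.tsum_ofReal_ne_top (ENNReal.tsum_le_tsum fun j => ?_)
    have h2 : ((2 : ℝ) ^ (-θ)) ^ (j + J₀) = ((2 : ℝ) ^ (j + J₀)) ^ (-θ) := by
      rw [← Real.rpow_natCast, ← Real.rpow_natCast, ← Real.rpow_mul (by norm_num),
        ← Real.rpow_mul (by norm_num), mul_comm]
    rw [h2]
    refine hbad _ (hJ₀.le.trans ?_)
    exact pow_le_pow_right₀ one_le_two (by omega)
  refine ae_of_ae_unitBox ?_ ?_
  · rintro w x ⟨t₀, ht₀⟩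
    refine ⟨t₀, fun t ht => ?_⟩
    obtain ⟨v, hv1, hv2⟩ := ht₀ t ht
    have he : (fun i => ((v - w) i : ℝ)) + ((fun i => (w i : ℝ)) + x) =
        (fun i => (v i : ℝ)) + x := by
      funext i
      simp only [Pi.add_apply, Pi.sub_apply]
      push_cast
      ring
    refine ⟨v - w, fun i => ?_, ?_⟩
    · have := congrFun he i
      simp only [Pi.add_apply] at this ⊢
      rw [this]
      exact hv1 i
    · rw [he]; exact hv2
  · filter_upwards [ae_eventually_notMem hs] with x hx hxb
    obtain ⟨J, hJ⟩ := eventually_atTop.1 hx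
    obtain ⟨t₀, ht₀⟩ := exists_two_pow_rpow_le hη0 (hκ₀0.trans h01.le) hηκ' (J + J₀)
    refine ⟨t₀, fun t ht => ?_⟩
    obtain ⟨j, hj, hj1, hj2⟩ := ht₀ t ht
    have h3 := hJ (j - J₀) (by omega)
    simp only [s, badShifts, Nat.sub_add_cancel (by omega : J₀ ≤ j)] at h3
    by_contra! hcon
    refine h3 ⟨hxb, fun v hv => ?_⟩
    exact hj2.trans (hcon v fun i => (hv i).trans hj1)

theorem exists_congruent_diagonal {K : Type*} [Field K] [Invertible (2 : K)] {n : ℕ}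
    {S : Matrix (Fin n) (Fin n) K} (hS : S.IsSymm) :
    ∃ R : Matrix (Fin n) (Fin n) K, R.det ≠ 0 ∧ ∃ d : Fin n → K,
      Rᵀ * S * R = diagonal d := by
  have hB : LinearMap.IsSymm (Matrix.toBilin' S) := ⟨fun x y => by
    rw [Matrix.toBilin'_apply', Matrix.toBilin'_apply', dotProduct_mulVec, ← mulVec_transpose,
      hS.eq, dotProduct_comm]
    rfl⟩
  obtain ⟨v, hv⟩ := LinearMap.BilinForm.exists_orthogonal_basis hB
  set b := v.reindex (finCongr (Module.finrank_fin_fun K (n := n))) with hb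
  refine ⟨(Pi.basisFun K (Fin n)).toMatrix b, ?_, fun i => Matrix.toBilin' S (b i) (b i), ?_⟩
  · have := (Pi.basisFun K (Fin n)).isUnit_det b
    rw [Module.Basis.det_apply] at this
    exact this.ne_zero
  · ext i j
    have h : (((Pi.basisFun K (Fin n)).toMatrix b)ᵀ * S * (Pi.basisFun K (Fin n)).toMatrix b) i j
        = Matrix.toBilin' S (b i) (b j) := by
      rw [Matrix.toBilin'_apply', Matrix.mul_assoc]
      simp only [Matrix.mul_apply, dotProduct, mulVec, transpose_apply, Module.Basis.toMatrix_apply,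
        Pi.basisFun_repr]
    rw [h, diagonal_apply]
    split_ifs with hij
    · rw [hij]
    · rw [hb, Module.Basis.reindex_apply, Module.Basis.reindex_apply]
      exact hv (fun h => hij ((Equiv.injective _) h))

theorem exists_int_smul_eq {ι : Type*} [Finite ι] (f : ι → ℚ) :
    ∃ N : ℤ, N ≠ 0 ∧ ∃ g : ι → ℤ, ∀ i, (g i : ℚ) = N * f i := by
  obtain ⟨b, hb⟩ := IsLocalization.exist_integer_multiples_of_finite (nonZeroDivisors ℤ) f
  choose g hg using hb
  refine ⟨b, nonZeroDivisors.coe_ne_zero b, g, fun i => ?_⟩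
  have := hg i
  simpa [Algebra.smul_def] using this

theorem exists_int_congruent_diagonal {n : ℕ} {S : Matrix (Fin n) (Fin n) ℚ} (hS : S.IsSymm) :
    ∃ P : Matrix (Fin n) (Fin n) ℤ, P.det ≠ 0 ∧ ∃ a : Fin n → ℤ, ∃ N : ℚ, N ≠ 0 ∧
      N • ((P.map (fun z => (z : ℚ)))ᵀ * S * P.map (fun z => (z : ℚ))) =
        diagonal fun i => (a i : ℚ) := by
  have : Invertible (2 : ℚ) := invertibleOfNonzero two_ne_zero
  obtain ⟨R, hR, d, hd⟩ := exists_congruent_diagonal hS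
  obtain ⟨M, hM, g, hg⟩ := exists_int_smul_eq fun ij : Fin n × Fin n => R ij.1 ij.2
  obtain ⟨N, hN, a, ha⟩ := exists_int_smul_eq d
  have hP : (Matrix.of fun i j => g (i, j)).map (fun z => (z : ℚ)) = (M : ℚ) • R := by
    ext i j
    simp [hg]
  refine ⟨Matrix.of fun i j => g (i, j), ?_, a, N / (M : ℚ) ^ 2, ?_, ?_⟩
  · intro h
    have h1 := (Int.castRingHom ℚ).map_det (Matrix.of fun i j => g (i, j))
    rw [h, map_zero] at h1
    have h2 : (Int.castRingHom ℚ).mapMatrix (Matrix.of fun i j => g (i, j)) = (M : ℚ) • R := hP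
    rw [h2, det_smul] at h1
    exact mul_ne_zero (pow_ne_zero _ (Int.cast_ne_zero.2 hM)) hR h1.symm
  · exact div_ne_zero (Int.cast_ne_zero.2 hN) (pow_ne_zero _ (Int.cast_ne_zero.2 hM))
  · have hM' : (M : ℚ) ≠ 0 := Int.cast_ne_zero.2 hM
    rw [hP, transpose_smul, smul_mul, smul_mul, mul_smul_comm, hd, smul_smul, smul_smul]
    ext i j
    rw [Matrix.smul_apply, diagonal_apply, diagonal_apply]
    split_ifs
    · rw [ha, smul_eq_mul]; field_simp
    · exact smul_zero _

theorem IsRationalForm.exists_diagForm {n : ℕ} {Q : (Fin n → ℝ) → ℝ} (hQ : IsRationalForm Q) :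
    ∃ P : Matrix (Fin n) (Fin n) ℤ, P.det ≠ 0 ∧ ∃ a : Fin n → ℤ, ∃ l : ℝ, l ≠ 0 ∧
      ∀ x, Q ((P.map (fun z => (z : ℝ))).mulVec x) = l * diagForm a x := by
  obtain ⟨c, hc, J, hJ⟩ := hQ
  obtain ⟨P, hP, a, N, hN, h⟩ := exists_int_congruent_diagonal (S := J + Jᵀ)
    (by rw [IsSymm, transpose_add, transpose_transpose, add_comm])
  refine ⟨P, hP, a, c / (2 * N), by positivity, fun x => ?_⟩
  set PR := P.map (fun z => (z : ℝ)) with hPR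
  set JR := J.map (fun r => (r : ℝ)) with hJR
  have hR : (N : ℝ) • (PRᵀ * (JR + JRᵀ) * PR) = diagonal fun i => (a i : ℝ) := by
    have h1 := congrArg (Rat.castHom ℝ).mapMatrix h
    have h2 : (Rat.castHom ℝ).mapMatrix (P.map (fun z => (z : ℚ))) = PR := by
      ext i j; simp [hPR]
    have h3 : (Rat.castHom ℝ).mapMatrix (J + Jᵀ) = JR + JRᵀ := by
      ext i j; simp [hJR]
    have h4 : (Rat.castHom ℝ).mapMatrix ((P.map (fun z => (z : ℚ)))ᵀ) = PRᵀ := by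
      ext i j; simp [hPR]
    have h5 : ∀ X : Matrix (Fin n) (Fin n) ℚ, (Rat.castHom ℝ).mapMatrix (N • X) =
        (N : ℝ) • (Rat.castHom ℝ).mapMatrix X := fun X => by ext i j; simp
    rw [h5, map_mul, map_mul, h2, h3, h4] at h1
    rw [h1]
    ext i j
    simp only [RingHom.mapMatrix_apply, map_apply, diagonal_apply]
    split_ifs <;> simp
  have hsym : PR.mulVec x ⬝ᵥ JRᵀ.mulVec (PR.mulVec x) = PR.mulVec x ⬝ᵥ JR.mulVec (PR.mulVec x) := by
    rw [mulVec_transpose, dotProduct_comm, ← dotProduct_mulVec]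
  have hx : (N : ℝ) * (2 * (PR.mulVec x ⬝ᵥ JR.mulVec (PR.mulVec x))) = diagForm a x := by
    have h1 : x ⬝ᵥ ((N : ℝ) • (PRᵀ * (JR + JRᵀ) * PR)).mulVec x = diagForm a x := by
      rw [hR, diagForm, dotProduct]
      refine Finset.sum_congr rfl fun j _ => ?_
      rw [mulVec_diagonal]; ring
    rw [← h1, smul_mulVec, dotProduct_smul, smul_eq_mul, Matrix.mul_assoc, ← mulVec_mulVec,
      ← mulVec_mulVec, mulVec_transpose, dotProduct_comm x, ← dotProduct_mulVec, dotProduct_comm,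
      add_mulVec, add_dotProduct, dotProduct_comm (JRᵀ.mulVec _), hsym,
      dotProduct_comm (JR.mulVec _)]
    ring
  rw [hJ, ← hx]
  have : (N : ℝ) ≠ 0 := Rat.cast_ne_zero.2 hN
  field_simp

theorem kappa1_le {n : ℕ} (hn : 3 ≤ n) : kappa1 n ≤ 1 / ((n : ℝ) - 2) := by
  have h : (3 : ℝ) ≤ n := by exact_mod_cast hn
  rw [kappa1]
  split_ifs
  · exact one_div_le_one_div_of_le (by linarith) (by linarith)
  · exact one_div_le_one_div_of_le (by linarith) (by linarith)
  · exact le_rfl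
  · exact one_div_le_one_div_of_le (by linarith) (by linarith)

theorem kappa0_le {p q : ℕ} (hq : 1 ≤ q) (hpq : q ≤ p) (hn : 3 ≤ p + q) :
    kappa0 p q ≤ (p : ℝ) + q - 2 := by
  have hn' : (3 : ℝ) ≤ p + q := by exact_mod_cast hn
  rw [kappa0]
  split_ifs with h1 h2 h3 h4
  · linarith
  · simp only [Prod.mk.injEq] at h2
    rw [h2.1, h2.2]; norm_num
  · simp only [Prod.mk.injEq] at h3
    rcases h3 with h3 | h3 <;> (rw [h3.1, h3.2]; norm_num)
  · simp only [Prod.mk.injEq] at h4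
    rw [h4.1, h4.2]; norm_num
  · have h5 : 5 ≤ p + q := by
      simp only [Prod.mk.injEq] at h2
      omega
    have h5' : (5 : ℝ) ≤ p + q := by exact_mod_cast h5
    have hq' : (1 : ℝ) ≤ q := by exact_mod_cast hq
    have hp' : (1 : ℝ) ≤ p := by exact_mod_cast hq.trans hpq
    have hk := kappa1_le hn
    push_cast at hk
    have hqp : (0 : ℝ) ≤ q * (p - 1) := mul_nonneg (by linarith) (by linarith)
    calc 2 * kappa1 (p + q) * q * ((p : ℝ) - 1) = kappa1 (p + q) * (2 * (q * (p - 1))) := by ring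
      _ ≤ 1 / ((p : ℝ) + q - 2) * (2 * (q * (p - 1))) := by gcongr
      _ ≤ (p : ℝ) + q - 2 := by
        rw [one_div_mul_eq_div, div_le_iff₀ (by linarith)]
        nlinarith [sq_nonneg ((p : ℝ) - 1 - q)]

theorem exists_pos_of_diagForm_pos {n : ℕ} {a : Fin n → ℤ} {x : Fin n → ℝ}
    (h : 0 < diagForm a x) : ∃ j, 0 < a j := by
  by_contra! hc
  refine h.not_ge (Finset.sum_nonpos fun j _ => mul_nonpos_of_nonpos_of_nonneg ?_ (sq_nonneg _))
  exact_mod_cast hc j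

theorem exists_neg_of_diagForm_neg {n : ℕ} {a : Fin n → ℤ} {x : Fin n → ℝ}
    (h : diagForm a x < 0) : ∃ j, a j < 0 := by
  by_contra! hc
  refine h.not_ge (Finset.sum_nonneg fun j _ => mul_nonneg ?_ (sq_nonneg _))
  exact_mod_cast hc j

theorem HasSignature.exists_eq_one {n p q : ℕ} {Q : (Fin n → ℝ) → ℝ} (hQ : HasSignature Q p q)
    (hp : 1 ≤ p) : ∃ x, Q x = 1 := by
  obtain ⟨hn, g, -, hg⟩ := hQ
  refine ⟨_, (hg (Pi.single ⟨0, by omega⟩ 1)).trans ?_⟩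
  rw [Finset.sum_eq_single_of_mem ⟨0, by omega⟩ (Finset.mem_univ _)]
  · simp [Nat.one_le_iff_ne_zero.1 hp]
  · intro i _ hi
    simp [Pi.single_eq_of_ne hi]

theorem HasSignature.exists_eq_neg_one {n p q : ℕ} {Q : (Fin n → ℝ) → ℝ}
    (hQ : HasSignature Q p q) (hq : 1 ≤ q) : ∃ x, Q x = -1 := by
  obtain ⟨hn, g, -, hg⟩ := hQ
  refine ⟨_, (hg (Pi.single ⟨p, by omega⟩ 1)).trans ?_⟩
  rw [Finset.sum_eq_single_of_mem ⟨p, by omega⟩ (Finset.mem_univ _)]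
  · simp
  · intro i _ hi
    simp [Pi.single_eq_of_ne hi]

theorem det_map_intCast_ne_zero {n : ℕ} {P : Matrix (Fin n) (Fin n) ℤ} (hP : P.det ≠ 0) :
    (P.map fun z => (z : ℝ)).det ≠ 0 := by
  have h := (Int.castRingHom ℝ).map_det P
  rw [RingHom.mapMatrix_apply] at h
  exact fun h0 => hP (Int.cast_eq_zero.1 (h.trans h0))

theorem IsNondegQuadForm.coeff_ne_zero {n : ℕ} {Q : (Fin n → ℝ) → ℝ} (hQ : IsNondegQuadForm Q)
    {P : Matrix (Fin n) (Fin n) ℝ} (hP : P.det ≠ 0) {a : Fin n → ℤ} {l : ℝ}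
    (h : ∀ x, Q (P.mulVec x) = l * diagForm a x) (j : Fin n) : a j ≠ 0 := by
  intro hj
  obtain ⟨J, hJs, hJ, hJQ⟩ := hQ
  set u := P.mulVec (Pi.single j 1) with hu
  have hdiag : ∀ x, diagForm a (x + Pi.single j 1) = diagForm a x := fun x =>
    Finset.sum_congr rfl fun k _ => by
      rcases eq_or_ne k j with rfl | hk
      · simp [hj]
      · simp [Pi.single_eq_of_ne hk]
  have hQu : Q u = 0 := by
    rw [hu, h, ← zero_add (Pi.single j 1 : Fin n → ℝ), hdiag]
    simp [diagForm]
  have hJu : ∀ x, P.mulVec x ⬝ᵥ J.mulVec u = 0 := fun x => by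
    have h1 : Q (P.mulVec x + u) = Q (P.mulVec x) := by
      rw [hu, ← mulVec_add, h, h, hdiag]
    have h2 : u ⬝ᵥ J.mulVec (P.mulVec x) = P.mulVec x ⬝ᵥ J.mulVec u := by
      rw [dotProduct_mulVec, ← mulVec_transpose, hJs.eq, dotProduct_comm]
    rw [hJQ, mulVec_add, dotProduct_add, add_dotProduct, add_dotProduct, h2, ← hJQ, ← hJQ,
      hQu] at h1
    linarith
  have hPu : IsUnit P.det := hP.isUnit
  have hJu0 : J.mulVec u = 0 := by
    have := hJu (P⁻¹.mulVec (J.mulVec u))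
    rw [mulVec_mulVec, mul_nonsing_inv _ hPu, one_mulVec] at this
    exact dotProduct_self_eq_zero.1 this
  have hu0 : u = 0 := eq_zero_of_mulVec_eq_zero hJ.ne_zero hJu0
  have := congrFun (eq_zero_of_mulVec_eq_zero hP hu0) j
  simp at this

theorem exists_signs {n p q : ℕ} (hq : 1 ≤ q) (hpq : q ≤ p) {Q : (Fin n → ℝ) → ℝ}
    (hQ : HasSignature Q p q) {P : Matrix (Fin n) (Fin n) ℝ} (hP : P.det ≠ 0) {a : Fin n → ℤ}
    {l : ℝ} (hl : l ≠ 0) (h : ∀ x, Q (P.mulVec x) = l * diagForm a x) :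
    (∃ j, 0 < a j) ∧ ∃ j, a j < 0 := by
  have hsurj : ∀ x, Q x = l * diagForm a (P⁻¹.mulVec x) := fun x => by
    rw [← h, mulVec_mulVec, mul_nonsing_inv _ hP.isUnit, one_mulVec]
  obtain ⟨x, hx⟩ := hQ.exists_eq_one (hq.trans hpq)
  obtain ⟨y, hy⟩ := hQ.exists_eq_neg_one hq
  rw [hsurj] at hx hy
  rcases hl.lt_or_gt with hl | hl
  · exact ⟨exists_pos_of_diagForm_pos (x := P⁻¹.mulVec y) (by nlinarith),
      exists_neg_of_diagForm_neg (x := P⁻¹.mulVec x) (by nlinarith)⟩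
  · exact ⟨exists_pos_of_diagForm_pos (x := P⁻¹.mulVec x) (by nlinarith),
      exists_neg_of_diagForm_neg (x := P⁻¹.mulVec y) (by nlinarith)⟩

theorem eunorm_le_sum_abs {n : ℕ} (x : Fin n → ℝ) : eunorm x ≤ ∑ i, |x i| := by
  rw [eunorm, Real.sqrt_le_left (Finset.sum_nonneg fun _ _ => abs_nonneg _)]
  simp_rw [← sq_abs (x _)]
  exact Finset.sum_sq_le_sq_sum_of_nonneg fun _ _ => abs_nonneg _

theorem eunorm_mulVec_le {n : ℕ} (P : Matrix (Fin n) (Fin n) ℝ) (x : Fin n → ℝ) {r : ℝ}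
    (hx : ∀ j, |x j| ≤ r) : eunorm (P.mulVec x) ≤ (∑ i, ∑ j, |P i j|) * r := by
  refine (eunorm_le_sum_abs _).trans ?_
  rw [Finset.sum_mul]
  refine Finset.sum_le_sum fun i _ => ?_
  rw [Finset.sum_mul, mulVec, dotProduct]
  refine (Finset.abs_sum_le_sum_abs _ _).trans ?_
  refine Finset.sum_le_sum fun j _ => ?_
  rw [abs_mul]
  exact mul_le_mul_of_nonneg_left (hx j) (abs_nonneg _)

theorem exists_forall_mul_rpow_le {κ κ₂ : ℝ} (h : κ < κ₂) (C : ℝ) {L : ℝ} (hL : 0 < L) :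
    ∃ t₀ : ℝ, ∀ t ≥ t₀, C * (t / L) ^ (-κ₂) ≤ t ^ (-κ) := by
  have h1 := (tendsto_rpow_atTop (sub_pos.2 h)).eventually_ge_atTop (C * L ^ κ₂)
  obtain ⟨t₀, ht₀⟩ := eventually_atTop.1 (h1.and (eventually_gt_atTop (0 : ℝ)))
  refine ⟨t₀, fun t ht => ?_⟩
  obtain ⟨h2, h3⟩ := ht₀ t ht
  rw [Real.div_rpow h3.le hL.le, Real.rpow_neg hL.le, div_inv_eq_mul,
    show -κ = (κ₂ - κ) + -κ₂ by ring, Real.rpow_add h3]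
  calc C * (t ^ (-κ₂) * L ^ κ₂) = C * L ^ κ₂ * t ^ (-κ₂) := by ring
    _ ≤ _ := mul_le_mul_of_nonneg_right h2 (Real.rpow_nonneg h3.le _)

theorem exists_near_of_diagForm_near {n : ℕ} {Q : (Fin n → ℝ) → ℝ}
    {P : Matrix (Fin n) (Fin n) ℤ} {a : Fin n → ℤ} {l : ℝ} (hl : l ≠ 0)
    (h : ∀ x, Q ((P.map fun z => (z : ℝ)).mulVec x) = l * diagForm a x) {ξ κ κ₂ : ℝ}
    (hκ : κ < κ₂) {β : Fin n → ℝ}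
    (hβ : ∃ t₀ : ℝ, ∀ t ≥ t₀, ∃ v : Fin n → ℤ, (∀ i, |v i + β i| ≤ t) ∧
      |diagForm a ((fun i => (v i : ℝ)) + β) - ξ / l| < t ^ (-κ₂)) :
    ∃ t₀ : ℝ, ∀ t ≥ t₀, ∃ v : Fin n → ℤ, eunorm (fun i => (v i : ℝ)) ≤ t ∧
      |Q ((fun i => (v i : ℝ)) + (P.map fun z => (z : ℝ)).mulVec β) - ξ| < t ^ (-κ) := by
  set R := P.map fun z => (z : ℝ) with hR
  set A := ∑ i, ∑ j, |R i j|
  set b := ∑ j, |β j|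
  have hA : 0 ≤ A := Finset.sum_nonneg fun _ _ => Finset.sum_nonneg fun _ _ => abs_nonneg _
  obtain ⟨t₁, h₁⟩ := hβ
  obtain ⟨t₂, h₂⟩ := exists_forall_mul_rpow_le hκ |l| (by positivity : 0 < 2 * (A + 1))
  refine ⟨max (max (2 * (A + 1) * t₁) t₂) (2 * (A * b)), fun t ht => ?_⟩
  have ht₁ : 2 * (A + 1) * t₁ ≤ t := (le_max_left _ _).trans ((le_max_left _ _).trans ht)
  have ht₂ : t₂ ≤ t := (le_max_right _ _).trans ((le_max_left _ _).trans ht)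
  have ht₃ : 2 * (A * b) ≤ t := (le_max_right _ _).trans ht
  have ht₀ : 0 ≤ t := le_trans (by positivity) ht₃
  obtain ⟨v, hv, hQ⟩ := h₁ (t / (2 * (A + 1))) (by
    rw [ge_iff_le, le_div_iff₀ (by positivity)]; linarith)
  have hPv : (fun i => ((P.mulVec v i : ℤ) : ℝ)) = R.mulVec fun i => (v i : ℝ) := by
    ext i
    simp [hR, mulVec, dotProduct]
  refine ⟨P.mulVec v, ?_, ?_⟩
  · rw [hPv]
    refine (eunorm_mulVec_le R _ (r := t / (2 * (A + 1)) + b) fun j => ?_).trans ?_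
    · have h3 : |β j| ≤ b := Finset.single_le_sum (f := fun j => |β j|)
        (fun _ _ => abs_nonneg _) (Finset.mem_univ j)
      calc |(v j : ℝ)| = |(v j + β j) - β j| := by rw [add_sub_cancel_right]
        _ ≤ |v j + β j| + |β j| := abs_sub _ _
        _ ≤ _ := add_le_add (hv j) h3
    · have h4 : A * (t / (2 * (A + 1))) ≤ t / 2 := by
        rw [← mul_div_assoc, div_le_div_iff₀ (by positivity) (by positivity)]
        nlinarith
      rw [mul_add]
      linarith
  · rw [hPv, ← mulVec_add, h]
    calc |l * diagForm a ((fun i => (v i : ℝ)) + β) - ξ|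
        = |l| * |diagForm a ((fun i => (v i : ℝ)) + β) - ξ / l| := by
          rw [← abs_mul, mul_sub, mul_div_cancel₀ _ hl]
      _ < |l| * (t / (2 * (A + 1))) ^ (-κ₂) := mul_lt_mul_of_pos_left hQ (abs_pos.2 hl)
      _ ≤ _ := h₂ t ht₂

/-- **Theorem 1.1** (effective Oppenheim for generic shifts).
For any rational indefinite nondegenerate form `Q` of signature `(p,q)` and any `ξ ∈ ℝ`,
for any `κ < κ₀(p,q)`, for almost all `α ∈ ℝⁿ` the system
`|Q(v+α) − ξ| < t^{−κ}`, `‖v‖ ≤ t` has integer solutions for all sufficiently large `t`. -/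
theorem oppenheim_generic_shifts
    {n p q : ℕ} (hq : 1 ≤ q) (hpq : q ≤ p) (hn3 : 3 ≤ n)
    (Q : (Fin n → ℝ) → ℝ) (hQ : IsNondegQuadForm Q) (hsig : HasSignature Q p q)
    (hrat : IsRationalForm Q) (ξ : ℝ) :
    ∀ κ : ℝ, κ < kappa0 p q →
      ∀ᵐ α ∂(volume : Measure (Fin n → ℝ)), ∃ t₀ : ℝ, ∀ t ≥ t₀,
        ∃ v : Fin n → ℤ, eunorm (fun i => (v i : ℝ)) ≤ t ∧
          |Q ((fun i => (v i : ℝ)) + α) - ξ| < t ^ (-κ) := by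
  intro κ hκ
  obtain ⟨P, hP, a, l, hl, h⟩ := hrat.exists_diagForm
  have hPR := det_map_intCast_ne_zero hP
  have ha := hQ.coeff_ne_zero hPR h
  obtain ⟨⟨i, hi⟩, ⟨j, hj⟩⟩ := exists_signs hq hpq hsig hPR hl h
  obtain ⟨m, rfl⟩ : ∃ m, n = m + 1 := ⟨n - 1, by omega⟩
  obtain ⟨k, rfl⟩ := Fin.exists_succAbove_eq (x := j) (y := i) (by rintro rfl; omega)
  have hκm : κ < (m : ℝ) - 1 := by
    have h1 := kappa0_le hq hpq (by rw [hsig.1]; exact hn3)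
    have h2 : (p : ℝ) + q = m + 1 := by exact_mod_cast hsig.1
    linarith
  obtain ⟨κ₂, hκ₂, hκ₂m⟩ := exists_between hκm
  have hnear := ae_diagForm_near (by omega) ha hi hj (ξ / l) hκ₂m
  set R := P.map fun z => (z : ℝ)
  have hdet : LinearMap.det (Matrix.toLin' R⁻¹) ≠ 0 := by
    rw [LinearMap.det_toLin']
    exact (R.isUnit_nonsing_inv_det hPR.isUnit).ne_zero
  filter_upwards [(Measure.LinearMap.quasiMeasurePreserving volume _ hdet).ae hnear] with α hα
  have := exists_near_of_diagForm_near hl h hκ₂ hα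
  rwa [toLin'_apply, mulVec_mulVec, mul_nonsing_inv _ hPR.isUnit, one_mulVec] at this
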